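/- arXiv:2011.00039 — 6 statements merged into one kernel-verified Lean document; each statement's English description precedes it below -/
import Mathlib

section
/- Let ν ∈ (0,1/2], a ∈ [0, 1/2 − ν], c(a) = 1/2 − a, λ_{ν,a} = √(c(a)² − ν²)/c(a), and let μ ∈ (−1, λ_{ν,a}]. Then for every η ∈ C_c^∞(ℝ²∖{0},ℂ), ∫_{ℝ²} ( 4 |∂_{z̄}η(x)|² / (1 + μ + ν/|x|) + (1 − μ − ν/|x|) |η(x)|² ) |x|^{−2a} dx ≥ 0. -/
open MeasureTheory

/-- The Wirtinger derivative `∂_{z̄} η = (1/2)(∂₁ η + i ∂₂ η)`, identifying `ℝ²` with `ℂ`. -/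
noncomputable def wirtingerZbar (η : ℂ → ℂ) (x : ℂ) : ℂ :=
  (1/2 : ℂ) * (fderiv ℝ η x 1 + Complex.I * fderiv ℝ η x Complex.I)

section

open intervalIntegral Filter Topology

theorem exists_slope {ν c μ : ℝ} (hν : 0 < ν) (hνc : ν ≤ c)
    (hμ' : μ ≤ √(c ^ 2 - ν ^ 2) / c) :
    ∃ t : ℝ, 0 ≤ t ∧ ν * t ^ 2 + ν = 2 * c * t ∧ t ^ 2 * (1 + μ) ≤ 1 - μ := by
  have hc : 0 < c := hν.trans_le hνc
  have hs0 := Real.sqrt_nonneg (c ^ 2 - ν ^ 2)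
  have hs2 : √(c ^ 2 - ν ^ 2) ^ 2 = c ^ 2 - ν ^ 2 := Real.sq_sqrt (by nlinarith)
  set s := √(c ^ 2 - ν ^ 2)
  have hsc : s ≤ c := by nlinarith
  rw [le_div_iff₀ hc] at hμ'
  refine ⟨(c - s) / ν, div_nonneg (by linarith) hν.le, ?_, ?_⟩
  · field_simp
    linear_combination hs2
  · rw [div_pow, div_mul_eq_mul_div, div_le_iff₀ (by positivity)]
    have : ν ^ 2 = (c - s) * (c + s) := by linear_combination hs2
    rw [this]
    nlinarith [mul_nonneg (sub_nonneg.2 hsc) (sub_nonneg.2 hμ')]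

theorem exists_slope_of_mode {ν c μ : ℝ} (hν : 0 < ν) (hνc : ν ≤ c) (hc : c ≤ 1 / 2)
    (hμ' : μ ≤ √(c ^ 2 - ν ^ 2) / c) (k : ℤ) :
    ∃ α : ℝ, ∀ r : ℝ, 0 < r →
      0 ≤ -2 * α * (k + c) / r - α ^ 2 * (1 + μ + ν / r) + (1 - μ - ν / r) := by
  obtain ⟨t, ht, h1, h2⟩ := exists_slope hν hνc hμ'
  have key : ∀ α : ℝ, α ^ 2 = t ^ 2 → 2 * c * t ≤ -2 * α * (k + c) → ∀ r : ℝ, 0 < r →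
      0 ≤ -2 * α * (k + c) / r - α ^ 2 * (1 + μ + ν / r) + (1 - μ - ν / r) := by
    intro α hα hk r hr
    have e : -2 * α * (k + c) / r - α ^ 2 * (1 + μ + ν / r) + (1 - μ - ν / r)
        = (-2 * α * (k + c) - 2 * c * t) / r + (1 - μ - t ^ 2 * (1 + μ)) := by
      rw [hα, ← h1]
      field_simp
      ring
    rw [e]
    exact add_nonneg (div_nonneg (by linarith) hr.le) (by linarith)
  rcases le_or_gt 0 k with hk | hk
  · have hk' : (0 : ℝ) ≤ k := by exact_mod_cast hk
    exact ⟨-t, key (-t) (by ring) (by nlinarith [mul_nonneg ht hk'])⟩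
  · have hk' : (k : ℝ) ≤ -1 := by exact_mod_cast Int.le_sub_one_of_lt hk
    exact ⟨t, key t rfl (by nlinarith [mul_nonneg ht (by linarith : 0 ≤ -(k + c) - c)])⟩

theorem radial_integrand_lower_bound {w α : ℝ} (hw : 0 < w) (u A : ℂ) :
    2 * α * inner ℝ u A - α ^ 2 * w * ‖u‖ ^ 2 ≤ ‖A‖ ^ 2 / w := by
  rw [le_div_iff₀ hw]
  have h : 0 ≤ ‖A - (α * w) • u‖ ^ 2 := by positivity
  rw [norm_sub_sq_real, norm_smul, inner_smul_right, real_inner_comm, mul_pow, Real.norm_eq_abs,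
    sq_abs] at h
  nlinarith

theorem one_add_add_div_pos {ν μ r : ℝ} (hν : 0 < ν) (hμ : -1 < μ) (hr : 0 < r) :
    0 < 1 + μ + ν / r := by
  have := div_pos hν hr
  linarith

theorem radial_integral_nonneg {ν a μ ε M : ℝ} (hν : 0 < ν) (hνa : ν ≤ 1 / 2 - a) (ha : 0 ≤ a)
    (hμ : -1 < μ) (hμ' : μ ≤ √((1 / 2 - a) ^ 2 - ν ^ 2) / (1 / 2 - a)) (k : ℤ)
    (hε : 0 < ε) (hM : ε ≤ M) {φ φ' : ℝ → ℂ} (hφ : ∀ r, HasDerivAt φ (φ' r) r)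
    (hφ' : Continuous φ') (hφε : φ ε = 0) (hφM : φ M = 0) :
    0 ≤ ∫ r in ε..M, r ^ (1 - 2 * a) * (‖φ' r - (k / r : ℝ) • φ r‖ ^ 2 / (1 + μ + ν / r)
      + (1 - μ - ν / r) * ‖φ r‖ ^ 2) := by
  obtain ⟨α, hα⟩ := exists_slope_of_mode hν hνa (by linarith) hμ' k
  have hφc : Continuous φ := continuous_iff_continuousAt.2 fun r => (hφ r).continuousAt
  have hpos : ∀ r ∈ Set.uIcc ε M, 0 < r := fun r hr => by
    rw [Set.uIcc_of_le hM] at hr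
    exact hε.trans_le hr.1
  have hder : ∀ r ∈ Set.uIcc ε M, HasDerivAt (fun r => α * r ^ (1 - 2 * a) * ‖φ r‖ ^ 2)
      (α * ((1 - 2 * a) * r ^ (1 - 2 * a - 1)) * ‖φ r‖ ^ 2
        + α * r ^ (1 - 2 * a) * (2 * inner ℝ (φ r) (φ' r))) r := fun r hr =>
    ((Real.hasDerivAt_rpow_const (Or.inl (hpos r hr).ne')).const_mul α).mul (hφ r).norm_sq
  have hcont : ContinuousOn (fun r => α * ((1 - 2 * a) * r ^ (1 - 2 * a - 1)) * ‖φ r‖ ^ 2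
        + α * r ^ (1 - 2 * a) * (2 * inner ℝ (φ r) (φ' r))) (Set.uIcc ε M) := by
    have h1 : ∀ p : ℝ, ContinuousOn (fun r : ℝ => r ^ p) (Set.uIcc ε M) := fun p r hr =>
      (Real.continuousAt_rpow_const r p (Or.inl (hpos r hr).ne')).continuousWithinAt
    have := h1 (1 - 2 * a - 1)
    have := h1 (1 - 2 * a)
    fun_prop
  have hFTC := integral_eq_sub_of_hasDerivAt hder hcont.intervalIntegrable
  rw [hφε, hφM] at hFTC
  simp only [norm_zero, ne_eq, OfNat.ofNat_ne_zero, not_false_eq_true, zero_pow, mul_zero,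
    sub_zero] at hFTC
  rw [← hFTC]
  have hcont' : ContinuousOn (fun r => r ^ (1 - 2 * a) * (‖φ' r - (k / r : ℝ) • φ r‖ ^ 2 /
      (1 + μ + ν / r) + (1 - μ - ν / r) * ‖φ r‖ ^ 2)) (Set.uIcc ε M) := by
    have h1 : ContinuousOn (fun r : ℝ => r ^ (1 - 2 * a)) (Set.uIcc ε M) := fun r hr =>
      (Real.continuousAt_rpow_const r _ (Or.inl (hpos r hr).ne')).continuousWithinAt
    have h2 : ∀ r ∈ Set.uIcc ε M, r ≠ 0 := fun r hr => (hpos r hr).ne'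
    have h3 : ∀ r ∈ Set.uIcc ε M, 1 + μ + ν / r ≠ 0 := fun r hr =>
      (one_add_add_div_pos hν hμ (hpos r hr)).ne'
    fun_prop (disch := assumption)
  refine integral_mono_on hM hcont.intervalIntegrable hcont'.intervalIntegrable fun r hr => ?_
  have hr0 : 0 < r := hε.trans_le hr.1
  have hlow := radial_integrand_lower_bound (α := α) (one_add_add_div_pos hν hμ hr0)
    (φ r) (φ' r - (k / r : ℝ) • φ r)
  rw [inner_sub_right, inner_smul_right, real_inner_self_eq_norm_sq] at hlow
  have hp : r ^ (1 - 2 * a - 1) = r ^ (1 - 2 * a) / r := by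
    rw [Real.rpow_sub hr0, Real.rpow_one]
  have hw : 0 ≤ r ^ (1 - 2 * a) := by positivity
  rw [hp]
  have hq := mul_nonneg (hα r hr0) (sq_nonneg ‖φ r‖)
  have e : α * ((1 - 2 * a) * (r ^ (1 - 2 * a) / r)) * ‖φ r‖ ^ 2
        + α * r ^ (1 - 2 * a) * (2 * inner ℝ (φ r) (φ' r))
      = r ^ (1 - 2 * a) * (α * (1 - 2 * a) / r * ‖φ r‖ ^ 2 + 2 * α * inner ℝ (φ r) (φ' r)) := by
    ring
  rw [e]
  refine mul_le_mul_of_nonneg_left ?_ hw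
  have e2 : (-2 * α * (k + (1 / 2 - a)) / r) = -2 * α * (k / r) - α * (1 - 2 * a) / r := by ring
  rw [e2] at hq
  linarith

/-- The `k`-th Fourier integral of `h` over `(-π, π)`, without normalisation. -/
noncomputable def circleCoeff (h : ℝ → ℂ) (k : ℤ) : ℂ :=
  ∫ θ in (-Real.pi)..Real.pi, Complex.exp (-(k * θ * Complex.I)) * h θ

theorem hasSum_sq_circleCoeff {h : ℝ → ℂ} (hh : Continuous h) :
    HasSum (fun k => ‖circleCoeff h k‖ ^ 2)
      (2 * Real.pi * ∫ θ in (-Real.pi)..Real.pi, ‖h θ‖ ^ 2) := by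
  have hπ := Real.pi_pos
  have hab : -Real.pi < Real.pi := by linarith
  have hL : MemLp h 2 (volume.restrict (Set.Ioc (-Real.pi) Real.pi)) :=
    (memLp_two_iff_integrable_sq_norm hh.aestronglyMeasurable).2
      (by fun_prop : Continuous fun θ => ‖h θ‖ ^ 2).integrableOn_Ioc
  have hc : ∀ k, ‖circleCoeff h k‖ ^ 2 = (2 * Real.pi) ^ 2 * ‖fourierCoeffOn hab h k‖ ^ 2 := by
    intro k
    have h1 : circleCoeff h k =
        ∫ x in (-Real.pi)..Real.pi, fourier (-k) (x : AddCircle (Real.pi - -Real.pi)) • h x := by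
      refine integral_congr fun θ _ => ?_
      simp only [fourier_coe_apply, smul_eq_mul]
      congr 2
      have : (Real.pi : ℂ) ≠ 0 := by exact_mod_cast hπ.ne'
      push_cast
      field_simp
      ring
    have h2 : (2 * Real.pi) ^ 2 * ‖1 / (Real.pi - -Real.pi)‖ ^ 2 = 1 := by
      rw [Real.norm_eq_abs, sq_abs]
      field_simp
      ring
    rw [fourierCoeffOn_eq_integral, norm_smul, mul_pow ‖_‖, h1, ← mul_assoc, h2, one_mul]
  have hs : 2 * Real.pi * ∫ θ in (-Real.pi)..Real.pi, ‖h θ‖ ^ 2 = (2 * Real.pi) ^ 2 *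
      ((Real.pi - -Real.pi)⁻¹ • ∫ θ in (-Real.pi)..Real.pi, ‖h θ‖ ^ 2) := by
    rw [smul_eq_mul]
    field_simp
    ring
  simp only [hc, hs]
  exact (hasSum_sq_fourierCoeffOn hab hL).mul_left _

theorem circleCoeff_deriv {h h' : ℝ → ℂ} (hd : ∀ θ, HasDerivAt h (h' θ) θ) (hh' : Continuous h')
    (hper : h (-Real.pi) = h Real.pi) (k : ℤ) :
    circleCoeff h' k = k * Complex.I * circleCoeff h k := by
  have hh : Continuous h := continuous_iff_continuousAt.2 fun r => (hd r).continuousAt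
  have he : ∀ θ : ℝ, HasDerivAt (fun θ : ℝ => Complex.exp (-(k * θ * Complex.I)))
      (Complex.exp (-(k * θ * Complex.I)) * (-(k * Complex.I))) θ := fun θ => by
    have := (((Complex.ofRealCLM.hasDerivAt (x := θ)).const_mul (k : ℂ)).mul_const
      Complex.I).neg.cexp
    simpa using this
  have hI := integral_eq_sub_of_hasDerivAt (a := -Real.pi) (b := Real.pi)
    (fun θ _ => (he θ).mul (hd θ)) (Continuous.intervalIntegrable (by fun_prop) _ _)
  rw [integral_add (Continuous.intervalIntegrable (by fun_prop) _ _)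
    (Continuous.intervalIntegrable (by fun_prop) _ _)] at hI
  have hb : Complex.exp (-(k * ((-Real.pi : ℝ) : ℂ) * Complex.I))
      = Complex.exp (-(k * (Real.pi : ℂ) * Complex.I)) := by
    rw [Complex.exp_eq_exp_iff_exists_int]
    exact ⟨k, by push_cast; ring⟩
  simp only [Pi.mul_apply, hb, hper, sub_self] at hI
  have e : ∀ θ : ℝ, Complex.exp (-(k * θ * Complex.I)) * (-(k * Complex.I)) * h θ
      = -(k * Complex.I) * (Complex.exp (-(k * θ * Complex.I)) * h θ) := fun θ => by ring
  simp only [e, intervalIntegral.integral_const_mul] at hI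
  rw [circleCoeff, circleCoeff]
  linear_combination hI

theorem continuous_circleCoeff {F : ℝ → ℝ → ℂ} (hF : Continuous F.uncurry) (k : ℤ) :
    Continuous fun r => circleCoeff (F r) k := by
  unfold circleCoeff
  refine continuous_parametric_intervalIntegral_of_continuous' ?_ _ _
  have : Continuous fun p : ℝ × ℝ => F p.1 p.2 := hF
  show Continuous fun p : ℝ × ℝ => Complex.exp (-(k * p.2 * Complex.I)) * F p.1 p.2
  fun_prop

theorem hasDerivAt_circleCoeff {F F' : ℝ → ℝ → ℂ} (hF : Continuous F.uncurry)
    (hF' : Continuous F'.uncurry) (hd : ∀ r θ, HasDerivAt (F · θ) (F' r θ) r) (k : ℤ) (r : ℝ) :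
    HasDerivAt (fun r => circleCoeff (F r) k) (circleCoeff (F' r) k) r := by
  have h1 : Continuous fun p : ℝ × ℝ => F p.1 p.2 := hF
  have h2 : Continuous fun p : ℝ × ℝ => F' p.1 p.2 := hF'
  have h3 : ∀ r, Continuous (F r) := fun r => h1.comp (by fun_prop : Continuous fun θ => (r, θ))
  have h4 : ∀ r, Continuous (F' r) := fun r => h2.comp (by fun_prop : Continuous fun θ => (r, θ))
  obtain ⟨C, hC⟩ := ((isCompact_closedBall r 1).prod
    (isCompact_uIcc (a := -Real.pi) (b := Real.pi))).exists_bound_of_continuousOn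
    (f := fun p : ℝ × ℝ => Complex.exp (-(k * p.2 * Complex.I)) * F' p.1 p.2)
    (Continuous.continuousOn (by fun_prop))
  refine (hasDerivAt_integral_of_dominated_loc_of_deriv_le (bound := fun _ => C)
    (F := fun r θ => Complex.exp (-(k * θ * Complex.I)) * F r θ)
    (F' := fun r θ => Complex.exp (-(k * θ * Complex.I)) * F' r θ)
    (Metric.closedBall_mem_nhds r one_pos) ?_ ?_ ?_ ?_ ?_ ?_).2
  · exact Eventually.of_forall fun x => Continuous.aestronglyMeasurable (by fun_prop)
  · exact Continuous.intervalIntegrable (by fun_prop) _ _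
  · exact Continuous.aestronglyMeasurable (by fun_prop)
  · exact Eventually.of_forall fun θ hθ x hx => hC (x, θ) ⟨hx, Set.uIoc_subset_uIcc hθ⟩
  · exact intervalIntegrable_const
  · exact Eventually.of_forall fun θ _ x _ => (hd x θ).const_mul _

theorem integral_nonneg_of_hasSum_modes {ν a μ ε M : ℝ} (hν : 0 < ν) (hνa : ν ≤ 1 / 2 - a)
    (ha : 0 ≤ a) (hμ : -1 < μ) (hμ' : μ ≤ √((1 / 2 - a) ^ 2 - ν ^ 2) / (1 / 2 - a))
    (hε : 0 < ε) (hM : ε ≤ M) {φ φ' : ℤ → ℝ → ℂ} {P Q : ℝ → ℝ}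
    (hφ : ∀ k r, HasDerivAt (φ k) (φ' k r) r) (hφ' : ∀ k, Continuous (φ' k))
    (hφε : ∀ k, φ k ε = 0) (hφM : ∀ k, φ k M = 0) (hP : Continuous P) (hQ : Continuous Q)
    (hPsum : ∀ r ∈ Set.Icc ε M, ∀ s : Finset ℤ,
      ∑ k ∈ s, ‖φ' k r - (k / r : ℝ) • φ k r‖ ^ 2 ≤ P r)
    (hQsum : ∀ r, HasSum (fun k => ‖φ k r‖ ^ 2) (Q r)) :
    0 ≤ ∫ r in ε..M, r ^ (1 - 2 * a) * (P r / (1 + μ + ν / r) + (1 - μ - ν / r) * Q r) := by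
  have hφc : ∀ k, Continuous (φ k) := fun k =>
    continuous_iff_continuousAt.2 fun r => (hφ k r).continuousAt
  have hpos : ∀ r ∈ Set.uIcc ε M, 0 < r := fun r hr => by
    rw [Set.uIcc_of_le hM] at hr
    exact hε.trans_le hr.1
  have hrpow : ContinuousOn (fun r : ℝ => r ^ (1 - 2 * a)) (Set.uIcc ε M) := fun r hr =>
    (Real.continuousAt_rpow_const r _ (Or.inl (hpos r hr).ne')).continuousWithinAt
  have hne : ∀ r ∈ Set.uIcc ε M, r ≠ 0 := fun r hr => (hpos r hr).ne'
  have hwne : ∀ r ∈ Set.uIcc ε M, 1 + μ + ν / r ≠ 0 := fun r hr =>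
    (one_add_add_div_pos hν hμ (hpos r hr)).ne'
  have htrunc : ∀ s : Finset ℤ, ContinuousOn (fun r => r ^ (1 - 2 * a) *
      (P r / (1 + μ + ν / r) + (1 - μ - ν / r) * ∑ k ∈ s, ‖φ k r‖ ^ 2)) (Set.uIcc ε M) := by
    intro s
    have : Continuous fun r => ∑ k ∈ s, ‖φ k r‖ ^ 2 :=
      continuous_finsetSum _ fun k _ => by
        have := hφc k
        fun_prop
    fun_prop (disch := assumption)
  have hnonneg : ∀ s : Finset ℤ, 0 ≤ ∫ r in ε..M, r ^ (1 - 2 * a) *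
      (P r / (1 + μ + ν / r) + (1 - μ - ν / r) * ∑ k ∈ s, ‖φ k r‖ ^ 2) := by
    intro s
    have hterm : ∀ k : ℤ, ContinuousOn (fun r => r ^ (1 - 2 * a) *
        (‖φ' k r - (k / r : ℝ) • φ k r‖ ^ 2 / (1 + μ + ν / r)
          + (1 - μ - ν / r) * ‖φ k r‖ ^ 2)) (Set.uIcc ε M) := fun k => by
      have := hφc k
      have := hφ' k
      fun_prop (disch := assumption)
    have hsum : 0 ≤ ∫ r in ε..M, ∑ k ∈ s, r ^ (1 - 2 * a) *
        (‖φ' k r - (k / r : ℝ) • φ k r‖ ^ 2 / (1 + μ + ν / r)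
          + (1 - μ - ν / r) * ‖φ k r‖ ^ 2) := by
      rw [integral_finsetSum fun k _ => (hterm k).intervalIntegrable]
      exact Finset.sum_nonneg fun k _ => radial_integral_nonneg hν hνa ha hμ hμ' k hε hM
        (hφ k) (hφ' k) (hφε k) (hφM k)
    refine hsum.trans (integral_mono_on hM
      (ContinuousOn.intervalIntegrable (continuousOn_finsetSum _ fun k _ => hterm k))
      (htrunc s).intervalIntegrable fun r hr => ?_)
    have hr0 : 0 < r := hε.trans_le hr.1
    have := one_add_add_div_pos hν hμ hr0
    rw [← Finset.mul_sum, Finset.sum_add_distrib, ← Finset.sum_div, ← Finset.mul_sum]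
    gcongr
    exact hPsum r hr s
  refine ge_of_tendsto' (tendsto_integral_filter_of_dominated_convergence (l := atTop)
    (fun r => r ^ (1 - 2 * a) * (P r / (1 + μ + ν / r) + |1 - μ - ν / r| * Q r))
    ?_ ?_ ?_ ?_) hnonneg
  · exact Eventually.of_forall fun s =>
      ((htrunc s).mono Set.uIoc_subset_uIcc).aestronglyMeasurable measurableSet_uIoc
  · refine Eventually.of_forall fun s => Eventually.of_forall fun r hr => ?_
    have hr' := Set.uIoc_subset_uIcc hr
    have hr0 := hpos r hr'
    rw [Set.uIcc_of_le hM] at hr'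
    have := one_add_add_div_pos hν hμ hr0
    have hP0 : 0 ≤ P r := by simpa using hPsum r hr' ∅
    have hS0 : 0 ≤ ∑ k ∈ s, ‖φ k r‖ ^ 2 := Finset.sum_nonneg fun k _ => sq_nonneg _
    have hSQ := sum_le_hasSum s (fun k _ => sq_nonneg _) (hQsum r)
    rw [Real.norm_eq_abs, abs_mul, abs_of_nonneg (by positivity : 0 ≤ r ^ (1 - 2 * a))]
    gcongr
    refine (abs_add_le _ _).trans ?_
    rw [abs_of_nonneg (by positivity : 0 ≤ P r / (1 + μ + ν / r)), abs_mul, abs_of_nonneg hS0]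
    gcongr
  · exact ContinuousOn.intervalIntegrable (by fun_prop (disch := assumption))
  · exact Eventually.of_forall fun r _ => (((hQsum r).const_mul _).const_add _).const_mul _

theorem polar_integral_nonneg {ν a μ ε M : ℝ} (hν : 0 < ν) (hνa : ν ≤ 1 / 2 - a) (ha : 0 ≤ a)
    (hμ : -1 < μ) (hμ' : μ ≤ √((1 / 2 - a) ^ 2 - ν ^ 2) / (1 / 2 - a))
    (hε : 0 < ε) (hM : ε ≤ M) {F D T : ℝ → ℝ → ℂ} (hF : Continuous F.uncurry)
    (hD : Continuous D.uncurry) (hT : Continuous T.uncurry)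
    (hFD : ∀ r θ, HasDerivAt (F · θ) (D r θ) r) (hFT : ∀ r θ, HasDerivAt (F r) (r * T r θ) θ)
    (hper : ∀ r, F r (-Real.pi) = F r Real.pi) (hFε : ∀ θ, F ε θ = 0) (hFM : ∀ θ, F M θ = 0) :
    0 ≤ ∫ r in ε..M, r ^ (1 - 2 * a) *
      ((∫ θ in (-Real.pi)..Real.pi, ‖D r θ + Complex.I * T r θ‖ ^ 2) / (1 + μ + ν / r)
        + (1 - μ - ν / r) * ∫ θ in (-Real.pi)..Real.pi, ‖F r θ‖ ^ 2) := by
  have hπ := Real.pi_pos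
  have hF2 : Continuous fun p : ℝ × ℝ => F p.1 p.2 := hF
  have hD2 : Continuous fun p : ℝ × ℝ => D p.1 p.2 := hD
  have hT2 : Continuous fun p : ℝ × ℝ => T p.1 p.2 := hT
  have hF3 : ∀ r, Continuous (F r) := fun r => hF2.comp (by fun_prop : Continuous fun θ => (r, θ))
  have hD3 : ∀ r, Continuous (D r) := fun r => hD2.comp (by fun_prop : Continuous fun θ => (r, θ))
  have hT3 : ∀ r, Continuous (T r) := fun r => hT2.comp (by fun_prop : Continuous fun θ => (r, θ))
  have hPc : Continuous fun r => ∫ θ in (-Real.pi)..Real.pi, ‖D r θ + Complex.I * T r θ‖ ^ 2 :=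
    continuous_parametric_intervalIntegral_of_continuous'
      (by unfold Function.uncurry; fun_prop) _ _
  have hQc : Continuous fun r => ∫ θ in (-Real.pi)..Real.pi, ‖F r θ‖ ^ 2 :=
    continuous_parametric_intervalIntegral_of_continuous'
      (by unfold Function.uncurry; fun_prop) _ _
  have hG : ∀ k : ℤ, ∀ r : ℝ, 0 < r → circleCoeff (fun θ => D r θ + Complex.I * T r θ) k =
      circleCoeff (D r) k - (k / r : ℝ) • circleCoeff (F r) k := by
    intro k r hr
    have h1 : circleCoeff (fun θ => D r θ + Complex.I * T r θ) k
        = circleCoeff (D r) k + Complex.I * circleCoeff (T r) k := by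
      have e : ∀ θ : ℝ, Complex.exp (-(k * θ * Complex.I)) * (D r θ + Complex.I * T r θ)
          = Complex.exp (-(k * θ * Complex.I)) * D r θ
            + Complex.I * (Complex.exp (-(k * θ * Complex.I)) * T r θ) := fun θ => by ring
      have := hD3 r
      have := hT3 r
      simp only [circleCoeff, e]
      rw [integral_add (Continuous.intervalIntegrable (by fun_prop) _ _)
        (Continuous.intervalIntegrable (by fun_prop) _ _), intervalIntegral.integral_const_mul]
    have h2 : circleCoeff (fun θ => (r : ℂ) * T r θ) k = r * circleCoeff (T r) k := by
      simp only [circleCoeff, ← intervalIntegral.integral_const_mul, mul_left_comm]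
    have := hT3 r
    have h3 := circleCoeff_deriv (hFT r) (by fun_prop) (hper r) k
    rw [h2] at h3
    have hr0 : (r : ℂ) ≠ 0 := by exact_mod_cast hr.ne'
    rw [h1, Complex.real_smul]
    push_cast
    field_simp
    linear_combination Complex.I * h3 + k * circleCoeff (F r) k * Complex.I_sq
  have h := integral_nonneg_of_hasSum_modes hν hνa ha hμ hμ' hε hM
    (φ := fun k r => circleCoeff (F r) k) (φ' := fun k r => circleCoeff (D r) k)
    (hasDerivAt_circleCoeff hF hD hFD) (continuous_circleCoeff hD)
    (by simp [circleCoeff, hFε]) (by simp [circleCoeff, hFM])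
    (hPc.const_mul (2 * Real.pi)) (hQc.const_mul (2 * Real.pi))
    (fun r hr s => by
      have := hD3 r
      have := hT3 r
      have h := sum_le_hasSum s (fun k _ => sq_nonneg _)
        (hasSum_sq_circleCoeff (h := fun θ => D r θ + Complex.I * T r θ) (by fun_prop))
      simpa only [hG _ r (hε.trans_le hr.1)] using h)
    (fun r => hasSum_sq_circleCoeff (hF3 r))
  simp only [mul_div_assoc, mul_left_comm _ (2 * Real.pi), ← mul_add,
    intervalIntegral.integral_const_mul] at h
  exact nonneg_of_mul_nonneg_right h (by positivity)

theorem norm_fderiv_add_I_mul_fderiv (η : ℂ → ℂ) (x : ℂ) (θ : ℝ) :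
    ‖fderiv ℝ η x (Complex.exp (θ * Complex.I))
      + Complex.I * fderiv ℝ η x (Complex.I * Complex.exp (θ * Complex.I))‖ ^ 2
      = 4 * ‖wirtingerZbar η x‖ ^ 2 := by
  have h1 : Complex.exp (θ * Complex.I) = Real.cos θ • (1 : ℂ) + Real.sin θ • Complex.I := by
    rw [Complex.exp_mul_I]
    simp
  have h2 : Complex.I * Complex.exp (θ * Complex.I)
      = -Real.sin θ • (1 : ℂ) + Real.cos θ • Complex.I := by
    rw [h1]
    simp only [Complex.real_smul]
    push_cast
    linear_combination Complex.sin θ * Complex.I_sq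
  have h3 : fderiv ℝ η x (Complex.exp (θ * Complex.I))
      + Complex.I * fderiv ℝ η x (Complex.I * Complex.exp (θ * Complex.I))
      = Complex.exp ((-θ : ℝ) * Complex.I) * (2 * wirtingerZbar η x) := by
    rw [h2, h1, map_add, map_add, map_smul, map_smul, map_smul, map_smul, Complex.exp_mul_I,
      wirtingerZbar]
    simp only [Complex.real_smul]
    push_cast
    rw [Complex.cos_neg, Complex.sin_neg]
    linear_combination (Complex.sin θ * fderiv ℝ η x Complex.I) * Complex.I_sq
  rw [h3, norm_mul, Complex.norm_exp_ofReal_mul_I, one_mul, norm_mul, mul_pow]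
  norm_num

theorem exists_annulus_of_notMem_tsupport {η : ℂ → ℂ} (hc : HasCompactSupport η)
    (h0 : (0 : ℂ) ∉ tsupport η) :
    ∃ ε M : ℝ, 0 < ε ∧ ε < M ∧ ∀ x, ‖x‖ ≤ ε ∨ M ≤ ‖x‖ → x ∉ tsupport η := by
  obtain ⟨δ, hδ, hball⟩ := Metric.isOpen_iff.1 (isClosed_tsupport η).isOpen_compl 0 h0
  obtain ⟨R, hR⟩ := hc.isBounded.exists_norm_le
  refine ⟨δ / 2, max R δ + 1, by positivity, by linarith [le_max_right R δ], ?_⟩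
  rintro x (hx | hx) hxs
  · exact hball (by rw [mem_ball_zero_iff]; linarith) hxs
  · linarith [hR x hxs, le_max_left R δ]

theorem integrand_eq_zero_of_notMem_tsupport {ν a μ : ℝ} {η : ℂ → ℂ} {x : ℂ}
    (hx : x ∉ tsupport η) : (4 * ‖wirtingerZbar η x‖ ^ 2 / (1 + μ + ν / ‖x‖)
        + (1 - μ - ν / ‖x‖) * ‖η x‖ ^ 2) * ‖x‖ ^ (-2 * a) = 0 := by
  have h1 : η x = 0 := image_eq_zero_of_notMem_tsupport hx
  have h2 : fderiv ℝ η x = 0 := image_eq_zero_of_notMem_tsupport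
    fun h => hx (tsupport_fderiv_subset ℝ h)
  simp [wirtingerZbar, h1, h2]

theorem integral_eq_polar_of_annulus {f : ℂ → ℝ} {ε M : ℝ} (hε : 0 < ε) (hM : ε < M)
    (hf : ContinuousOn f {0}ᶜ) (hf0 : ∀ x, ‖x‖ ≤ ε ∨ M ≤ ‖x‖ → f x = 0) :
    ∫ x, f x = ∫ r in ε..M, ∫ θ in (-Real.pi)..Real.pi,
      r * f (r * Complex.exp (θ * Complex.I)) := by
  have hπ := Real.pi_pos
  have hsymm : ∀ p : ℝ × ℝ, Complex.polarCoord.symm p = p.1 * Complex.exp (p.2 * Complex.I) :=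
    fun p => by rw [Complex.polarCoord_symm_apply, Complex.exp_mul_I]; push_cast; rfl
  have hnorm : ∀ r θ : ℝ, 0 < r → ‖(r : ℂ) * Complex.exp (θ * Complex.I)‖ = r :=
    fun r θ hr => by
      rw [norm_mul, Complex.norm_exp_ofReal_mul_I, mul_one, Complex.norm_real, Real.norm_eq_abs,
        abs_of_pos hr]
  have hzero : ∀ r θ : ℝ, 0 < r → r ≤ ε ∨ M ≤ r →
      r * f (r * Complex.exp (θ * Complex.I)) = 0 := fun r θ hr h => by
    rw [hf0 _ (by rwa [hnorm r θ hr]), mul_zero]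
  have hK : IntegrableOn (fun p : ℝ × ℝ => p.1 * f (p.1 * Complex.exp (p.2 * Complex.I)))
      (Set.Icc ε M ×ˢ Set.Icc (-Real.pi) Real.pi) := by
    refine ContinuousOn.integrableOn_compact (isCompact_Icc.prod isCompact_Icc) ?_
    refine continuousOn_fst.mul (hf.comp (Continuous.continuousOn (by fun_prop)) ?_)
    rintro ⟨r, θ⟩ ⟨hr, -⟩
    have hr0 : r ≠ 0 := (hε.trans_le hr.1).ne'
    simpa using hr0
  have hI : IntegrableOn (fun p : ℝ × ℝ => p.1 * f (p.1 * Complex.exp (p.2 * Complex.I)))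
      (Set.Ioi 0 ×ˢ Set.Ioo (-Real.pi) Real.pi) := by
    refine hK.of_forall_sdiff_eq_zero (measurableSet_Ioi.prod measurableSet_Ioo) ?_
    rintro ⟨r, θ⟩ ⟨⟨hr, hθ⟩, hn⟩
    refine hzero r θ hr ?_
    by_contra! h
    exact hn ⟨⟨h.1.le, h.2.le⟩, Set.Ioo_subset_Icc_self hθ⟩
  rw [← Complex.integral_comp_polarCoord_symm]
  simp only [hsymm, smul_eq_mul, polarCoord_target]
  rw [Measure.volume_eq_prod, setIntegral_prod _ hI, integral_of_le hM.le]
  simp only [integral_of_le (by linarith : -Real.pi ≤ Real.pi), integral_Ioc_eq_integral_Ioo]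
  refine setIntegral_eq_of_subset_of_forall_sdiff_eq_zero measurableSet_Ioi
    (fun r hr => hε.trans hr.1) fun r hr => ?_
  have hr' : r ≤ ε ∨ M ≤ r := by
    by_contra! h
    exact hr.2 h
  simp [hzero r _ hr.1 hr']

theorem hasDerivAt_comp_ray {η : ℂ → ℂ} (hη : Differentiable ℝ η) (z : ℂ) (r : ℝ) :
    HasDerivAt (fun r : ℝ => η (r * z)) (fderiv ℝ η (r * z) z) r := by
  have h : HasDerivAt (fun r : ℝ => (r : ℂ) * z) z r := by
    simpa using (Complex.ofRealCLM.hasDerivAt (x := r)).mul_const z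
  exact (hη _).hasFDerivAt.comp_hasDerivAt r h

theorem hasDerivAt_comp_circle {η : ℂ → ℂ} (hη : Differentiable ℝ η) (r θ : ℝ) :
    HasDerivAt (fun θ : ℝ => η (r * Complex.exp (θ * Complex.I)))
      (r * fderiv ℝ η (r * Complex.exp (θ * Complex.I))
        (Complex.I * Complex.exp (θ * Complex.I))) θ := by
  have h : HasDerivAt (fun θ : ℝ => (r : ℂ) * Complex.exp (θ * Complex.I))
      (r • (Complex.I * Complex.exp (θ * Complex.I))) θ := by
    have := ((Complex.ofRealCLM.hasDerivAt (x := θ)).mul_const Complex.I).cexp.const_mul (r : ℂ)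
    simpa [mul_comm] using this
  have h' := (hη _).hasFDerivAt.comp_hasDerivAt θ h
  rwa [map_smul, Complex.real_smul] at h'

end

theorem stmt9 (ν a : ℝ) (hν : ν ∈ Set.Ioc (0 : ℝ) (1/2)) (ha : a ∈ Set.Icc (0 : ℝ) (1/2 - ν))
    (μ : ℝ) (hμ : μ ∈ Set.Ioc (-1 : ℝ) (Real.sqrt ((1/2 - a)^2 - ν^2) / (1/2 - a)))
    (η : ℂ → ℂ) (hs : ContDiff ℝ (⊤ : ℕ∞) η) (hc : HasCompactSupport η) (h0 : (0 : ℂ) ∉ tsupport η) :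
    ∫ x : ℂ, (4 * ‖wirtingerZbar η x‖^2 / (1 + μ + ν/‖x‖)
        + (1 - μ - ν/‖x‖) * ‖η x‖^2) * ‖x‖ ^ (-2*a) ≥ 0 := by
  have hdiff : Differentiable ℝ η := hs.differentiable (by simp)
  have hηc : Continuous η := hs.continuous
  have hdc : Continuous (fderiv ℝ η) := hs.continuous_fderiv (by simp)
  have ha0 : 0 ≤ a := ha.1
  have hνa : ν ≤ 1 / 2 - a := by linarith [ha.2]
  obtain ⟨ε, M, hε, hM, hsupp⟩ := exists_annulus_of_notMem_tsupport hc h0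
  have hnorm : ∀ r θ : ℝ, 0 < r → ‖(r : ℂ) * Complex.exp (θ * Complex.I)‖ = r :=
    fun r θ hr => by
      rw [norm_mul, Complex.norm_exp_ofReal_mul_I, mul_one, Complex.norm_real, Real.norm_eq_abs,
        abs_of_pos hr]
  have hcont : ContinuousOn (fun x : ℂ => (4 * ‖wirtingerZbar η x‖ ^ 2 / (1 + μ + ν / ‖x‖)
      + (1 - μ - ν / ‖x‖) * ‖η x‖ ^ 2) * ‖x‖ ^ (-2 * a)) {0}ᶜ := by
    have h1 : ∀ x ∈ ({0}ᶜ : Set ℂ), ‖x‖ ≠ 0 := fun x hx => norm_ne_zero_iff.2 hx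
    have h2 : ∀ x ∈ ({0}ᶜ : Set ℂ), 1 + μ + ν / ‖x‖ ≠ 0 := fun x hx =>
      (one_add_add_div_pos hν.1 hμ.1 (norm_pos_iff.2 hx)).ne'
    have h3 : ContinuousOn (fun x : ℂ => ‖x‖ ^ (-2 * a)) {0}ᶜ :=
      continuous_norm.continuousOn.rpow_const fun x hx => Or.inl (h1 x hx)
    unfold wirtingerZbar
    fun_prop (disch := assumption)
  rw [ge_iff_le, integral_eq_polar_of_annulus hε hM hcont
    fun x hx => integrand_eq_zero_of_notMem_tsupport (hsupp x hx)]
  have hη0 : ∀ r θ : ℝ, 0 < r → r ≤ ε ∨ M ≤ r → η (r * Complex.exp (θ * Complex.I)) = 0 :=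
    fun r θ hr h => image_eq_zero_of_notMem_tsupport (hsupp _ (by rwa [hnorm r θ hr]))
  have h := polar_integral_nonneg hν.1 hνa ha0 hμ.1 hμ.2 hε hM.le
    (F := fun r θ => η (r * Complex.exp (θ * Complex.I)))
    (D := fun r θ => fderiv ℝ η (r * Complex.exp (θ * Complex.I)) (Complex.exp (θ * Complex.I)))
    (T := fun r θ => fderiv ℝ η (r * Complex.exp (θ * Complex.I))
      (Complex.I * Complex.exp (θ * Complex.I)))
    (by unfold Function.uncurry; fun_prop) (by unfold Function.uncurry; fun_prop)
    (by unfold Function.uncurry; fun_prop)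
    (fun r θ => hasDerivAt_comp_ray hdiff _ r) (fun r θ => hasDerivAt_comp_circle hdiff r θ)
    (fun r => by
      have : Complex.exp (((-Real.pi : ℝ) : ℂ) * Complex.I)
          = Complex.exp ((Real.pi : ℂ) * Complex.I) := by
        rw [Complex.exp_eq_exp_iff_exists_int]
        exact ⟨-1, by push_cast; ring⟩
      simp only [this])
    (fun θ => hη0 ε θ hε (Or.inl le_rfl)) (fun θ => hη0 M θ (hε.trans hM) (Or.inr le_rfl))
  refine h.trans_eq (intervalIntegral.integral_congr fun r hr => ?_)
  rw [Set.uIcc_of_le hM.le] at hr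
  have hr0 : 0 < r := hε.trans_le hr.1
  have hp : r ^ (1 - 2 * a) = r * r ^ (-2 * a) := by
    rw [show 1 - 2 * a = 1 + -2 * a by ring, Real.rpow_add hr0, Real.rpow_one]
  simp only [norm_fderiv_add_I_mul_fderiv, hnorm r _ hr0]
  have hw : Continuous fun θ : ℝ => 4 * ‖wirtingerZbar η (r * Complex.exp (θ * Complex.I))‖ ^ 2 := by
    unfold wirtingerZbar
    fun_prop
  rw [← intervalIntegral.integral_div, ← intervalIntegral.integral_const_mul,
    ← intervalIntegral.integral_add ((hw.div_const _).intervalIntegrable _ _)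
      (Continuous.intervalIntegrable (by fun_prop) _ _), ← intervalIntegral.integral_const_mul]
  refine intervalIntegral.integral_congr fun θ _ => ?_
  simp only [hp]
  ring
end

section
/- Let ν ∈ (0,1/2], a ∈ (0, 1/2 − ν], c(a) = 1/2 − a, λ_{ν,a} = √(c(a)² − ν²)/c(a), and let λ ∈ (−1, λ_{ν,a}]. Then for every φ ∈ C_c^∞(ℝ²∖{0},ℂ), ∫_{ℝ²} ( |D_a^* φ(x)|² / (1 + λ + ν/|x|) + (1 − λ − ν/|x|) |φ(x)|² ) dx ≥ 0. -/
open MeasureTheory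

/-- The Wirtinger derivative `∂_z η = (1/2)(∂₁ η - i ∂₂ η)`, identifying `ℝ²` with `ℂ`. -/
noncomputable def wirtingerZ (η : ℂ → ℂ) (x : ℂ) : ℂ :=
  (1/2 : ℂ) * (fderiv ℝ η x 1 - Complex.I * fderiv ℝ η x Complex.I)

/-- The magnetic operator `D_a χ = -2i ∂_z χ + i a (z̄/|z|²) χ`. -/
noncomputable def Dop (a : ℝ) (χ : ℂ → ℂ) (x : ℂ) : ℂ :=
  (-2) * Complex.I * wirtingerZ χ x
    + Complex.I * (a : ℂ) * ((starRingEnd ℂ) x / ((‖x‖ : ℂ)^2)) * χ x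

/-- The magnetic operator `D_a^* φ = -2i ∂_{z̄} φ - i a (z/|z|²) φ`. -/
noncomputable def DopStar (a : ℝ) (φ : ℂ → ℂ) (x : ℂ) : ℂ :=
  (-2) * Complex.I * wirtingerZbar φ x
    - Complex.I * (a : ℂ) * (x / ((‖x‖ : ℂ)^2)) * φ x

/-- The unnormalised `k`-th Fourier coefficient of `g` on `(-π, π)`. -/
noncomputable def angularCoeff (g : ℝ → ℂ) (k : ℤ) : ℂ :=
  ∫ θ in (-Real.pi)..Real.pi, Complex.exp (-(k * θ * Complex.I)) * g θ

lemma hasSum_sq_angularCoeff {g : ℝ → ℂ} (hg : Continuous g) :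
    HasSum (fun k : ℤ => (2 * Real.pi)⁻¹ * ‖angularCoeff g k‖ ^ 2)
      (∫ θ in (-Real.pi)..Real.pi, ‖g θ‖ ^ 2) := by
  have hab : -Real.pi < Real.pi := by linarith [Real.pi_pos]
  have hL2 : MemLp g 2 (volume.restrict (Set.Ioc (-Real.pi) Real.pi)) := by
    obtain ⟨C, hC⟩ := isCompact_Icc.exists_bound_of_continuousOn
      (hg.continuousOn (s := Set.Icc (-Real.pi) Real.pi))
    refine MemLp.of_bound hg.aestronglyMeasurable C ?_
    exact (ae_restrict_mem measurableSet_Ioc).mono fun x hx => hC x (Set.Ioc_subset_Icc_self hx)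
  have h := (hasSum_sq_fourierCoeffOn hab hL2).mul_left (2 * Real.pi)
  have hpi := Real.pi_pos
  have hcoeff (k : ℤ) : 2 * Real.pi * ‖fourierCoeffOn hab g k‖ ^ 2
      = (2 * Real.pi)⁻¹ * ‖angularCoeff g k‖ ^ 2 := by
    have : fourierCoeffOn hab g k = ((2 * Real.pi)⁻¹ : ℝ) • angularCoeff g k := by
      rw [fourierCoeffOn_eq_integral, angularCoeff]
      congr 1
      · ring
      · congr 1
        ext θ
        rw [fourier_coe_apply, smul_eq_mul]
        congr 2
        have : (Real.pi : ℂ) ≠ 0 := by exact_mod_cast hpi.ne'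
        push_cast
        field_simp
        ring
    rw [this, norm_smul, mul_pow, Real.norm_of_nonneg (by positivity)]
    field_simp
  simp_rw [hcoeff] at h
  rwa [smul_eq_mul, sub_neg_eq_add, ← two_mul, mul_inv_cancel_left₀ (by positivity)] at h

lemma continuous_angularCoeff {X : Type*} [TopologicalSpace X] {g : X → ℝ → ℂ}
    (hg : Continuous (Function.uncurry g)) (k : ℤ) :
    Continuous fun r => angularCoeff (g r) k := by
  unfold angularCoeff
  refine intervalIntegral.continuous_parametric_intervalIntegral_of_continuous' ?_ _ _
  have : Continuous fun p : X × ℝ => g p.1 p.2 := hg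
  simp only [Function.uncurry_def]
  fun_prop

lemma hasDerivAt_angularCoeff {g g' : ℝ → ℝ → ℂ} (hg : Continuous (Function.uncurry g))
    (hg' : Continuous (Function.uncurry g'))
    (hd : ∀ r θ, HasDerivAt (fun r => g r θ) (g' r θ) r) (k : ℤ) (r : ℝ) :
    HasDerivAt (fun r => angularCoeff (g r) k) (angularCoeff (g' r) k) r := by
  have hg1 : Continuous fun p : ℝ × ℝ => g p.1 p.2 := hg
  have hg1' : Continuous fun p : ℝ × ℝ => g' p.1 p.2 := hg'
  have hF' : Continuous fun p : ℝ × ℝ => Complex.exp (-(k * p.2 * Complex.I)) * g' p.1 p.2 := by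
    fun_prop
  obtain ⟨C, hC⟩ := ((isCompact_Icc (a := r - 1) (b := r + 1)).prod
    (isCompact_Icc (a := -Real.pi) (b := Real.pi))).exists_bound_of_continuousOn hF'.continuousOn
  have hm : ∀ x, Continuous fun θ : ℝ => Complex.exp (-(k * θ * Complex.I)) * g x θ := by
    intro x
    have : Continuous (g x) := hg1.comp (Continuous.prodMk_right x)
    fun_prop
  refine (intervalIntegral.hasDerivAt_integral_of_dominated_loc_of_deriv_le
    (bound := fun _ => C) (s := Set.Icc (r - 1) (r + 1))
    (F := fun r θ => Complex.exp (-(k * θ * Complex.I)) * g r θ)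
    (F' := fun r θ => Complex.exp (-(k * θ * Complex.I)) * g' r θ)
    (Icc_mem_nhds (by linarith) (by linarith))
    (.of_forall fun x => (hm x).aestronglyMeasurable)
    ((hm r).intervalIntegrable _ _)
    (hF'.comp (Continuous.prodMk_right r)).aestronglyMeasurable
    (.of_forall fun θ hθ x hx => hC (x, θ) ⟨hx, ?_⟩)
    intervalIntegrable_const
    (.of_forall fun θ _ x _ => (hd x θ).const_mul _)).2
  rw [Set.uIoc_of_le (by linarith [Real.pi_pos])] at hθ
  exact Set.Ioc_subset_Icc_self hθ

lemma angularCoeff_deriv {g g' : ℝ → ℂ} (hg' : Continuous g')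
    (hd : ∀ θ, HasDerivAt g (g' θ) θ) (hper : g (-Real.pi) = g Real.pi) (k : ℤ) :
    angularCoeff g' k = k * Complex.I * angularCoeff g k := by
  have hexp : ∀ θ : ℝ, HasDerivAt (fun θ : ℝ => Complex.exp (-(k * θ * Complex.I)))
      (Complex.exp (-(k * θ * Complex.I)) * (-(k * Complex.I))) θ := by
    intro θ
    have h1 : HasDerivAt (fun θ : ℝ => (-(k * θ * Complex.I) : ℂ)) (-(k * Complex.I)) θ := by
      have := ((hasDerivAt_id θ).ofReal_comp.const_mul (k : ℂ)).mul_const Complex.I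
      simpa using this.fun_neg
    exact h1.cexp
  have h := intervalIntegral.integral_mul_deriv_eq_deriv_mul (a := -Real.pi) (b := Real.pi)
    (fun θ _ => hexp θ) (fun θ _ => hd θ)
    (Continuous.intervalIntegrable (by fun_prop) _ _) (hg'.intervalIntegrable _ _)
  unfold angularCoeff
  rw [h, hper, ← intervalIntegral.integral_const_mul]
  have hb : Complex.exp (-(k * (Real.pi : ℝ) * Complex.I))
      = Complex.exp (-(k * ((-Real.pi : ℝ) : ℂ) * Complex.I)) := by
    rw [Complex.exp_eq_exp_iff_exists_int]
    exact ⟨-k, by push_cast; ring⟩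
  rw [hb, sub_self, zero_sub, ← intervalIntegral.integral_neg]
  congr 1
  ext θ
  ring

lemma radial_integral_nonneg_s10 {ν lam κ s R : ℝ} (hν : 0 < ν) (hlam : -1 < lam) (hR : 0 ≤ R)
    (h1 : (1 + lam) * s ^ 2 ≤ 1 - lam) (h2 : ν * (1 + s ^ 2) ≤ s * (2 * κ - 1))
    {f f' : ℝ → ℂ} (hf' : Continuous f') (hd : ∀ r, HasDerivAt f (f' r) r) (hfR : f R = 0) :
    0 ≤ ∫ r in (0 : ℝ)..R, (‖r * f' r + κ * f r‖ ^ 2 / ((1 + lam) * r + ν)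
      + ((1 - lam) * r - ν) * ‖f r‖ ^ 2) := by
  have hf : Continuous f := continuous_iff_continuousAt.2 fun r => (hd r).continuousAt
  have hQ : ∀ r ∈ Set.uIcc 0 R, 0 < (1 + lam) * r + ν := by
    intro r hr
    rw [Set.uIcc_of_le hR] at hr
    nlinarith [mul_nonneg (by linarith : 0 ≤ 1 + lam) hr.1]
  have hder : ∀ r, HasDerivAt (fun r : ℝ => r * ‖f r‖ ^ 2)
      (1 * ‖f r‖ ^ 2 + r * (2 * inner ℝ (f r) (f' r))) r := fun r =>
    (hasDerivAt_id r).mul (hd r).norm_sq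
  have hcont : Continuous fun r => 1 * ‖f r‖ ^ 2 + r * (2 * inner ℝ (f r) (f' r)) := by
    fun_prop
  have hzero := intervalIntegral.integral_eq_sub_of_hasDerivAt (a := 0) (b := R)
    (fun r _ => hder r) (hcont.intervalIntegrable _ _)
  rw [hfR] at hzero
  have hs : (0 : ℝ) = ∫ r in (0 : ℝ)..R, s * (1 * ‖f r‖ ^ 2 + r * (2 * inner ℝ (f r) (f' r))) := by
    rw [intervalIntegral.integral_const_mul, hzero]
    simp
  refine hs.le.trans ?_
  refine intervalIntegral.integral_mono_on hR ((hcont.const_mul s).intervalIntegrable _ _)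
    (ContinuousOn.intervalIntegrable (μ := volume) ?_) fun r hr => ?_
  · refine ContinuousOn.add (ContinuousOn.div (by fun_prop) (by fun_prop) ?_) (by fun_prop)
    exact fun r hr => (hQ r hr).ne'
  · have hq := hQ r (by rwa [Set.uIcc_of_le hR])
    set q := (1 + lam) * r + ν with hqdef
    set v : ℂ := r * f' r + κ * f r with hv
    have hin : inner ℝ (f r) v = r * inner ℝ (f r) (f' r) + κ * ‖f r‖ ^ 2 := by
      rw [hv, ← Complex.real_smul, ← Complex.real_smul, inner_add_right, inner_smul_right,
        inner_smul_right, real_inner_self_eq_norm_sq]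
    have hsq : 0 ≤ ‖v - (q * s) • f r‖ ^ 2 / q := by positivity
    rw [norm_sub_sq_real, inner_smul_right, norm_smul, mul_pow, real_inner_comm, hin,
      Real.norm_eq_abs, sq_abs] at hsq
    have hexp : (‖v‖ ^ 2 - 2 * (q * s * (r * inner ℝ (f r) (f' r) + κ * ‖f r‖ ^ 2))
        + (q * s) ^ 2 * ‖f r‖ ^ 2) / q = ‖v‖ ^ 2 / q
        - 2 * s * (r * inner ℝ (f r) (f' r) + κ * ‖f r‖ ^ 2) + q * s ^ 2 * ‖f r‖ ^ 2 := by
      field_simp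
    rw [hexp] at hsq
    have hb : 0 ≤ (r * ((1 - lam) - (1 + lam) * s ^ 2)
        + (s * (2 * κ - 1) - ν * (1 + s ^ 2))) * ‖f r‖ ^ 2 :=
      mul_nonneg (add_nonneg (mul_nonneg hr.1 (by linarith)) (by linarith)) (sq_nonneg _)
    rw [hqdef] at hsq ⊢
    linarith

lemma exists_multiplier {ν a lam : ℝ} (hν : 0 < ν) (ha : 0 < a) (haν : ν ≤ 1 / 2 - a)
    (hlam : lam ≤ Real.sqrt ((1 / 2 - a) ^ 2 - ν ^ 2) / (1 / 2 - a)) (k : ℤ) :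
    ∃ s : ℝ, (1 + lam) * s ^ 2 ≤ 1 - lam ∧ ν * (1 + s ^ 2) ≤ s * (2 * (a - k) - 1) := by
  set c := 1 / 2 - a with hc
  set w := Real.sqrt (c ^ 2 - ν ^ 2) with hw
  have hcpos : 0 < c := by linarith
  have hw2 : w ^ 2 = c ^ 2 - ν ^ 2 := Real.sq_sqrt (by nlinarith)
  have hw0 : 0 ≤ w := Real.sqrt_nonneg _
  have hwc : w < c := by nlinarith
  set t := (c - w) / ν with ht
  have htpos : 0 < t := div_pos (by linarith) hν
  have htν : ν * t = c - w := by rw [ht]; field_simp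
  have ht1 : ν * (1 + t ^ 2) = 2 * c * t := by
    apply mul_left_cancel₀ hν.ne'
    linear_combination (ν * t + c - w - 2 * c) * htν + hw2
  have ht2 : (1 + lam) * t ^ 2 ≤ 1 - lam := by
    rw [le_div_iff₀ hcpos] at hlam
    have h3 : t * (c + w) = ν := by
      apply mul_left_cancel₀ hν.ne'
      linear_combination (c + w) * htν - hw2
    have h4 : ν * ((1 - lam) - (1 + lam) * t ^ 2) = 2 * t * (w - lam * c) := by
      linear_combination (- (1 + lam)) * ht1 - 2 * h3
    have h5 : 0 ≤ ν * ((1 - lam) - (1 + lam) * t ^ 2) := by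
      rw [h4]
      exact mul_nonneg (by linarith) (by linarith)
    linarith [nonneg_of_mul_nonneg_right h5 hν]
  rcases le_or_gt 0 k with hk | hk
  · have hk' : (0 : ℝ) ≤ k := by exact_mod_cast hk
    exact ⟨-t, by rwa [neg_sq], by rw [neg_sq, ht1]; nlinarith⟩
  · have hk' : (k : ℝ) ≤ -1 := by exact_mod_cast Int.le_sub_one_of_lt hk
    exact ⟨t, ht2, by rw [ht1]; nlinarith⟩

/-- The function `r e^{-iθ} (i DopStar a φ)` in polar coordinates. -/
noncomputable def polarDop (a : ℝ) (φ : ℂ → ℂ) (r θ : ℝ) : ℂ :=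
  r * fderiv ℝ φ (r * Complex.exp (θ * Complex.I)) (Complex.exp (θ * Complex.I))
    + Complex.I * fderiv ℝ φ (r * Complex.exp (θ * Complex.I))
      (r * (Complex.exp (θ * Complex.I) * Complex.I))
    + a * φ (r * Complex.exp (θ * Complex.I))

lemma norm_DopStar_polar (a : ℝ) (φ : ℂ → ℂ) {r : ℝ} (hr : 0 < r) (θ : ℝ) :
    ‖DopStar a φ (r * Complex.exp (θ * Complex.I))‖ = ‖polarDop a φ r θ‖ / r := by
  have hr' : (r : ℂ) ≠ 0 := by exact_mod_cast hr.ne'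
  have hnorm : ‖(r : ℂ) * Complex.exp (θ * Complex.I)‖ = r := by
    rw [norm_mul, Complex.norm_exp_ofReal_mul_I, mul_one, Complex.norm_real,
      Real.norm_of_nonneg hr.le]
  have key : polarDop a φ r θ * Complex.exp (θ * Complex.I)
      = Complex.I * r * DopStar a φ (r * Complex.exp (θ * Complex.I)) := by
    unfold DopStar polarDop wirtingerZbar
    rw [hnorm]
    set L := fderiv ℝ φ (r * Complex.exp (θ * Complex.I))
    have hlin : ∀ x y : ℝ, L (x + y * Complex.I) = x * L 1 + y * L Complex.I := by
      intro x y
      have : (x + y * Complex.I : ℂ) = x • (1 : ℂ) + y • Complex.I := by simp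
      rw [this, map_add, map_smul, map_smul, Complex.real_smul, Complex.real_smul]
    have he : Complex.exp (θ * Complex.I) = (Real.cos θ : ℂ) + (Real.sin θ : ℂ) * Complex.I := by
      rw [Complex.exp_mul_I]; simp
    have he1 : L (Complex.exp (θ * Complex.I))
        = Real.cos θ * L 1 + Real.sin θ * L Complex.I := by rw [he, hlin]
    have he2 : L (r * (Complex.exp (θ * Complex.I) * Complex.I))
        = r * (-Real.sin θ * L 1 + Real.cos θ * L Complex.I) := by
      have : (r * (Complex.exp (θ * Complex.I) * Complex.I) : ℂ)
          = ((-r * Real.sin θ : ℝ) : ℂ) + ((r * Real.cos θ : ℝ) : ℂ) * Complex.I := by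
        rw [he]
        simp only [Complex.ofReal_mul, Complex.ofReal_neg]
        linear_combination (r * (Real.sin θ : ℂ)) * Complex.I_sq
      rw [this, hlin]; push_cast; ring
    have hcs : (Real.cos θ : ℂ) ^ 2 + (Real.sin θ : ℂ) ^ 2 = 1 := by
      exact_mod_cast Real.cos_sq_add_sin_sq θ
    rw [he1, he2]
    generalize φ (r * Complex.exp (θ * Complex.I)) = p
    rw [he]
    generalize (Real.cos θ : ℂ) = x at *
    generalize (Real.sin θ : ℂ) = y at *
    field_simp
    linear_combination (r * L 1 + r * Complex.I * L Complex.I) * hcs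
      + (r * L 1 + a * p * (x + y * Complex.I) + r * Complex.I * L Complex.I
          - r * y ^ 2 * L 1 + r * x * y * L Complex.I) * Complex.I_sq
  have h := congrArg norm key
  rw [norm_mul, norm_mul, norm_mul, Complex.norm_exp_ofReal_mul_I, Complex.norm_I,
    Complex.norm_real, Real.norm_of_nonneg hr.le, mul_one, one_mul] at h
  rw [h]
  field_simp

lemma angularCoeff_polarDop (a : ℝ) {φ : ℂ → ℂ} (hs : ContDiff ℝ 1 φ) (k : ℤ) :
    ∃ f' : ℝ → ℂ, Continuous f' ∧
      (∀ r, HasDerivAt (fun r : ℝ => angularCoeff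
        (fun θ => φ (r * Complex.exp (θ * Complex.I))) k) (f' r) r) ∧
      ∀ r : ℝ, angularCoeff (polarDop a φ r) k = r * f' r + ((a - k : ℝ) : ℂ) *
        angularCoeff (fun θ => φ (r * Complex.exp (θ * Complex.I))) k := by
  have hfd : Continuous (fderiv ℝ φ) := hs.continuous_fderiv one_ne_zero
  have hφ : Continuous φ := hs.continuous
  have hdiff : ∀ z, HasFDerivAt φ (fderiv ℝ φ z) z := fun z =>
    (hs.differentiable one_ne_zero z).hasFDerivAt
  set P : ℝ → ℝ → ℂ := fun r θ => φ (r * Complex.exp (θ * Complex.I)) with hP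
  set Pr : ℝ → ℝ → ℂ := fun r θ =>
    fderiv ℝ φ (r * Complex.exp (θ * Complex.I)) (Complex.exp (θ * Complex.I)) with hPr
  set Pt : ℝ → ℝ → ℂ := fun r θ => fderiv ℝ φ (r * Complex.exp (θ * Complex.I))
      (r * (Complex.exp (θ * Complex.I) * Complex.I)) with hPt
  have cP : Continuous (Function.uncurry P) := by
    simp only [hP, Function.uncurry_def]; fun_prop
  have cPr : Continuous (Function.uncurry Pr) := by
    simp only [hPr, Function.uncurry_def]
    exact (hfd.comp (by fun_prop)).clm_apply (by fun_prop)
  have cPt : Continuous (Function.uncurry Pt) := by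
    simp only [hPt, Function.uncurry_def]
    exact (hfd.comp (by fun_prop)).clm_apply (by fun_prop)
  have dr : ∀ r θ, HasDerivAt (fun r => P r θ) (Pr r θ) r := by
    intro r θ
    have h1 : HasDerivAt (fun r : ℝ => (r : ℂ) * Complex.exp (θ * Complex.I))
        (Complex.exp (θ * Complex.I)) r := by
      simpa using (hasDerivAt_id r).ofReal_comp.mul_const (Complex.exp (θ * Complex.I))
    exact (hdiff _).comp_hasDerivAt r h1
  have dt : ∀ r θ, HasDerivAt (P r) (Pt r θ) θ := by
    intro r θ
    have h1 : HasDerivAt (fun θ : ℝ => (r : ℂ) * Complex.exp (θ * Complex.I))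
        (r * (Complex.exp (θ * Complex.I) * Complex.I)) θ := by
      have h2 : HasDerivAt (fun θ : ℝ => (θ * Complex.I : ℂ)) Complex.I θ := by
        simpa using (hasDerivAt_id θ).ofReal_comp.mul_const Complex.I
      exact h2.cexp.const_mul _
    exact (hdiff _).comp_hasDerivAt θ h1
  refine ⟨fun r => angularCoeff (Pr r) k, continuous_angularCoeff cPr k,
    hasDerivAt_angularCoeff cP cPr dr k, fun r => ?_⟩
  have cP1 : Continuous (P r) := cP.comp (Continuous.prodMk_right r)
  have cPr1 : Continuous (Pr r) := cPr.comp (Continuous.prodMk_right r)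
  have cPt1 : Continuous (Pt r) := cPt.comp (Continuous.prodMk_right r)
  have ht := angularCoeff_deriv cPt1 (dt r) (by simp [hP, Complex.exp_neg, Complex.exp_pi_mul_I]) k
  have hsplit : angularCoeff (polarDop a φ r) k = r * angularCoeff (Pr r) k
      + Complex.I * angularCoeff (Pt r) k + a * angularCoeff (P r) k := by
    unfold angularCoeff
    rw [← intervalIntegral.integral_const_mul, ← intervalIntegral.integral_const_mul,
      ← intervalIntegral.integral_const_mul, ← intervalIntegral.integral_add,
      ← intervalIntegral.integral_add]
    · congr 1
      ext θ
      simp only [polarDop, hP, hPr, hPt]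
      ring
    all_goals exact Continuous.intervalIntegrable (by fun_prop) _ _
  rw [hsplit, ht]
  push_cast
  linear_combination (k * angularCoeff (P r) k) * Complex.I_sq

lemma continuous_polarDop (a : ℝ) {φ : ℂ → ℂ} (hs : ContDiff ℝ 1 φ) :
    Continuous (Function.uncurry (polarDop a φ)) := by
  have hfd : Continuous (fderiv ℝ φ) := hs.continuous_fderiv one_ne_zero
  have hφ : Continuous φ := hs.continuous
  simp only [polarDop, Function.uncurry_def]
  refine ((Continuous.mul (by fun_prop) ?_).add (Continuous.mul (by fun_prop) ?_)).add
    (by fun_prop)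
  all_goals exact (hfd.comp (by fun_prop)).clm_apply (by fun_prop)

lemma integral_polar_nonneg {ν a lam R : ℝ} (hν : 0 < ν) (ha : 0 < a) (haν : ν ≤ 1 / 2 - a)
    (hlam : lam ∈ Set.Ioc (-1 : ℝ) (Real.sqrt ((1 / 2 - a) ^ 2 - ν ^ 2) / (1 / 2 - a)))
    (hR : 0 ≤ R) {φ : ℂ → ℂ} (hs : ContDiff ℝ 1 φ)
    (hφR : ∀ z : ℂ, ‖z‖ = R → φ z = 0) :
    0 ≤ ∫ r in (0 : ℝ)..R, ((∫ θ in (-Real.pi)..Real.pi, ‖polarDop a φ r θ‖ ^ 2)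
        / ((1 + lam) * r + ν) + ((1 - lam) * r - ν) *
        ∫ θ in (-Real.pi)..Real.pi, ‖φ (r * Complex.exp (θ * Complex.I))‖ ^ 2) := by
  have hφ : Continuous φ := hs.continuous
  have cD := continuous_polarDop a hs
  have cD' : Continuous fun p : ℝ × ℝ => polarDop a φ p.1 p.2 := cD
  have cP : Continuous (Function.uncurry fun r θ : ℝ => φ (r * Complex.exp (θ * Complex.I))) := by
    simp only [Function.uncurry_def]; fun_prop
  have hQ : ∀ r ∈ Set.uIcc 0 R, (1 + lam) * r + ν ≠ 0 := by
    intro r hr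
    rw [Set.uIcc_of_le hR] at hr
    nlinarith [mul_nonneg (by linarith [hlam.1] : 0 ≤ 1 + lam) hr.1]
  have hQ' : ∀ r ∈ Set.uIoc 0 R, 0 ≤ (1 + lam) * r + ν := by
    intro r hr
    rw [Set.uIoc_of_le hR] at hr
    nlinarith [mul_nonneg (by linarith [hlam.1] : 0 ≤ 1 + lam) hr.1.le]
  have hD := fun r => hasSum_sq_angularCoeff (cD.comp (Continuous.prodMk_right r))
  have hP := fun r => hasSum_sq_angularCoeff (cP.comp (Continuous.prodMk_right r))
  simp only [Function.comp_def, Function.uncurry_apply_pair] at hD hP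
  have hcD := continuous_angularCoeff cD
  have hcP := continuous_angularCoeff cP
  have hiD : Continuous fun r => ∫ θ in (-Real.pi)..Real.pi, ‖polarDop a φ r θ‖ ^ 2 :=
    intervalIntegral.continuous_parametric_intervalIntegral_of_continuous'
      (by simp only [Function.uncurry_def]; fun_prop) _ _
  have hiP : Continuous fun r : ℝ =>
      ∫ θ in (-Real.pi)..Real.pi, ‖φ (r * Complex.exp (θ * Complex.I))‖ ^ 2 :=
    intervalIntegral.continuous_parametric_intervalIntegral_of_continuous'
      (by simp only [Function.uncurry_def]; fun_prop) _ _
  have hsum := intervalIntegral.hasSum_integral_of_dominated_convergence (μ := volume)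
    (a := 0) (b := R)
    (F := fun (k : ℤ) (r : ℝ) =>
      (2 * Real.pi)⁻¹ * ‖angularCoeff (polarDop a φ r) k‖ ^ 2 / ((1 + lam) * r + ν)
      + ((1 - lam) * r - ν) * ((2 * Real.pi)⁻¹ *
        ‖angularCoeff (fun θ => φ (r * Complex.exp (θ * Complex.I))) k‖ ^ 2))
    (bound := fun (k : ℤ) (r : ℝ) =>
      (2 * Real.pi)⁻¹ * ‖angularCoeff (polarDop a φ r) k‖ ^ 2 / ((1 + lam) * r + ν)
      + |(1 - lam) * r - ν| * ((2 * Real.pi)⁻¹ *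
        ‖angularCoeff (fun θ => φ (r * Complex.exp (θ * Complex.I))) k‖ ^ 2))
    (f := fun r => (∫ θ in (-Real.pi)..Real.pi, ‖polarDop a φ r θ‖ ^ 2)
        / ((1 + lam) * r + ν) + ((1 - lam) * r - ν) *
        ∫ θ in (-Real.pi)..Real.pi, ‖φ (r * Complex.exp (θ * Complex.I))‖ ^ 2)
    ?_ ?_ ?_ ?_ ?_
  · refine hsum.nonneg fun k => ?_
    obtain ⟨s, h1, h2⟩ := exists_multiplier hν ha haν hlam.2 k
    obtain ⟨f', hf', hd, hf⟩ := angularCoeff_polarDop a hs k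
    have hfR : angularCoeff (fun θ => φ (R * Complex.exp (θ * Complex.I))) k = 0 := by
      have : ∀ θ : ℝ, φ (R * Complex.exp (θ * Complex.I)) = 0 := fun θ => hφR _ (by
        rw [norm_mul, Complex.norm_exp_ofReal_mul_I, mul_one, Complex.norm_real,
          Real.norm_of_nonneg hR])
      simp [angularCoeff, this]
    have h := radial_integral_nonneg_s10 hν hlam.1 hR h1 h2 hf' hd hfR
    have h' := mul_nonneg (by positivity : 0 ≤ (2 * Real.pi)⁻¹) h
    rw [← intervalIntegral.integral_const_mul] at h'
    refine h'.trans_eq ?_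
    congr 1
    ext r
    rw [hf r]
    ring
  · intro k
    have : ContinuousOn (fun r : ℝ =>
      (2 * Real.pi)⁻¹ * ‖angularCoeff (polarDop a φ r) k‖ ^ 2 / ((1 + lam) * r + ν)
      + ((1 - lam) * r - ν) * ((2 * Real.pi)⁻¹ *
        ‖angularCoeff (fun θ => φ (r * Complex.exp (θ * Complex.I))) k‖ ^ 2))
        (Set.uIcc 0 R) := by
      refine ContinuousOn.add (ContinuousOn.div ?_ (by fun_prop) hQ) (ContinuousOn.mul ?_ ?_)
      · exact (((hcD k).norm.pow 2).const_mul _).continuousOn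
      · fun_prop
      · exact (((hcP k).norm.pow 2).const_mul _).continuousOn
    exact (this.mono Set.uIoc_subset_uIcc).aestronglyMeasurable measurableSet_uIoc
  · refine fun k => .of_forall fun r hr => (norm_add_le _ _).trans (le_of_eq ?_)
    have := hQ' r hr
    rw [norm_mul, Real.norm_of_nonneg (by positivity), Real.norm_eq_abs,
      Real.norm_of_nonneg (by positivity)]
  · exact .of_forall fun r _ => (((hD r).div_const _).add ((hP r).mul_left _)).summable
  · have : (fun r => ∑' k : ℤ, ((2 * Real.pi)⁻¹ * ‖angularCoeff (polarDop a φ r) k‖ ^ 2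
        / ((1 + lam) * r + ν) + |(1 - lam) * r - ν| * ((2 * Real.pi)⁻¹ *
        ‖angularCoeff (fun θ => φ (r * Complex.exp (θ * Complex.I))) k‖ ^ 2)))
        = fun r => (∫ θ in (-Real.pi)..Real.pi, ‖polarDop a φ r θ‖ ^ 2)
        / ((1 + lam) * r + ν) + |(1 - lam) * r - ν| *
        ∫ θ in (-Real.pi)..Real.pi, ‖φ (r * Complex.exp (θ * Complex.I))‖ ^ 2 :=
      funext fun r => (((hD r).div_const _).add ((hP r).mul_left _)).tsum_eq
    rw [this]
    refine ContinuousOn.intervalIntegrable ?_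
    refine ContinuousOn.add (ContinuousOn.div hiD.continuousOn (by fun_prop) hQ) ?_
    exact ContinuousOn.mul (by fun_prop) hiP.continuousOn
  · exact .of_forall fun r _ => ((hD r).div_const _).add ((hP r).mul_left _)

theorem stmt10 (ν a : ℝ) (hν : ν ∈ Set.Ioc (0 : ℝ) (1/2)) (ha : a ∈ Set.Ioc (0 : ℝ) (1/2 - ν))
    (lam : ℝ) (hlam : lam ∈ Set.Ioc (-1 : ℝ) (Real.sqrt ((1/2 - a)^2 - ν^2) / (1/2 - a)))
    (φ : ℂ → ℂ) (hs : ContDiff ℝ (⊤ : ℕ∞) φ) (hc : HasCompactSupport φ) (h0 : (0 : ℂ) ∉ tsupport φ) :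
    ∫ x : ℂ, (‖DopStar a φ x‖^2 / (1 + lam + ν/‖x‖)
        + (1 - lam - ν/‖x‖) * ‖φ x‖^2) ≥ 0 := by
  have hν0 : 0 < ν := hν.1
  have hs1 : ContDiff ℝ 1 φ := hs.of_le (by exact_mod_cast le_top)
  have hφ : Continuous φ := hs1.continuous
  obtain ⟨R, hR, hsub⟩ := hc.isCompact.isBounded.subset_ball_lt 0 0
  have hout : ∀ z : ℂ, R ≤ ‖z‖ → z ∉ tsupport φ := fun z hz hmem => by
    have := hsub hmem
    rw [mem_ball_zero_iff] at this
    linarith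
  have hφR : ∀ z : ℂ, R ≤ ‖z‖ → φ z = 0 := fun z hz => image_eq_zero_of_notMem_tsupport (hout z hz)
  have hDR : ∀ z : ℂ, R ≤ ‖z‖ → DopStar a φ z = 0 := fun z hz => by
    have : fderiv ℝ φ z = 0 := image_eq_zero_of_notMem_tsupport
      fun h => hout z hz (tsupport_fderiv_subset ℝ h)
    simp [DopStar, wirtingerZbar, this, hφR z hz]
  have hpi : -Real.pi ≤ Real.pi := by linarith [Real.pi_pos]
  set S : Set (ℝ × ℝ) := Set.Ioo 0 R ×ˢ Set.Ioo (-Real.pi) Real.pi with hS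
  set G : ℝ × ℝ → ℝ := fun p => ‖polarDop a φ p.1 p.2‖ ^ 2 / ((1 + lam) * p.1 + ν)
    + ((1 - lam) * p.1 - ν) * ‖φ (p.1 * Complex.exp (p.2 * Complex.I))‖ ^ 2 with hG
  have hnorm : ∀ r θ : ℝ, 0 < r → ‖(r : ℂ) * Complex.exp (θ * Complex.I)‖ = r := by
    intro r θ hr
    rw [norm_mul, Complex.norm_exp_ofReal_mul_I, mul_one, Complex.norm_real,
      Real.norm_of_nonneg hr.le]
  have hsymm : ∀ p : ℝ × ℝ, Complex.polarCoord.symm p = p.1 * Complex.exp (p.2 * Complex.I) := by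
    intro p
    rw [Complex.polarCoord_symm_apply, Complex.exp_mul_I]
    simp
  have cD := continuous_polarDop a hs1
  have cD' : Continuous fun p : ℝ × ℝ => polarDop a φ p.1 p.2 := cD
  have hQ : ∀ r : ℝ, 0 ≤ r → 0 < (1 + lam) * r + ν := fun r hr => by
    nlinarith [mul_nonneg (by linarith [hlam.1] : 0 ≤ 1 + lam) hr]
  have hint : IntegrableOn G S := by
    have : ContinuousOn G (Set.Icc 0 R ×ˢ Set.Icc (-Real.pi) Real.pi) := by
      refine ContinuousOn.add (ContinuousOn.div (by fun_prop) (by fun_prop) ?_) (by fun_prop)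
      exact fun p hp => (hQ p.1 hp.1.1).ne'
    exact (this.integrableOn_compact (isCompact_Icc.prod isCompact_Icc)).mono_set
      (Set.prod_mono Set.Ioo_subset_Icc_self Set.Ioo_subset_Icc_self)
  rw [ge_iff_le, ← Complex.integral_comp_polarCoord_symm]
  have hST : S ⊆ polarCoord.target := by
    rw [polarCoord_target]
    exact Set.prod_mono Set.Ioo_subset_Ioi_self subset_rfl
  rw [setIntegral_eq_of_subset_of_forall_sdiff_eq_zero
    polarCoord.open_target.measurableSet hST]
  · have hSm : MeasurableSet S := measurableSet_Ioo.prod measurableSet_Ioo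
    rw [setIntegral_congr_fun (g := G) hSm]
    · rw [hS, Measure.volume_eq_prod, setIntegral_prod _ hint, ← integral_Ioc_eq_integral_Ioo,
        ← intervalIntegral.integral_of_le hR.le]
      refine (integral_polar_nonneg hν0 ha.1 (by linarith [ha.2]) hlam hR.le hs1
        fun z hz => hφR z hz.ge).trans_eq (intervalIntegral.integral_congr fun r _ => ?_)
      simp only [hG]
      have c1 : Continuous fun θ => polarDop a φ r θ := cD.comp (Continuous.prodMk_right r)
      rw [← integral_Ioc_eq_integral_Ioo, ← intervalIntegral.integral_of_le hpi,
        intervalIntegral.integral_add, intervalIntegral.integral_div,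
        intervalIntegral.integral_const_mul]
      all_goals exact Continuous.intervalIntegrable (by fun_prop) _ _
    · intro p hp
      have hr : 0 < p.1 := hp.1.1
      have hq := hQ p.1 hr.le
      have hq' : 0 < 1 + lam + ν / p.1 := by
        have : 0 < ν / p.1 := div_pos hν0 hr
        linarith [hlam.1]
      have e : 1 + lam + ν / p.1 = ((1 + lam) * p.1 + ν) / p.1 := by field_simp
      simp only [hsymm, hnorm _ _ hr, norm_DopStar_polar a φ hr, smul_eq_mul, hG]
      rw [e]
      field_simp
  · intro p hp
    have hp1 : p ∈ Set.Ioi (0 : ℝ) ×ˢ Set.Ioo (-Real.pi) Real.pi := by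
      rw [← polarCoord_target]; exact hp.1
    have hr : R ≤ p.1 := by
      by_contra! h
      exact hp.2 ⟨⟨hp1.1, h⟩, hp1.2⟩
    have hz : R ≤ ‖Complex.polarCoord.symm p‖ := by
      rw [hsymm, hnorm _ _ hp1.1]; exact hr
    rw [hφR _ hz, hDR _ hz]
    simp
end

section
/- Let a ∈ (0,1/2) and ν ∈ (0, 1/2 − a). Then for every η ∈ C_c^∞(ℝ²∖{0},ℂ), ∫_{ℝ²} ( (4/ν) |x|^{1−2a} |∂_{z̄}η(x)|² + 2 |x|^{−2a} |η(x)|² ) dx ≥ ν ∫_{ℝ²} |x|^{−2a−1} |η(x)|² dx. -/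
open MeasureTheory

open scoped InnerProductSpace

/-- Fourier coefficients over a period turn differentiation of a periodic function into
multiplication by `i n`. -/
lemma fourierCoeffOn_deriv_of_periodic {g g' : ℝ → ℂ} (hg : ∀ x, HasDerivAt g (g' x) x)
    (hg' : Continuous g') (hper : g Real.pi = g (-Real.pi)) (hab : -Real.pi < Real.pi) (n : ℤ) :
    fourierCoeffOn hab g' n = Complex.I * n * fourierCoeffOn hab g n := by
  have hpi : (Real.pi : ℂ) ≠ 0 := by exact_mod_cast Real.pi_ne_zero
  rcases eq_or_ne n 0 with rfl | hn
  · rw [fourierCoeffOn_eq_integral]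
    have h := intervalIntegral.integral_eq_sub_of_hasDerivAt (a := -Real.pi) (b := Real.pi)
      (fun x _ => hg x) (hg'.intervalIntegrable _ _)
    simp [h, hper]
  · have h := fourierCoeffOn_of_hasDerivAt hab hn (fun x _ => hg x) (hg'.intervalIntegrable _ _)
    have hn' : (n : ℂ) ≠ 0 := by exact_mod_cast hn
    rw [h, hper]
    push_cast
    field_simp
    ring

/-- The operator `i d/dθ - c` on `2π`-periodic functions has spectrum `{-n - c : n ∈ ℤ}`, hence it
is bounded below by `c` when `0 ≤ c ≤ 1/2`. -/
lemma integral_norm_sq_le_of_periodic {c : ℝ} (hc0 : 0 ≤ c) (hc : c ≤ 1 / 2) {g g' : ℝ → ℂ}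
    (hg : ∀ x, HasDerivAt g (g' x) x) (hg' : Continuous g')
    (hper : g Real.pi = g (-Real.pi)) :
    c ^ 2 * ∫ x in -Real.pi..Real.pi, ‖g x‖ ^ 2 ≤
      ∫ x in -Real.pi..Real.pi, ‖Complex.I * g' x - c * g x‖ ^ 2 := by
  have hab : -Real.pi < Real.pi := by linarith [Real.pi_pos]
  have hgc : Continuous g := continuous_iff_continuousAt.2 fun x => (hg x).continuousAt
  have hL2 : ∀ h : ℝ → ℂ, Continuous h →
      MemLp h 2 (volume.restrict (Set.Ioc (-Real.pi) Real.pi)) := fun h hh =>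
    (memLp_two_iff_integrable_sq_norm hh.aestronglyMeasurable).2
      ((hh.norm.pow 2).integrableOn_Icc.mono_set Set.Ioc_subset_Icc_self)
  have hcoef : ∀ n : ℤ, fourierCoeffOn hab (fun x => Complex.I * g' x - c * g x) n =
      -(n + c) * fourierCoeffOn hab g n := by
    intro n
    have hd := fourierCoeffOn_deriv_of_periodic hg hg' hper hab n
    have hfc : Continuous fun x : ℝ => (fourier (-n) (x : AddCircle (Real.pi - -Real.pi)) : ℂ) :=
      (map_continuous (fourier (-n))).comp (AddCircle.continuous_mk' _)
    have hsub : fourierCoeffOn hab (fun x => Complex.I * g' x - c * g x) n =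
        Complex.I * fourierCoeffOn hab g' n - c * fourierCoeffOn hab g n := by
      rw [← fourierCoeffOn.const_mul, ← fourierCoeffOn.const_mul, fourierCoeffOn_eq_integral,
        fourierCoeffOn_eq_integral, fourierCoeffOn_eq_integral, ← smul_sub,
        ← intervalIntegral.integral_sub]
      · simp only [smul_eq_mul, mul_sub]
      · exact (hfc.smul (continuous_const.mul hg')).intervalIntegrable _ _
      · exact (hfc.smul (continuous_const.mul hgc)).intervalIntegrable _ _
    rw [hsub, hd]
    linear_combination (n : ℂ) * fourierCoeffOn hab g n * Complex.I_mul_I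
  have h1 := (hasSum_sq_fourierCoeffOn hab (hL2 g hgc)).mul_left (c ^ 2)
  have h2 := hasSum_sq_fourierCoeffOn hab
    (hL2 (fun x => Complex.I * g' x - c * g x) (by fun_prop))
  have h3 := hasSum_le (fun n => ?_) h1 h2
  · have hp : (0 : ℝ) < (Real.pi - -Real.pi)⁻¹ := by
      have := Real.pi_pos
      positivity
    simp only [smul_eq_mul] at h3
    rw [mul_left_comm] at h3
    exact le_of_mul_le_mul_left h3 hp
  · rw [hcoef, norm_mul, mul_pow]
    refine mul_le_mul_of_nonneg_right ?_ (sq_nonneg _)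
    rw [norm_neg, show ((n : ℂ) + c) = ((n + c : ℝ) : ℂ) by push_cast; rfl, Complex.norm_real,
      Real.norm_eq_abs, sq_abs]
    have : (0 : ℝ) ≤ n * (n + 2 * c) := by
      rcases le_or_gt 0 n with h | h
      · have : (0 : ℝ) ≤ n := by exact_mod_cast h
        positivity
      · have : (n : ℝ) ≤ -1 := by exact_mod_cast (by omega : n ≤ -1)
        exact mul_nonneg_of_nonpos_of_nonpos (by linarith) (by linarith)
    nlinarith

/-- In a double integral over a rectangle, the cross term of `‖∂ₜG + (i ∂_θ - c) G‖²` vanishes when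
`G` vanishes at the ends of the `t`-range and is periodic in `θ`. -/
lemma integral_cross_term_eq_zero (c A B : ℝ) {G : ℝ × ℝ → ℂ} (hG : ContDiff ℝ 2 G)
    (hper : ∀ t θ, G (t, θ + 2 * Real.pi) = G (t, θ)) (hA : ∀ θ, G (A, θ) = 0)
    (hB : ∀ θ, G (B, θ) = 0) :
    ∫ t in A..B, ∫ θ in -Real.pi..Real.pi, 2 * ⟪fderiv ℝ G (t, θ) (1, 0),
      Complex.I * fderiv ℝ G (t, θ) (0, 1) - c * G (t, θ)⟫_ℝ = 0 := by
  have hD : ContDiff ℝ 1 (fderiv ℝ G) := hG.fderiv_right (by norm_num)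
  have hG1 : ContDiff ℝ 1 G := hG.of_le (by norm_num)
  have hDper : ∀ t, fderiv ℝ G (t, Real.pi) = fderiv ℝ G (t, -Real.pi) := by
    intro t
    have h : (fun p : ℝ × ℝ => G (p + (0, 2 * Real.pi))) = G := by
      ext ⟨t, θ⟩
      simpa using hper t θ
    have h2 := fderiv_comp_add_right (𝕜 := ℝ) (f := G) (x := (t, -Real.pi)) (0, 2 * Real.pi)
    rw [h] at h2
    rw [h2]
    congr 1
    ext <;> simp
    ring
  have hGper : ∀ t, G (t, Real.pi) = G (t, -Real.pi) := by
    intro t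
    rw [← hper t (-Real.pi)]
    congr 2
    ring
  set f : ℝ × ℝ → ℝ := fun p => -c * ⟪G p, G p⟫_ℝ + ⟪G p, Complex.I * fderiv ℝ G p (0, 1)⟫_ℝ
    with hf
  set g : ℝ × ℝ → ℝ := fun p => -⟪G p, Complex.I * fderiv ℝ G p (1, 0)⟫_ℝ with hg
  have hDv : ∀ v : ℝ × ℝ, ContDiff ℝ 1 fun p => Complex.I * fderiv ℝ G p v := fun v =>
    contDiff_const.mul (hD.clm_apply contDiff_const)
  have hfC : ContDiff ℝ 1 f := (contDiff_const.mul (hG1.inner ℝ hG1)).add (hG1.inner ℝ (hDv _))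
  have hgC : ContDiff ℝ 1 g := (hG1.inner ℝ (hDv _)).neg
  have hdG : ∀ p, HasFDerivAt G (fderiv ℝ G p) p := fun p =>
    (hG1.differentiable (by norm_num) p).hasFDerivAt
  have hdD : ∀ p, HasFDerivAt (fderiv ℝ G) (fderiv ℝ (fderiv ℝ G) p) p := fun p =>
    (hD.differentiable (by norm_num) p).hasFDerivAt
  have hdDv : ∀ p v, HasFDerivAt (fun p => Complex.I * fderiv ℝ G p v)
      (Complex.I • (fderiv ℝ (fderiv ℝ G) p).flip v) p := fun p v => by
    have := ((hdD p).clm_apply (hasFDerivAt_const v p)).const_mul Complex.I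
    simpa using this
  have hdiv : ∀ p, fderiv ℝ f p (1, 0) + fderiv ℝ g p (0, 1) =
      2 * ⟪fderiv ℝ G p (1, 0), Complex.I * fderiv ℝ G p (0, 1) - c * G p⟫_ℝ := by
    intro p
    have hsymm : fderiv ℝ (fderiv ℝ G) p (1, 0) (0, 1) = fderiv ℝ (fderiv ℝ G) p (0, 1) (1, 0) :=
      (hG.contDiffAt.isSymmSndFDerivAt (by simp)) _ _
    have h1 : HasFDerivAt f _ p :=
      (((hdG p).inner ℝ (hdG p)).const_mul (-c)).add ((hdG p).inner ℝ (hdDv p (0, 1)))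
    have h2 : HasFDerivAt g _ p := ((hdG p).inner ℝ (hdDv p (1, 0))).neg
    rw [h1.fderiv, h2.fderiv]
    simp [hsymm, Complex.inner]
    ring
  have key := integral2_divergence_prod_of_hasFDerivAt f g (fderiv ℝ f) (fderiv ℝ g)
    A (-Real.pi) B Real.pi hfC.continuous.continuousOn hgC.continuous.continuousOn
    (fun p _ => (hfC.differentiable (by norm_num) p).hasFDerivAt)
    (fun p _ => (hgC.differentiable (by norm_num) p).hasFDerivAt)
    (ContinuousOn.integrableOn_compact (isCompact_uIcc.prod isCompact_uIcc)
      (((hfC.continuous_fderiv (by norm_num)).clm_apply continuous_const).add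
        ((hgC.continuous_fderiv (by norm_num)).clm_apply continuous_const)).continuousOn)
  simp only [hdiv] at key
  rw [key]
  simp [hf, hg, hA, hB, hDper, hGper]

/-- A weighted Hardy inequality for the Cauchy-Riemann operator in logarithmic polar coordinates. -/
lemma hardy_cylinder {c A B : ℝ} (hc0 : 0 ≤ c) (hc : c ≤ 1 / 2) (hAB : A ≤ B)
    {G : ℝ × ℝ → ℂ} (hG : ContDiff ℝ 2 G)
    (hper : ∀ t θ, G (t, θ + 2 * Real.pi) = G (t, θ)) (hA : ∀ θ, G (A, θ) = 0)
    (hB : ∀ θ, G (B, θ) = 0) :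
    c ^ 2 * ∫ t in A..B, ∫ θ in -Real.pi..Real.pi, ‖G (t, θ)‖ ^ 2 ≤
      ∫ t in A..B, ∫ θ in -Real.pi..Real.pi, ‖fderiv ℝ G (t, θ) (1, 0) - c * G (t, θ)
        + Complex.I * fderiv ℝ G (t, θ) (0, 1)‖ ^ 2 := by
  have hGc : Continuous G := hG.continuous
  have hDc : Continuous (fderiv ℝ G) := hG.continuous_fderiv (by norm_num)
  have hv : ∀ v, Continuous fun p => fderiv ℝ G p v := fun v => hDc.clm_apply continuous_const
  have h10 := hv (1, 0)
  have h01 := hv (0, 1)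
  have hInt : ∀ h : ℝ × ℝ → ℝ, Continuous h →
      Continuous fun t => ∫ θ in -Real.pi..Real.pi, h (t, θ) := fun h hh =>
    intervalIntegral.continuous_parametric_intervalIntegral_of_continuous' (by exact hh) _ _
  have hslice : ∀ (h : ℝ × ℝ → ℝ), Continuous h → ∀ t,
      IntervalIntegrable (fun θ => h (t, θ)) volume (-Real.pi) Real.pi := fun h hh t =>
    (hh.comp (by fun_prop : Continuous fun θ : ℝ => (t, θ))).intervalIntegrable _ _
  set X : ℝ × ℝ → ℝ := fun p => 2 * ⟪fderiv ℝ G p (1, 0),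
      Complex.I * fderiv ℝ G p (0, 1) - c * G p⟫_ℝ with hX
  set N : ℝ × ℝ → ℝ := fun p => ‖Complex.I * fderiv ℝ G p (0, 1) - c * G p‖ ^ 2 with hN
  set M : ℝ × ℝ → ℝ := fun p => ‖fderiv ℝ G p (1, 0) - c * G p
        + Complex.I * fderiv ℝ G p (0, 1)‖ ^ 2 with hM
  have hXc : Continuous X := continuous_const.mul (h10.inner (by fun_prop))
  have hNc : Continuous N := by fun_prop
  have hMc : Continuous M := by fun_prop
  have hpt : ∀ p, N p + X p ≤ M p := by
    intro p
    have : fderiv ℝ G p (1, 0) - c * G p + Complex.I * fderiv ℝ G p (0, 1) =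
      fderiv ℝ G p (1, 0) + (Complex.I * fderiv ℝ G p (0, 1) - c * G p) := by ring
    simp only [hM, hN, hX, this]
    rw [norm_add_sq_real]
    nlinarith [sq_nonneg ‖fderiv ℝ G p (1, 0)‖]
  have hX0 : ∫ t in A..B, ∫ θ in -Real.pi..Real.pi, X (t, θ) = 0 :=
    integral_cross_term_eq_zero c A B hG hper hA hB
  have hpi : -Real.pi ≤ Real.pi := by linarith [Real.pi_pos]
  calc c ^ 2 * ∫ t in A..B, ∫ θ in -Real.pi..Real.pi, ‖G (t, θ)‖ ^ 2
      = ∫ t in A..B, c ^ 2 * ∫ θ in -Real.pi..Real.pi, ‖G (t, θ)‖ ^ 2 := by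
        rw [intervalIntegral.integral_const_mul]
    _ ≤ ∫ t in A..B, ∫ θ in -Real.pi..Real.pi, N (t, θ) := by
        refine intervalIntegral.integral_mono_on hAB
          ((continuous_const.mul (hInt (fun p => ‖G p‖ ^ 2) (by fun_prop))).intervalIntegrable _ _)
          ((hInt N hNc).intervalIntegrable _ _) fun t _ => ?_
        refine integral_norm_sq_le_of_periodic hc0 hc (g := fun θ => G (t, θ))
          (g' := fun θ => fderiv ℝ G (t, θ) (0, 1)) (fun θ => ?_)
          (h01.comp (by fun_prop : Continuous fun θ : ℝ => (t, θ))) ?_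
        · exact (hG.differentiable (by norm_num) (t, θ)).hasFDerivAt.comp_hasDerivAt θ
            ((hasDerivAt_const θ t).prodMk (hasDerivAt_id θ))
        · rw [← hper t (-Real.pi)]
          congr 2
          ring
    _ = ∫ t in A..B, ∫ θ in -Real.pi..Real.pi, (N (t, θ) + X (t, θ)) := by
        simp_rw [intervalIntegral.integral_add (hslice N hNc _) (hslice X hXc _)]
        rw [intervalIntegral.integral_add ((hInt N hNc).intervalIntegrable _ _)
          ((hInt X hXc).intervalIntegrable _ _), hX0, add_zero]
    _ ≤ ∫ t in A..B, ∫ θ in -Real.pi..Real.pi, M (t, θ) :=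
        intervalIntegral.integral_mono_on hAB
          ((hInt (fun p => N p + X p) (hNc.add hXc)).intervalIntegrable _ _)
          ((hInt M hMc).intervalIntegrable _ _) fun t _ =>
            intervalIntegral.integral_mono_on hpi
              (hslice (fun p => N p + X p) (hNc.add hXc) t) (hslice M hMc t) fun θ _ => hpt _

/-- A function that is continuous off the origin and vanishes outside an annulus is integrable. -/
lemma integrable_of_annulus {A B : ℝ} {f : ℂ → ℝ} (hf : ContinuousOn f {0}ᶜ)
    (hfA : ∀ z, ‖z‖ ≤ Real.exp A → f z = 0) (hfB : ∀ z, Real.exp B ≤ ‖z‖ → f z = 0) :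
    Integrable f := by
  have hK : IsCompact (Metric.closedBall (0 : ℂ) (Real.exp B) \ Metric.ball 0 (Real.exp A)) :=
    (isCompact_closedBall _ _).diff Metric.isOpen_ball
  refine ((hf.mono ?_).integrableOn_compact hK).integrable_of_forall_notMem_eq_zero ?_
  · rintro z ⟨-, hz⟩ rfl
    exact hz (Metric.mem_ball_self (Real.exp_pos A))
  · intro z hz
    simp only [Set.mem_sdiff, mem_closedBall_zero_iff, mem_ball_zero_iff, not_and_or, not_not,
      not_le] at hz
    exact hz.elim (fun h => hfB z h.le) fun h => hfA z h.le

/-- Integration in logarithmic polar coordinates of functions supported in an annulus. -/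
lemma integral_eq_integral_log_polar {A B : ℝ} (hAB : A ≤ B) {f : ℂ → ℝ}
    (hf : ContinuousOn f {0}ᶜ)
    (hfA : ∀ z, ‖z‖ ≤ Real.exp A → f z = 0) (hfB : ∀ z, Real.exp B ≤ ‖z‖ → f z = 0) :
    ∫ z, f z = ∫ t in A..B, ∫ θ in -Real.pi..Real.pi,
      Real.exp (2 * t) * f (Complex.exp (t + θ * Complex.I)) := by
  have hpi : -Real.pi ≤ Real.pi := by linarith [Real.pi_pos]
  have hE : Real.exp A ≤ Real.exp B := Real.exp_le_exp.2 hAB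
  set P : ℝ × ℝ → ℝ := fun p => p.1 * f (p.1 * Complex.exp (p.2 * Complex.I)) with hP
  have hPi : IntegrableOn P (Set.Ioc (Real.exp A) (Real.exp B) ×ˢ Set.Ioc (-Real.pi) Real.pi) := by
    have hcont : ContinuousOn P
        (Set.Icc (Real.exp A) (Real.exp B) ×ˢ Set.Icc (-Real.pi) Real.pi) := by
      refine continuousOn_fst.mul (hf.comp (by fun_prop) ?_)
      rintro ⟨r, θ⟩ ⟨⟨hr, -⟩, -⟩
      have : r ≠ 0 := ((Real.exp_pos A).trans_le hr).ne'
      simpa using this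
    exact (hcont.integrableOn_compact (isCompact_Icc.prod isCompact_Icc)).mono_set
      (Set.prod_mono Set.Ioc_subset_Icc_self Set.Ioc_subset_Icc_self)
  calc ∫ z, f z = ∫ p in Set.Ioi (0 : ℝ) ×ˢ Set.Ioo (-Real.pi) Real.pi, P p := by
        rw [← Complex.integral_comp_polarCoord_symm, polarCoord_target]
        simp only [hP, Complex.polarCoord_symm_apply, smul_eq_mul, Complex.exp_mul_I,
          Complex.ofReal_cos, Complex.ofReal_sin]
    _ = ∫ p in Set.Ioi (0 : ℝ) ×ˢ Set.Ioc (-Real.pi) Real.pi, P p :=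
        setIntegral_congr_set (Measure.set_prod_ae_eq (ae_eq_refl _) Ioo_ae_eq_Ioc)
    _ = ∫ p in Set.Ioc (Real.exp A) (Real.exp B) ×ˢ Set.Ioc (-Real.pi) Real.pi, P p := by
        refine setIntegral_eq_of_subset_of_forall_sdiff_eq_zero
          (measurableSet_Ioi.prod measurableSet_Ioc)
          (Set.prod_mono (fun r hr => (Real.exp_pos A).trans hr.1) subset_rfl) ?_
        rintro ⟨r, θ⟩ ⟨⟨hr, hθ⟩, hn⟩
        have hr' : (0 : ℝ) < r := hr
        have hnorm : ‖(r : ℂ) * Complex.exp (θ * Complex.I)‖ = r := by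
          simp [Complex.norm_exp_ofReal_mul_I, abs_of_pos hr']
        simp only [hP]
        rcases le_or_gt r (Real.exp A) with h | h
        · rw [hfA _ (by rwa [hnorm]), mul_zero]
        · rcases le_or_gt (Real.exp B) r with h' | h'
          · rw [hfB _ (by rwa [hnorm]), mul_zero]
          · exact absurd ⟨⟨h, h'.le⟩, hθ⟩ hn
    _ = ∫ r in Real.exp A..Real.exp B, ∫ θ in -Real.pi..Real.pi, P (r, θ) := by
        rw [Measure.volume_eq_prod, setIntegral_prod _ hPi, intervalIntegral.integral_of_le hE]
        simp only [intervalIntegral.integral_of_le hpi]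
    _ = ∫ t in A..B, (∫ θ in -Real.pi..Real.pi, P (Real.exp t, θ)) * Real.exp t :=
        (intervalIntegral.integral_comp_mul_deriv_of_deriv_nonneg
          (g := fun r => ∫ θ in -Real.pi..Real.pi, P (r, θ)) Real.continuous_exp.continuousOn
          (fun t _ => Real.hasDerivAt_exp t) (fun t _ => (Real.exp_pos t).le)).symm
    _ = _ := by
        congr 1
        ext t
        rw [← intervalIntegral.integral_mul_const]
        congr 1
        ext θ
        simp only [hP, Complex.exp_add, Complex.ofReal_exp, two_mul, Real.exp_add]
        ring

/-- A compactly supported function whose support avoids the origin is supported in an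
annulus. -/
lemma exists_tsupport_subset_annulus {η : ℂ → ℂ} (hc : HasCompactSupport η)
    (h0 : (0 : ℂ) ∉ tsupport η) : ∃ A B : ℝ, A ≤ B ∧
      ∀ z ∈ tsupport η, Real.exp A < ‖z‖ ∧ ‖z‖ < Real.exp B := by
  obtain ⟨ε, hε, hball⟩ := Metric.isOpen_iff.1 (isClosed_tsupport η).isOpen_compl 0 h0
  obtain ⟨R, hR⟩ := hc.isCompact.isBounded.exists_norm_le
  refine ⟨Real.log (ε / 2), max (Real.log (ε / 2)) (Real.log (|R| + 1)), le_max_left _ _,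
    fun z hz => ⟨?_, ?_⟩⟩
  · rw [Real.exp_log (by positivity)]
    by_contra! h
    exact hball (mem_ball_zero_iff.2 (by linarith)) hz
  · calc ‖z‖ < |R| + 1 := by linarith [hR z hz, le_abs_self R]
      _ = Real.exp (Real.log (|R| + 1)) := (Real.exp_log (by positivity)).symm
      _ ≤ _ := Real.exp_le_exp.2 (le_max_right _ _)

/-- The Wirtinger derivative in logarithmic polar coordinates. -/
lemma fderiv_add_I_mul_fderiv (η : ℂ → ℂ) (z : ℂ) :
    fderiv ℝ η z z + Complex.I * fderiv ℝ η z (z * Complex.I) =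
      2 * (starRingEnd ℂ z * wirtingerZbar η z) := by
  have h : ∀ x y : ℝ, fderiv ℝ η z (x + y * Complex.I) =
      x * fderiv ℝ η z 1 + y * fderiv ℝ η z Complex.I := by
    intro x y
    have : (x + y * Complex.I : ℂ) = x • (1 : ℂ) + y • Complex.I := by simp
    rw [this, map_add, map_smul, map_smul, Complex.real_smul, Complex.real_smul]
  have h1 := h z.re z.im
  have h2 := h (-z.im) z.re
  have e2 : ((-z.im : ℝ) : ℂ) + z.re * Complex.I = z * Complex.I := by
    apply Complex.ext <;> simp
  have e3 : starRingEnd ℂ z = z.re - z.im * Complex.I := by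
    apply Complex.ext <;> simp
  rw [e2] at h2
  rw [Complex.re_add_im] at h1
  rw [h1, h2, e3, wirtingerZbar]
  push_cast
  linear_combination (z.im * fderiv ℝ η z Complex.I) * Complex.I_mul_I

lemma continuous_wirtingerZbar {η : ℂ → ℂ} (hs : ContDiff ℝ 1 η) :
    Continuous (wirtingerZbar η) := by
  have h : Continuous (fderiv ℝ η) := hs.continuous_fderiv (by norm_num)
  unfold wirtingerZbar
  fun_prop

lemma wirtingerZbar_eq_zero_of_notMem_tsupport {η : ℂ → ℂ} {z : ℂ} (hz : z ∉ tsupport η) :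
    wirtingerZbar η z = 0 := by
  have h : fderiv ℝ η z = 0 :=
    Function.notMem_support.1 fun h => hz (support_fderiv_subset ℝ h)
  simp [wirtingerZbar, h]

lemma continuousOn_norm_rpow_mul_norm_sq (k s : ℝ) {h : ℂ → ℂ} (hh : Continuous h) :
    ContinuousOn (fun z => k * ‖z‖ ^ s * ‖h z‖ ^ 2) {0}ᶜ :=
  (continuousOn_const.mul (continuous_norm.continuousOn.rpow_const fun _ hz =>
    Or.inl (norm_ne_zero_iff.2 hz))).mul (hh.norm.pow 2).continuousOn

/-- The sharp weighted Hardy inequality for `∂_{z̄}` away from the origin. -/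
lemma hardy_wirtingerZbar {c : ℝ} (hc0 : 0 ≤ c) (hc : c ≤ 1 / 2) {A B : ℝ} (hAB : A ≤ B)
    {η : ℂ → ℂ} (hs : ContDiff ℝ 2 η)
    (hη : ∀ z ∈ tsupport η, Real.exp A < ‖z‖ ∧ ‖z‖ < Real.exp B) :
    c ^ 2 * ∫ z : ℂ, ‖z‖ ^ (2 * c - 2) * ‖η z‖ ^ 2 ≤
      ∫ z : ℂ, 4 * ‖z‖ ^ (2 * c) * ‖wirtingerZbar η z‖ ^ 2 := by
  have hw : ∀ z, z ∉ tsupport η → wirtingerZbar η z = 0 := fun z =>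
    wirtingerZbar_eq_zero_of_notMem_tsupport
  have hnA : ∀ z, ‖z‖ ≤ Real.exp A → z ∉ tsupport η := fun z hz h => (hη z h).1.not_ge hz
  have hnB : ∀ z, Real.exp B ≤ ‖z‖ → z ∉ tsupport η := fun z hz h => (hη z h).2.not_ge hz
  have h0 : ∀ z, z ∉ tsupport η → η z = 0 := fun z => image_eq_zero_of_notMem_tsupport
  rw [integral_eq_integral_log_polar hAB
      (continuousOn_norm_rpow_mul_norm_sq 4 (2 * c) (continuous_wirtingerZbar
        (hs.of_le (by norm_num)))) (fun z hz => by simp [hw z (hnA z hz)])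
      (fun z hz => by simp [hw z (hnB z hz)]),
    integral_eq_integral_log_polar hAB
      (by simpa using continuousOn_norm_rpow_mul_norm_sq 1 (2 * c - 2) hs.continuous)
      (fun z hz => by simp [h0 z (hnA z hz)])
      (fun z hz => by simp [h0 z (hnB z hz)])]
  set W : ℝ × ℝ → ℂ := fun p => Complex.exp (p.1 + p.2 * Complex.I) with hW
  set G : ℝ × ℝ → ℂ := fun p => (Real.exp (c * p.1) : ℂ) * η (W p) with hGdef
  have hlin : ∀ p, HasFDerivAt (fun p : ℝ × ℝ => (p.1 + p.2 * Complex.I : ℂ))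
      (Complex.ofRealCLM.comp (ContinuousLinearMap.fst ℝ ℝ ℝ) +
        Complex.I • Complex.ofRealCLM.comp (ContinuousLinearMap.snd ℝ ℝ ℝ)) p := fun p => by
    convert ContinuousLinearMap.hasFDerivAt (Complex.ofRealCLM.comp
      (ContinuousLinearMap.fst ℝ ℝ ℝ) +
        Complex.I • Complex.ofRealCLM.comp (ContinuousLinearMap.snd ℝ ℝ ℝ)) using 1
    ext q
    simp [mul_comm]
  have hWd : ∀ p, HasFDerivAt W _ p := fun p => (hlin p).cexp
  have hWnorm : ∀ p, ‖W p‖ = Real.exp p.1 := fun p => by simp [hW, Complex.norm_exp]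
  have hWc : ContDiff ℝ 2 W := by
    have : ContDiff ℝ 2 fun p : ℝ × ℝ => (p.1 + p.2 * Complex.I : ℂ) :=
      (Complex.ofRealCLM.contDiff.comp contDiff_fst).add
        ((Complex.ofRealCLM.contDiff.comp contDiff_snd).mul contDiff_const)
    exact this.cexp
  have hGC : ContDiff ℝ 2 G :=
    (Complex.ofRealCLM.contDiff.comp (contDiff_const.mul contDiff_fst).exp).mul (hs.comp hWc)
  have hexp : ∀ p : ℝ × ℝ, HasFDerivAt (fun p : ℝ × ℝ => (Real.exp (c * p.1) : ℂ)) _ p := fun p =>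
    Complex.ofRealCLM.hasFDerivAt.comp p
      (((ContinuousLinearMap.fst ℝ ℝ ℝ).hasFDerivAt.const_mul c).exp)
  have hGd : ∀ p, HasFDerivAt G _ p := fun p =>
    (hexp p).mul (((hs.differentiable (by norm_num) (W p)).hasFDerivAt).comp p (hWd p))
  have hcr : ∀ p, fderiv ℝ G p (1, 0) - c * G p + Complex.I * fderiv ℝ G p (0, 1) =
      Real.exp (c * p.1) * (2 * (starRingEnd ℂ (W p) * wirtingerZbar η (W p))) := by
    intro p
    rw [← fderiv_add_I_mul_fderiv, (hGd p).fderiv]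
    simp [hGdef, hW]
    ring
  have key := hardy_cylinder hc0 hc hAB hGC
    (fun t θ => by
      have : W (t, θ + 2 * Real.pi) = W (t, θ) := by
        simp only [hW]
        rw [← Complex.exp_periodic (t + θ * Complex.I)]
        congr 1
        push_cast
        ring
      simp only [hGdef, this])
    (fun θ => by simp only [hGdef]; rw [h0 _ (hnA _ (hWnorm (A, θ)).le), mul_zero])
    (fun θ => by simp only [hGdef]; rw [h0 _ (hnB _ (hWnorm (B, θ)).ge), mul_zero])
  simp only [hcr] at key
  have hrw : ∀ (s t θ : ℝ), ‖Complex.exp (t + θ * Complex.I)‖ ^ s = Real.exp (s * t) := by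
    intro s t θ
    rw [show ‖Complex.exp (t + θ * Complex.I)‖ = Real.exp t from hWnorm (t, θ), ← Real.exp_mul,
      mul_comm]
  have hGnorm : ∀ t θ : ℝ, Real.exp (2 * t) * (‖Complex.exp (t + θ * Complex.I)‖ ^ (2 * c - 2) *
      ‖η (Complex.exp (t + θ * Complex.I))‖ ^ 2) = ‖G (t, θ)‖ ^ 2 := by
    intro t θ
    rw [hrw, ← mul_assoc, ← Real.exp_add]
    simp only [hGdef, hW, norm_mul, Complex.norm_real, Real.norm_eq_abs, Real.abs_exp, mul_pow]
    rw [← Real.exp_nat_mul]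
    congr 2
    push_cast
    ring
  have hDnorm : ∀ t θ : ℝ, Real.exp (2 * t) * (4 * ‖Complex.exp (t + θ * Complex.I)‖ ^ (2 * c) *
      ‖wirtingerZbar η (Complex.exp (t + θ * Complex.I))‖ ^ 2) =
      ‖(Real.exp (c * t) * (2 * (starRingEnd ℂ (W (t, θ)) * wirtingerZbar η (W (t, θ)))) : ℂ)‖ ^ 2
      := by
    intro t θ
    rw [hrw, norm_mul, norm_mul, norm_mul, RCLike.norm_conj, hWnorm, Complex.norm_real,
      Real.norm_eq_abs, Real.abs_exp, mul_pow, mul_pow, mul_pow, ← Real.exp_nat_mul,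
      ← Real.exp_nat_mul]
    simp only [hW, Complex.norm_ofNat]
    push_cast
    rw [mul_assoc 2 c t]
    ring
  simpa only [hGnorm, hDnorm] using key

theorem stmt11 (a ν : ℝ) (ha : a ∈ Set.Ioo (0 : ℝ) (1/2)) (hν : ν ∈ Set.Ioo (0 : ℝ) (1/2 - a))
    (η : ℂ → ℂ) (hs : ContDiff ℝ (⊤ : ℕ∞) η) (hc : HasCompactSupport η) (h0 : (0 : ℂ) ∉ tsupport η) :
    ∫ x : ℂ, ((4/ν) * ‖x‖ ^ (1 - 2*a) * ‖wirtingerZbar η x‖^2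
        + 2 * ‖x‖ ^ (-2*a) * ‖η x‖^2)
      ≥ ν * ∫ x : ℂ, ‖x‖ ^ (-2*a - 1) * ‖η x‖^2 := by
  obtain ⟨ha0, ha1⟩ := ha
  obtain ⟨hν0, hν1⟩ := hν
  obtain ⟨A, B, hAB, hη⟩ := exists_tsupport_subset_annulus hc h0
  have hs2 : ContDiff ℝ 2 η := contDiff_infty.1 hs 2
  have hs1 : ContDiff ℝ 1 η := hs2.of_le (by norm_num)
  have hη0 : ∀ z, z ∉ tsupport η → η z = 0 := fun z => image_eq_zero_of_notMem_tsupport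
  have hw0 : ∀ z, z ∉ tsupport η → wirtingerZbar η z = 0 := fun z =>
    wirtingerZbar_eq_zero_of_notMem_tsupport
  have hInt : ∀ (k s : ℝ) (h : ℂ → ℂ), Continuous h → (∀ z, z ∉ tsupport η → h z = 0) →
      Integrable fun z : ℂ => k * ‖z‖ ^ s * ‖h z‖ ^ 2 := fun k s h hh hz =>
    integrable_of_annulus (A := A) (B := B) (continuousOn_norm_rpow_mul_norm_sq k s hh)
      (fun z hzA => by simp [hz z fun hm => (hη z hm).1.not_ge hzA])
      (fun z hzB => by simp [hz z fun hm => (hη z hm).2.not_ge hzB])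
  have hD := hInt (4 / ν) (1 - 2 * a) _ (continuous_wirtingerZbar hs1) hw0
  have hE := hInt 2 (-2 * a) _ hs1.continuous hη0
  have key := hardy_wirtingerZbar (c := 1 / 2 - a) (by linarith) (by linarith) hAB hs2 hη
  rw [show 2 * (1 / 2 - a) = 1 - 2 * a by ring, show 1 - 2 * a - 2 = -2 * a - 1 by ring] at key
  have hI : 0 ≤ ∫ x : ℂ, ‖x‖ ^ (-2 * a - 1) * ‖η x‖ ^ 2 :=
    integral_nonneg fun z => by positivity
  calc ν * ∫ x : ℂ, ‖x‖ ^ (-2 * a - 1) * ‖η x‖ ^ 2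
      = ν⁻¹ * (ν ^ 2 * ∫ x : ℂ, ‖x‖ ^ (-2 * a - 1) * ‖η x‖ ^ 2) := by
        field_simp
    _ ≤ ν⁻¹ * ∫ x : ℂ, 4 * ‖x‖ ^ (1 - 2 * a) * ‖wirtingerZbar η x‖ ^ 2 := by
        refine mul_le_mul_of_nonneg_left (le_trans ?_ key) (inv_nonneg.2 hν0.le)
        gcongr
    _ = ∫ x : ℂ, (4 / ν) * ‖x‖ ^ (1 - 2 * a) * ‖wirtingerZbar η x‖ ^ 2 := by
        rw [← integral_const_mul]
        congr 1
        ext x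
        ring
    _ ≤ _ := integral_mono hD (hD.add hE) fun z => le_add_of_nonneg_right (by positivity)
end

section
/- Let ν ∈ (0,1/2], a ∈ (1/2 − ν, 1/2), and λ ∈ (−1,1). Then there exists a square-integrable function φ : ℝ² → ℂ which is smooth on ℝ²∖{0}, such that ∫_{ℝ²} (|x|/(1+|x|)) |D_a^* φ(x)|² dx < ∞, the integrals ∫_{ℝ²} |D_a^* φ(x)|²/(1 + λ + ν/|x|) dx and ∫_{ℝ²} (ν/|x|) |φ(x)|² dx are finite, and Q_{ν,a,λ}(φ) := ∫_{ℝ²} ( |D_a^* φ(x)|² / (1 + λ + ν/|x|) + (1 − λ − ν/|x|) |φ(x)|² ) dx < 0. -/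
open MeasureTheory

lemma wirtingerZbar_radial {F : ℝ → ℝ} {F' : ℝ} {x : ℂ} (hx : x ≠ 0)
    (hF : HasDerivAt F F' ‖x‖) :
    wirtingerZbar (fun y => (F ‖y‖ : ℂ)) x = (1/2 : ℂ) * (F' * (x / ‖x‖)) := by
  have hnorm : HasFDerivAt (fun y : ℂ => ‖y‖) (‖x‖⁻¹ • innerSL ℝ x) x := by
    have h := (hasStrictFDerivAt_norm_sq x).hasFDerivAt.sqrt (by simpa using hx)
    simp only [Real.sqrt_sq (norm_nonneg _)] at h
    refine h.congr_fderiv ?_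
    ext v
    simp
    ring
  have h : HasFDerivAt (fun y : ℂ => (F ‖y‖ : ℂ))
      (Complex.ofRealCLM.comp (F' • (‖x‖⁻¹ • innerSL ℝ x))) x :=
    Complex.ofRealCLM.hasFDerivAt.comp x (hF.comp_hasFDerivAt x hnorm)
  rw [wirtingerZbar, h.fderiv]
  simp [Complex.inner]
  linear_combination (F' : ℂ) * (‖x‖ : ℂ)⁻¹ * Complex.re_add_im x

lemma norm_DopStar_radial (a : ℝ) {F : ℝ → ℝ} {F' : ℝ} {x : ℂ} (hx : x ≠ 0)
    (hF : HasDerivAt F F' ‖x‖) :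
    ‖DopStar a (fun y => (F ‖y‖ : ℂ)) x‖ = |F' + a * F ‖x‖ / ‖x‖| := by
  have hr : (‖x‖ : ℂ) ≠ 0 := by simpa using hx
  have h : DopStar a (fun y => (F ‖y‖ : ℂ)) x
      = -Complex.I * (x / ‖x‖) * ((F' + a * F ‖x‖ / ‖x‖ : ℝ) : ℂ) := by
    rw [DopStar, wirtingerZbar_radial hx hF]
    push_cast
    field_simp
    ring
  rw [h, norm_mul, norm_mul, norm_div, Complex.norm_real, Complex.norm_real]
  simp [hx]

lemma hasDerivAt_rpow_mul_exp_neg (s : ℝ) {r : ℝ} (hr : 0 < r) :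
    HasDerivAt (fun r => r ^ s * Real.exp (-r)) ((s / r - 1) * (r ^ s * Real.exp (-r))) r := by
  have h := (Real.hasDerivAt_rpow_const (p := s) (Or.inl hr.ne')).mul (hasDerivAt_neg r).exp
  refine h.congr_deriv ?_
  rw [Real.rpow_sub_one hr.ne']
  field_simp
  ring

lemma norm_DopStar_rpow_mul_exp_neg_sq (a s : ℝ) {x : ℂ} (hx : x ≠ 0) :
    ‖DopStar a (fun y => ((‖y‖ ^ s * Real.exp (-‖y‖) : ℝ) : ℂ)) x‖ ^ 2
      = (((s + a) / ‖x‖ - 1) * (‖x‖ ^ s * Real.exp (-‖x‖))) ^ 2 := by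
  rw [norm_DopStar_radial a (F := fun r => r ^ s * Real.exp (-r)) hx
    (hasDerivAt_rpow_mul_exp_neg s (norm_pos_iff.2 hx)), sq_abs]
  ring

lemma integral_norm_rpow_mul_exp_neg_two {q : ℝ} (hq : -2 < q) :
    ∫ x : ℂ, ‖x‖ ^ q * Real.exp (-2 * ‖x‖)
      = 2 * Real.pi * ((2 : ℝ) ^ (-(q + 2)) * Real.Gamma (q + 2)) := by
  have h := Complex.integral_rpow_mul_exp_neg_mul_rpow (p := 1) (b := 2) le_rfl hq two_pos
  simp only [Real.rpow_one, div_one] at h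
  rw [h]
  ring

lemma integrable_norm_rpow_mul_exp_neg_two {q : ℝ} (hq : -2 < q) :
    Integrable (fun x : ℂ => ‖x‖ ^ q * Real.exp (-2 * ‖x‖)) := by
  by_contra h
  have h0 := integral_undef h
  rw [integral_norm_rpow_mul_exp_neg_two hq] at h0
  have := Real.Gamma_pos_of_pos (show 0 < q + 2 by linarith)
  have : 0 < 2 * Real.pi * ((2 : ℝ) ^ (-(q + 2)) * Real.Gamma (q + 2)) := by positivity
  exact this.ne' h0

lemma integral_norm_rpow_add_one_mul_exp_neg_two {q : ℝ} (hq : -2 < q) :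
    ∫ x : ℂ, ‖x‖ ^ (q + 1) * Real.exp (-2 * ‖x‖)
      = (q + 2) / 2 * ∫ x : ℂ, ‖x‖ ^ q * Real.exp (-2 * ‖x‖) := by
  rw [integral_norm_rpow_mul_exp_neg_two hq, integral_norm_rpow_mul_exp_neg_two (by linarith),
    show q + 1 + 2 = (q + 2) + 1 by ring, Real.Gamma_add_one (by linarith), neg_add,
    Real.rpow_add two_pos, Real.rpow_neg_one]
  ring

lemma exists_pos_symbol_neg {ν a : ℝ} (lam : ℝ) (hν : 0 < ν) (ha : a ∈ Set.Ioo (1/2 - ν) (1/2)) :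
    ∃ t : ℝ, 0 < t ∧ (((t - 1) / 2 + a) ^ 2 / ν - ν)
      + (1 - lam - 2 * ((t - 1) / 2 + a) / ν) * (t / 2) + (1 / ν) * (t * (t + 1) / 4) < 0 := by
  have hcont : Continuous fun t : ℝ => (((t - 1) / 2 + a) ^ 2 / ν - ν)
      + (1 - lam - 2 * ((t - 1) / 2 + a) / ν) * (t / 2) + (1 / ν) * (t * (t + 1) / 4) := by
    fun_prop
  have h0 : (((0 - 1) / 2 + a) ^ 2 / ν - ν)
      + (1 - lam - 2 * ((0 - 1) / 2 + a) / ν) * (0 / 2) + (1 / ν) * (0 * (0 + 1) / 4) < 0 := by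
    have : ((0 - 1) / 2 + a) ^ 2 / ν < ν := by
      rw [div_lt_iff₀ hν]
      nlinarith [ha.1, ha.2]
    linarith
  have h := (hcont.continuousAt.eventually_lt continuousAt_const h0).filter_mono
    (nhdsWithin_le_nhds (s := Set.Ioi 0))
  exact (eventually_mem_nhdsWithin.and h).exists

theorem stmt12 (ν a lam : ℝ) (hν : ν ∈ Set.Ioc (0 : ℝ) (1/2))
    (ha : a ∈ Set.Ioo (1/2 - ν) (1/2)) (hlam : lam ∈ Set.Ioo (-1 : ℝ) 1) :
    ∃ φ : ℂ → ℂ,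
      Integrable (fun x : ℂ => ‖φ x‖^2) ∧
      ContDiffOn ℝ (⊤ : ℕ∞) φ {(0 : ℂ)}ᶜ ∧
      Integrable (fun x : ℂ => (‖x‖ / (1 + ‖x‖)) * ‖DopStar a φ x‖^2) ∧
      Integrable (fun x : ℂ => ‖DopStar a φ x‖^2 / (1 + lam + ν/‖x‖)) ∧
      Integrable (fun x : ℂ => (ν/‖x‖) * ‖φ x‖^2) ∧
      ∫ x : ℂ, (‖DopStar a φ x‖^2 / (1 + lam + ν/‖x‖)
          + (1 - lam - ν/‖x‖) * ‖φ x‖^2) < 0 := by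
  have hν0 : 0 < ν := hν.1
  obtain ⟨t, ht, hneg⟩ := exists_pos_symbol_neg lam hν0 ha
  set s : ℝ := (t - 1) / 2 with hs
  set φ : ℂ → ℂ := fun y => ((‖y‖ ^ s * Real.exp (-‖y‖) : ℝ) : ℂ) with hφ
  set E : ℝ → ℂ → ℝ := fun q x => ‖x‖ ^ q * Real.exp (-2 * ‖x‖) with hE
  have hEint : ∀ q, -2 < q → Integrable (E q) := fun q hq =>
    integrable_norm_rpow_mul_exp_neg_two hq
  have hE0 := hEint (t - 2) (by linarith)
  have hE1 := hEint (t - 2 + 1) (by linarith)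
  have hE2 := hEint (t - 2 + 1 + 1) (by linarith)
  have hne : ∀ᵐ x : ℂ, x ≠ 0 := by simp [ae_iff]
  have hsucc : ∀ q (x : ℂ), x ≠ 0 → E (q + 1) x = ‖x‖ * E q x := fun q x hx => by
    simp only [hE]
    rw [Real.rpow_add_one (norm_ne_zero_iff.2 hx)]
    ring
  have hsq : ∀ x : ℂ, (‖x‖ ^ s * Real.exp (-‖x‖)) ^ 2 = E (t - 2 + 1) x := fun x => by
    simp only [hE]
    rw [mul_pow, ← Real.exp_nat_mul, ← Real.rpow_mul_natCast (norm_nonneg x)]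
    congr 2
    · rw [hs]; push_cast; ring
    · push_cast; ring
  have hφsq : ∀ x, ‖φ x‖ ^ 2 = E (t - 2 + 1) x := fun x => by
    rw [hφ, Complex.norm_real, Real.norm_eq_abs, sq_abs, hsq]
  set U : ℂ → ℝ := fun x => (s + a) ^ 2 * E (t - 2) x - 2 * (s + a) * E (t - 2 + 1) x
    + E (t - 2 + 1 + 1) x with hU
  have hUint : Integrable U := ((hE0.const_mul _).sub (hE1.const_mul _)).add hE2
  have hDU : ∀ x : ℂ, x ≠ 0 → ‖x‖ * ‖DopStar a φ x‖ ^ 2 = U x := fun x hx => by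
    have hr := norm_ne_zero_iff.2 hx
    rw [norm_DopStar_rpow_mul_exp_neg_sq a s hx, mul_pow, hsq]
    simp only [hU, hsucc _ x hx]
    field_simp
    ring
  have hφdiv : ∀ x : ℂ, x ≠ 0 → (ν / ‖x‖) * ‖φ x‖ ^ 2 = ν * E (t - 2) x := fun x hx => by
    have hr := norm_ne_zero_iff.2 hx
    rw [hφsq, hsucc _ x hx]
    field_simp
  have hDmeas : AEStronglyMeasurable (fun x => ‖DopStar a φ x‖ ^ 2) volume := by
    have hm : Measurable fun x : ℂ =>
        (((s + a) / ‖x‖ - 1) * (‖x‖ ^ s * Real.exp (-‖x‖))) ^ 2 := by fun_prop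
    exact hm.aestronglyMeasurable.congr
      (hne.mono fun x hx => (norm_DopStar_rpow_mul_exp_neg_sq a s hx).symm)
  have hφint : Integrable fun x => ‖φ x‖ ^ 2 := by simpa only [hφsq] using hE1
  have hwle : ∀ x : ℂ, x ≠ 0 →
      ‖DopStar a φ x‖ ^ 2 / (1 + lam + ν / ‖x‖) ≤ (1 / ν) * U x := fun x hx => by
    have hr := norm_pos_iff.2 hx
    rw [← hDU x hx]
    calc _ ≤ ‖DopStar a φ x‖ ^ 2 / (ν / ‖x‖) := by
          gcongr
          linarith [hlam.1]
      _ = _ := by field_simp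
  have hwpos : ∀ x : ℂ, 0 ≤ 1 + lam + ν / ‖x‖ := fun x => by
    have := hlam.1
    have : 0 ≤ ν / ‖x‖ := by positivity
    linarith
  have hDint : Integrable fun x => ‖DopStar a φ x‖ ^ 2 / (1 + lam + ν / ‖x‖) := by
    refine (hUint.const_mul (1 / ν)).mono' ?_ (hne.mono fun x hx => ?_)
    · have hm : Measurable fun x : ℂ => (1 + lam + ν / ‖x‖)⁻¹ := by fun_prop
      simp only [div_eq_mul_inv _ (1 + lam + _)]
      exact hDmeas.mul hm.aestronglyMeasurable
    · rw [Real.norm_of_nonneg (div_nonneg (sq_nonneg _) (hwpos x))]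
      exact hwle x hx
  have hVint : Integrable fun x => (ν / ‖x‖) * ‖φ x‖ ^ 2 :=
    (hE0.const_mul ν).congr (hne.mono fun x hx => (hφdiv x hx).symm)
  refine ⟨φ, hφint, fun x hx => ?_, ?_, hDint, hVint, ?_⟩
  · have hn : ContDiffAt ℝ (⊤ : ℕ∞) (fun y : ℂ => ‖y‖) x := contDiffAt_norm ℝ hx
    have h : ContDiffAt ℝ (⊤ : ℕ∞) (fun y : ℂ => ‖y‖ ^ s * Real.exp (-‖y‖)) x :=
      (hn.rpow_const_of_ne (norm_ne_zero_iff.2 hx)).mul hn.neg.exp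
    exact (Complex.ofRealCLM.contDiff.contDiffAt.comp x h).contDiffWithinAt
  · refine hUint.mono' ?_ (hne.mono fun x hx => ?_)
    · have hm : Measurable fun x : ℂ => ‖x‖ / (1 + ‖x‖) := by fun_prop
      exact hm.aestronglyMeasurable.mul hDmeas
    · rw [Real.norm_of_nonneg (by positivity), ← hDU x hx]
      gcongr
      exact div_le_self (norm_nonneg x) (by linarith [norm_nonneg x])
  · have hle : ∫ x : ℂ, (‖DopStar a φ x‖^2 / (1 + lam + ν/‖x‖)
          + (1 - lam - ν/‖x‖) * ‖φ x‖^2)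
        ≤ ∫ x : ℂ, (((s + a) ^ 2 / ν - ν) * E (t - 2) x
          + (1 - lam - 2 * (s + a) / ν) * E (t - 2 + 1) x
          + (1 / ν) * E (t - 2 + 1 + 1) x) := by
      refine integral_mono_ae ?_ (((hE0.const_mul _).add (hE1.const_mul _)).add
        (hE2.const_mul _)) (hne.mono fun x hx => ?_)
      · simp only [sub_mul _ (ν / _)]
        exact hDint.add ((hφint.const_mul _).sub hVint)
      · dsimp only
        rw [sub_mul _ (ν / _), hφdiv x hx, hφsq]
        refine (add_le_add_left (hwle x hx) _).trans_eq ?_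
        simp only [hU]
        ring
    refine hle.trans_lt ?_
    have hE01 : Integrable fun x => ((s + a) ^ 2 / ν - ν) * E (t - 2) x
        + (1 - lam - 2 * (s + a) / ν) * E (t - 2 + 1) x :=
      (hE0.const_mul _).add (hE1.const_mul _)
    rw [integral_add hE01 (hE2.const_mul _),
      integral_add (hE0.const_mul _) (hE1.const_mul _), integral_const_mul, integral_const_mul,
      integral_const_mul]
    simp only [hE]
    rw [integral_norm_rpow_add_one_mul_exp_neg_two (q := t - 2 + 1) (by linarith),
      integral_norm_rpow_add_one_mul_exp_neg_two (q := t - 2) (by linarith)]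
    have hJ : 0 < ∫ x : ℂ, ‖x‖ ^ (t - 2) * Real.exp (-2 * ‖x‖) := by
      rw [integral_norm_rpow_mul_exp_neg_two (by linarith)]
      have := Real.Gamma_pos_of_pos (show 0 < t - 2 + 2 by linarith)
      positivity
    refine lt_of_eq_of_lt ?_ (mul_neg_of_neg_of_pos hneg hJ)
    ring
end

section
/- Let ν ∈ (0,1/2) and a ∈ [0, 1/2). Then there exists λ ∈ (−1,1) such that for every φ ∈ C_c^∞(ℝ²∖{0},ℂ) one has ∫_{ℝ²} ( |D_a^* φ(x)|² / (1 + λ + ν/|x|) + (1 − λ − ν/|x|) |φ(x)|² ) dx ≥ 0 if and only if a ≤ 1/2 − ν. In other words, the critical magnetic field strength for the two-dimensional magnetic Dirac-Coulomb Hardy inequality equals 1/2 − ν. -/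
open MeasureTheory

open Real in
theorem Complex.integral_eq_integral_log_polar {G : ℂ → ℝ} (hG : Continuous G)
    (hs : HasCompactSupport G) :
    ∫ x, G x = ∫ t : ℝ, ∫ θ in -π..π, rexp t ^ 2 * G (Complex.exp (t + θ * Complex.I)) := by
  obtain ⟨R, hR⟩ := hs.isCompact.isBounded.subset_closedBall 0
  have hcont : Continuous fun p : ℝ × ℝ => p.1 • G (Complex.polarCoord.symm p) := by
    simp only [Complex.polarCoord_symm_apply]
    fun_prop
  have hint : IntegrableOn (fun p : ℝ × ℝ => p.1 • G (Complex.polarCoord.symm p))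
      (Set.Ioi 0 ×ˢ Set.Ioo (-π) π) (volume.prod volume) := by
    refine IntegrableOn.of_forall_sdiff_eq_zero (s := Set.Icc 0 R ×ˢ Set.Icc (-π) π)
      (hcont.continuousOn.integrableOn_compact (isCompact_Icc.prod isCompact_Icc))
      (measurableSet_Ioi.prod measurableSet_Ioo) ?_
    rintro ⟨r, θ⟩ ⟨⟨hr, hθ⟩, hn⟩
    have : G (Complex.polarCoord.symm (r, θ)) = 0 := by
      by_contra h
      have h1 := hR (subset_tsupport _ h)
      rw [mem_closedBall_zero_iff, Complex.norm_polarCoord_symm] at h1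
      exact hn ⟨⟨le_of_lt hr, (le_abs_self _).trans h1⟩, hθ.1.le, hθ.2.le⟩
    simp only [this, smul_zero]
  rw [← Complex.integral_comp_polarCoord_symm, polarCoord_target, Measure.volume_eq_prod,
    setIntegral_prod _ hint, ← Real.range_exp, ← Set.image_univ,
    integral_image_eq_integral_abs_deriv_smul MeasurableSet.univ
      (fun x _ => (Real.hasDerivAt_exp x).hasDerivWithinAt) Real.exp_injective.injOn]
  simp only [Measure.restrict_univ, abs_exp, smul_eq_mul]
  congr 1 with t
  rw [← integral_const_mul, intervalIntegral.integral_of_le (by linarith [pi_pos]),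
    ← integral_Ioc_eq_integral_Ioo]
  congr 1 with θ
  rw [Complex.polarCoord_symm_apply, Complex.exp_add, Complex.exp_mul_I]
  push_cast
  ring

theorem sub_sq_div_ge {X c : ℂ} {w s : ℝ} (hw : 0 < w) :
    2 * s * (X * (starRingEnd ℂ) c).re - w * s ^ 2 * ‖c‖ ^ 2 ≤ ‖X‖ ^ 2 / w := by
  rw [le_div_iff₀ hw, Complex.sq_norm, Complex.sq_norm, Complex.normSq_apply, Complex.normSq_apply]
  simp only [Complex.mul_re, Complex.conj_re, Complex.conj_im]
  nlinarith [sq_nonneg (X.re - w * s * c.re), sq_nonneg (X.im - w * s * c.im)]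

open Real in
theorem mode_integral_nonneg {c c' : ℝ → ℂ} {ν β T : ℝ} (hν : 0 < ν) (hβ : 2 * ν ≤ |2 * β - 1|)
    (hc : ∀ t, HasDerivAt c (c' t) t) (hc' : Continuous c')
    (h0 : ∀ t, T < |t| → c t = 0) (h0' : ∀ t, T < |t| → c' t = 0) :
    0 ≤ ∫ t : ℝ, (‖c' t + β * c t‖ ^ 2 / (1 + ν * rexp (-t))
      + (1 - ν * rexp (-t)) * rexp t ^ 2 * ‖c t‖ ^ 2) := by
  have hcc : Continuous c := continuous_iff_continuousAt.2 fun t => (hc t).continuousAt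
  have hw : ∀ t : ℝ, 0 < 1 + ν * rexp (-t) := fun t => by positivity
  obtain ⟨s, hs, hs1⟩ : ∃ s : ℝ, s ^ 2 = 1 ∧ s * (2 * β - 1) = |2 * β - 1| := by
    rcases abs_cases (2 * β - 1) with h | h
    · exact ⟨1, by norm_num, by linarith⟩
    · exact ⟨-1, by norm_num, by linarith⟩
  have hsupp : ∀ {f : ℝ → ℝ}, Continuous f → (∀ t, T < |t| → f t = 0) → Integrable f := by
    intro f hf hf0
    refine hf.integrable_of_hasCompactSupport
      (HasCompactSupport.intro (isCompact_Icc (a := -T) (b := T)) fun t ht => hf0 t ?_)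
    rw [Set.mem_Icc, ← abs_le] at ht
    exact not_le.1 ht
  have hd : ∀ t, HasDerivAt (fun t => s * (rexp t * ‖c t‖ ^ 2))
      (s * (rexp t * ‖c t‖ ^ 2 + rexp t * (2 * (c' t * (starRingEnd ℂ) (c t)).re))) t := by
    intro t
    have h1 := ((Real.hasDerivAt_exp t).mul (hc t).norm_sq).const_mul s
    have h2 : inner ℝ (c t) (c' t) = (c' t * (starRingEnd ℂ) (c t)).re := rfl
    rwa [h2] at h1
  have hz : ∫ t, (s * (rexp t * ‖c t‖ ^ 2 + rexp t * (2 * (c' t * (starRingEnd ℂ) (c t)).re)))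
      = 0 := by
    refine integral_eq_zero_of_hasDerivAt_of_integrable hd (hsupp ?_ ?_) (hsupp ?_ ?_)
    · fun_prop
    · intro t ht; simp [h0 t ht]
    · fun_prop
    · intro t ht; simp [h0 t ht]
  rw [← hz]
  refine integral_mono (hsupp ?_ ?_) (hsupp ?_ ?_) fun t => ?_
  · fun_prop
  · intro t ht; simp [h0 t ht]
  · refine Continuous.add (Continuous.div (by fun_prop) (by fun_prop) fun t => (hw t).ne')
      (by fun_prop)
  · intro t ht; simp [h0 t ht, h0' t ht]
  · have h1 := sub_sq_div_ge (X := c' t + β * c t) (c := c t) (s := s * rexp t) (hw t)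
    have h2 : ((c' t + β * c t) * (starRingEnd ℂ) (c t)).re
        = (c' t * (starRingEnd ℂ) (c t)).re + β * ‖c t‖ ^ 2 := by
      rw [Complex.sq_norm, Complex.normSq_apply]
      simp
      ring
    have h3 : rexp (-t) * rexp t = 1 := by rw [← Real.exp_add]; simp
    have h4 : (0 : ℝ) ≤ (|2 * β - 1| - 2 * ν) * (rexp t * ‖c t‖ ^ 2) :=
      mul_nonneg (by linarith) (by positivity)
    rw [← hs1] at h4
    rw [h2] at h1
    have h5 : (1 + ν * rexp (-t)) * (s * rexp t) ^ 2 * ‖c t‖ ^ 2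
        = rexp t ^ 2 * ‖c t‖ ^ 2 + ν * rexp t * ‖c t‖ ^ 2 := by
      linear_combination (1 + ν * rexp (-t)) * rexp t ^ 2 * ‖c t‖ ^ 2 * hs
        + ν * rexp t * ‖c t‖ ^ 2 * h3
    have h6 : (1 - ν * rexp (-t)) * rexp t ^ 2 * ‖c t‖ ^ 2
        = rexp t ^ 2 * ‖c t‖ ^ 2 - ν * rexp t * ‖c t‖ ^ 2 := by
      linear_combination - ν * rexp t * ‖c t‖ ^ 2 * h3
    simp only
    rw [h6]
    rw [h5] at h1
    linarith

open Real in
theorem fourierCoeffOn_neg_pi_pi (hab : -π < π) (u : ℝ → ℂ) (k : ℤ) :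
    fourierCoeffOn hab u k
      = (2 * π : ℂ)⁻¹ * ∫ θ in -π..π, Complex.exp (-(k * θ * Complex.I)) * u θ := by
  rw [fourierCoeffOn_eq_integral, Complex.real_smul]
  have hπ : (π : ℂ) ≠ 0 := by exact_mod_cast pi_ne_zero
  congr 1
  · push_cast
    rw [one_div]
    ring
  · congr 1 with θ
    rw [fourier_coe_apply, smul_eq_mul]
    congr 2
    push_cast
    field_simp
    ring

open Real in
theorem fourierCoeffOn_deriv_of_periodic_s13 (hab : -π < π) {u v : ℝ → ℂ}
    (hu : ∀ θ, HasDerivAt u (v θ) θ) (hv : Continuous v) (hper : u π = u (-π)) (k : ℤ) :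
    fourierCoeffOn hab v k = k * Complex.I * fourierCoeffOn hab u k := by
  rw [fourierCoeffOn_neg_pi_pi, fourierCoeffOn_neg_pi_pi]
  have hd : ∀ θ : ℝ, HasDerivAt (fun θ : ℝ => Complex.exp (-(k * θ * Complex.I)))
      (-(k * Complex.I) * Complex.exp (-(k * θ * Complex.I))) θ := by
    intro θ
    have h : HasDerivAt (fun θ : ℝ => -(k * (θ : ℂ) * Complex.I)) (-(k * 1 * Complex.I)) θ :=
      ((Complex.ofRealCLM.hasDerivAt.const_mul (k : ℂ)).mul_const Complex.I).fun_neg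
    convert h.cexp using 1
    ring
  have he : Complex.exp (-(k * (π : ℝ) * Complex.I))
      = Complex.exp (-(k * ((-π : ℝ) : ℂ) * Complex.I)) := by
    rw [Complex.exp_eq_exp_iff_exists_int]
    exact ⟨-k, by push_cast; ring⟩
  rw [intervalIntegral.integral_mul_deriv_eq_deriv_mul (fun θ _ => hd θ) (fun θ _ => hu θ)
    ((by fun_prop : Continuous _).intervalIntegrable _ _) (hv.intervalIntegrable _ _), he, hper,
    sub_self]
  simp only [mul_assoc, intervalIntegral.integral_const_mul]
  ring

open Real in
theorem hasDerivAt_fourierCoeffOn (hab : -π < π) {f g : ℝ → ℝ → ℂ}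
    (hf : Continuous f.uncurry) (hg : Continuous g.uncurry)
    (hfg : ∀ t θ, HasDerivAt (fun s => f s θ) (g t θ) t) (k : ℤ) (t : ℝ) :
    HasDerivAt (fun s => fourierCoeffOn hab (f s) k) (fourierCoeffOn hab (g t) k) t := by
  simp only [fourierCoeffOn_neg_pi_pi]
  have hF : ∀ {f : ℝ → ℝ → ℂ}, Continuous f.uncurry →
      Continuous fun p : ℝ × ℝ => Complex.exp (-(k * p.2 * Complex.I)) * f p.1 p.2 := by
    intro f hf
    have : Continuous fun p : ℝ × ℝ => f p.1 p.2 := hf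
    fun_prop
  have hF1 : ∀ {f : ℝ → ℝ → ℂ}, Continuous f.uncurry → ∀ s,
      Continuous fun θ : ℝ => Complex.exp (-(k * θ * Complex.I)) * f s θ := fun hf s =>
    (hF hf).comp (Continuous.prodMk continuous_const continuous_id)
  obtain ⟨C, hC⟩ := ((isCompact_Icc (a := t - 1) (b := t + 1)).prod
    (isCompact_Icc (a := -π) (b := π))).exists_bound_of_continuousOn (hF hg).continuousOn
  have key := intervalIntegral.hasDerivAt_integral_of_dominated_loc_of_deriv_le
    (μ := volume) (a := -π) (b := π)
    (F := fun s (θ : ℝ) => Complex.exp (-(k * θ * Complex.I)) * f s θ)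
    (F' := fun s (θ : ℝ) => Complex.exp (-(k * θ * Complex.I)) * g s θ)
    (bound := fun _ => C) (Icc_mem_nhds (by linarith : t - 1 < t) (by linarith : t < t + 1))
    (Filter.Eventually.of_forall fun s => (hF1 hf s).aestronglyMeasurable)
    ((hF1 hf t).intervalIntegrable _ _) (hF1 hg t).aestronglyMeasurable ?_
    intervalIntegrable_const ?_
  · exact key.2.const_mul _
  · refine Filter.Eventually.of_forall fun θ hθ s hs => hC (s, θ) ⟨hs, ?_⟩
    rw [Set.uIoc_of_le hab.le] at hθ
    exact ⟨hθ.1.le, hθ.2⟩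
  · exact Filter.Eventually.of_forall fun θ _ s _ => (hfg s θ).const_mul _

open Real in
theorem continuous_fourierCoeffOn (hab : -π < π) {g : ℝ → ℝ → ℂ}
    (hg : Continuous g.uncurry) (k : ℤ) :
    Continuous fun t => fourierCoeffOn hab (g t) k := by
  simp only [fourierCoeffOn_neg_pi_pi]
  refine continuous_const.mul
    (intervalIntegral.continuous_parametric_intervalIntegral_of_continuous' ?_ _ _)
  have : Continuous fun p : ℝ × ℝ => g p.1 p.2 := hg
  simp only [Function.uncurry_def]
  fun_prop

open Real in
theorem hasSum_sq_fourierCoeffOn_of_continuous (hab : -π < π) {u : ℝ → ℂ} (hu : Continuous u) :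
    HasSum (fun k : ℤ => ‖fourierCoeffOn hab u k‖ ^ 2) ((2 * π)⁻¹ * ∫ θ in -π..π, ‖u θ‖ ^ 2) := by
  have h : MemLp u 2 (volume.restrict (Set.Ioc (-π) π)) := by
    rw [memLp_two_iff_integrable_sq_norm hu.aestronglyMeasurable]
    exact ((by fun_prop : Continuous fun θ => ‖u θ‖ ^ 2).intervalIntegrable _ _).1
  convert hasSum_sq_fourierCoeffOn hab h using 1
  rw [smul_eq_mul]
  ring

open Real in
theorem log_polar_form_nonneg {f g h : ℝ → ℝ → ℂ} {ν a T : ℝ} (hν : 0 < ν) (ha0 : 0 ≤ a)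
    (ha : a ≤ 1 / 2 - ν) (hf : Continuous f.uncurry) (hg : Continuous g.uncurry)
    (hh : Continuous h.uncurry) (hfg : ∀ t θ, HasDerivAt (fun s => f s θ) (g t θ) t)
    (hfh : ∀ t θ, HasDerivAt (f t) (h t θ) θ) (hper : ∀ t, f t π = f t (-π))
    (hf0 : ∀ t, T < |t| → ∀ θ, f t θ = 0) (hg0 : ∀ t, T < |t| → ∀ θ, g t θ = 0)
    (hh0 : ∀ t, T < |t| → ∀ θ, h t θ = 0) :
    0 ≤ ∫ t : ℝ, ∫ θ in -π..π, (‖g t θ + Complex.I * h t θ + a * f t θ‖ ^ 2 / (1 + ν * rexp (-t))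
      + (1 - ν * rexp (-t)) * rexp t ^ 2 * ‖f t θ‖ ^ 2) := by
  have hab : -π < π := by linarith [pi_pos]
  set c : ℤ → ℝ → ℂ := fun k t => fourierCoeffOn hab (f t) k with hc
  set c' : ℤ → ℝ → ℂ := fun k t => fourierCoeffOn hab (g t) k with hc'
  set L : ℝ → ℝ → ℂ := fun t θ => g t θ + Complex.I * h t θ + a * f t θ with hL
  have slice : ∀ {f : ℝ → ℝ → ℂ}, Continuous f.uncurry → ∀ t, Continuous (f t) := fun hf t =>
    hf.comp (Continuous.prodMk continuous_const continuous_id)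
  have hLc : Continuous L.uncurry := by
    have h1 : Continuous fun p : ℝ × ℝ => f p.1 p.2 := hf
    have h2 : Continuous fun p : ℝ × ℝ => g p.1 p.2 := hg
    have h3 : Continuous fun p : ℝ × ℝ => h p.1 p.2 := hh
    simp only [hL, Function.uncurry_def]
    fun_prop
  have hw : ∀ t : ℝ, 0 < 1 + ν * rexp (-t) := fun t => by positivity
  have hLk : ∀ k t, fourierCoeffOn hab (L t) k = c' k t + ((a - k : ℝ) : ℂ) * c k t := by
    intro k t
    have h1 := fourierCoeffOn_deriv_of_periodic_s13 hab (hfh t) (slice hh t) (hper t) k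
    have hi : ∀ {u : ℝ → ℂ}, Continuous u → IntervalIntegrable
        (fun θ : ℝ => Complex.exp (-(k * θ * Complex.I)) * u θ) volume (-π) π := fun hu =>
      (by fun_prop : Continuous _).intervalIntegrable _ _
    have h2 : fourierCoeffOn hab (L t) k = fourierCoeffOn hab (g t) k
        + Complex.I * fourierCoeffOn hab (h t) k + a * fourierCoeffOn hab (f t) k := by
      simp only [fourierCoeffOn_neg_pi_pi]
      have : ∀ θ : ℝ, Complex.exp (-(k * θ * Complex.I)) * L t θ
          = Complex.exp (-(k * θ * Complex.I)) * g t θ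
          + Complex.I * (Complex.exp (-(k * θ * Complex.I)) * h t θ)
          + a * (Complex.exp (-(k * θ * Complex.I)) * f t θ) := fun θ => by
        simp only [hL]; ring
      simp only [this]
      rw [intervalIntegral.integral_add (((hi (slice hg t)).add ((hi (slice hh t)).const_mul _)))
        ((hi (slice hf t)).const_mul _),
        intervalIntegral.integral_add (hi (slice hg t)) ((hi (slice hh t)).const_mul _),
        intervalIntegral.integral_const_mul, intervalIntegral.integral_const_mul]
      ring
    rw [h2, h1]
    push_cast
    linear_combination (k * fourierCoeffOn hab (f t) k) * Complex.I_sq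
  have hcoef0 : ∀ (k : ℤ), fourierCoeffOn hab (fun _ => (0 : ℂ)) k = 0 := by
    intro k; simp [fourierCoeffOn_neg_pi_pi]
  have hck0 : ∀ k t, T < |t| → c k t = 0 := by
    intro k t ht
    simp only [hc, funext (hf0 t ht), hcoef0]
  have hck0' : ∀ k t, T < |t| → c' k t = 0 := by
    intro k t ht
    simp only [hc', funext (hg0 t ht), hcoef0]
  have hcc : ∀ k, Continuous (c k) := fun k => continuous_fourierCoeffOn hab hf k
  have hcc' : ∀ k, Continuous (c' k) := fun k => continuous_fourierCoeffOn hab hg k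
  set N : (ℝ → ℝ → ℂ) → ℝ → ℝ := fun f t => (2 * π)⁻¹ * ∫ θ in -π..π, ‖f t θ‖ ^ 2 with hN
  have hNc : ∀ {f : ℝ → ℝ → ℂ}, Continuous f.uncurry → Continuous (N f) := by
    intro f hf
    refine continuous_const.mul
      (intervalIntegral.continuous_parametric_intervalIntegral_of_continuous' ?_ _ _)
    have : Continuous fun p : ℝ × ℝ => f p.1 p.2 := hf
    simp only [Function.uncurry_def]
    fun_prop
  have hsumL : ∀ t, HasSum (fun k => ‖c' k t + ((a - k : ℝ) : ℂ) * c k t‖ ^ 2) (N L t) := by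
    intro t
    simpa only [hLk] using hasSum_sq_fourierCoeffOn_of_continuous hab (slice hLc t)
  have hsumf : ∀ t, HasSum (fun k => ‖c k t‖ ^ 2) (N f t) := fun t =>
    hasSum_sq_fourierCoeffOn_of_continuous hab (slice hf t)
  have key := hasSum_integral_of_dominated_convergence (μ := (volume : Measure ℝ))
    (F := fun (k : ℤ) t => ‖c' k t + ((a - k : ℝ) : ℂ) * c k t‖ ^ 2 / (1 + ν * rexp (-t))
      + (1 - ν * rexp (-t)) * rexp t ^ 2 * ‖c k t‖ ^ 2)
    (f := fun t => N L t / (1 + ν * rexp (-t)) + (1 - ν * rexp (-t)) * rexp t ^ 2 * N f t)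
    (fun (k : ℤ) t => ‖c' k t + ((a - k : ℝ) : ℂ) * c k t‖ ^ 2 / (1 + ν * rexp (-t))
      + |(1 - ν * rexp (-t)) * rexp t ^ 2| * ‖c k t‖ ^ 2) ?_ ?_ ?_ ?_ ?_
  · have h1 : ∀ t : ℝ, ∫ θ in -π..π, (‖L t θ‖ ^ 2 / (1 + ν * rexp (-t))
        + (1 - ν * rexp (-t)) * rexp t ^ 2 * ‖f t θ‖ ^ 2) = 2 * π *
        (N L t / (1 + ν * rexp (-t)) + (1 - ν * rexp (-t)) * rexp t ^ 2 * N f t) := by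
      intro t
      have i1 := slice hLc t
      have i2 := slice hf t
      rw [intervalIntegral.integral_add, intervalIntegral.integral_div,
        intervalIntegral.integral_const_mul]
      · simp only [hN]
        have := hw t
        field_simp
      · exact (by fun_prop : Continuous fun θ => ‖L t θ‖ ^ 2 / (1 + ν * rexp (-t))).intervalIntegrable _ _
      · exact (by fun_prop : Continuous _).intervalIntegrable _ _
    refine le_of_le_of_eq ?_ (integral_congr_ae (Filter.Eventually.of_forall fun t => (h1 t).symm))
    rw [integral_const_mul]
    refine mul_nonneg (by positivity) (key.nonneg fun k => ?_)
    refine mode_integral_nonneg hν ?_ (fun t => hasDerivAt_fourierCoeffOn hab hf hg hfg k t)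
      (hcc' k) (hck0 k) (hck0' k)
    rcases le_or_gt 0 k with hk | hk
    · have : (0 : ℝ) ≤ k := by exact_mod_cast hk
      rw [abs_of_nonpos (by linarith)]
      linarith
    · have : (k : ℝ) ≤ -1 := by exact_mod_cast Int.le_sub_one_of_lt hk
      rw [abs_of_nonneg (by linarith)]
      linarith
  · intro k
    have := hcc k
    have := hcc' k
    refine Continuous.aestronglyMeasurable ?_
    exact Continuous.add (Continuous.div (by fun_prop) (by fun_prop) fun t => (hw t).ne')
      (by fun_prop)
  · refine fun k => Filter.Eventually.of_forall fun t => (norm_add_le _ _).trans ?_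
    rw [norm_mul, Real.norm_eq_abs, Real.norm_eq_abs, Real.norm_eq_abs, abs_of_nonneg
      (div_nonneg (sq_nonneg _) (hw t).le), abs_of_nonneg (sq_nonneg ‖c k t‖)]
  · exact Filter.Eventually.of_forall fun t =>
      (((hsumL t).div_const _).add ((hsumf t).mul_left _)).summable
  · have h1 : (fun t => ∑' k : ℤ, (‖c' k t + ((a - k : ℝ) : ℂ) * c k t‖ ^ 2 / (1 + ν * rexp (-t))
        + |(1 - ν * rexp (-t)) * rexp t ^ 2| * ‖c k t‖ ^ 2)) = fun t => N L t / (1 + ν * rexp (-t))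
        + |(1 - ν * rexp (-t)) * rexp t ^ 2| * N f t := funext fun t =>
      (((hsumL t).div_const _).add ((hsumf t).mul_left _)).tsum_eq
    rw [h1]
    have := hNc hf
    have := hNc hLc
    refine Continuous.integrable_of_hasCompactSupport (Continuous.add
      (Continuous.div (by fun_prop) (by fun_prop) fun t => (hw t).ne') (by fun_prop))
      (HasCompactSupport.intro (isCompact_Icc (a := -T) (b := T)) fun t ht => ?_)
    rw [Set.mem_Icc, ← abs_le, not_le] at ht
    simp [hN, hL, hf0 t ht, hg0 t ht, hh0 t ht]
  · exact Filter.Eventually.of_forall fun t =>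
      ((hsumL t).div_const _).add ((hsumf t).mul_left _)

section DopStar

variable {φ : ℂ → ℂ}

theorem norm_DopStar_sq_mul_norm_sq (a : ℝ) {x : ℂ} (hx : x ≠ 0) :
    ‖x‖ ^ 2 * ‖DopStar a φ x‖ ^ 2
      = ‖fderiv ℝ φ x x + Complex.I * fderiv ℝ φ x (Complex.I * x) + a * φ x‖ ^ 2 := by
  have hlin : ∀ y : ℂ, fderiv ℝ φ x y = y.re * fderiv ℝ φ x 1 + y.im * fderiv ℝ φ x Complex.I := by
    intro y
    have : y = y.re • (1 : ℂ) + y.im • Complex.I := by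
      apply Complex.ext <;> simp
    conv_lhs => rw [this, map_add, map_smul, map_smul, Complex.real_smul, Complex.real_smul]
  have hn : (starRingEnd ℂ) x * x = (‖x‖ : ℂ) ^ 2 := Complex.conj_mul' x
  have hx' : (‖x‖ : ℂ) ≠ 0 := by exact_mod_cast norm_ne_zero_iff.2 hx
  have h1 : (starRingEnd ℂ) x * DopStar a φ x = -Complex.I *
      (fderiv ℝ φ x x + Complex.I * fderiv ℝ φ x (Complex.I * x) + a * φ x) := by
    have h2 : (starRingEnd ℂ) x * (x / ((‖x‖ : ℂ) ^ 2)) = 1 := by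
      rw [← hn, mul_div_assoc', div_self]
      rw [hn]
      exact pow_ne_zero 2 hx'
    have h3 : (starRingEnd ℂ) x = x.re - x.im * Complex.I := by
      apply Complex.ext <;> simp
    rw [hlin x, hlin (Complex.I * x)]
    unfold DopStar wirtingerZbar
    simp only [Complex.I_mul_re, Complex.I_mul_im]
    rw [mul_sub]
    have h4 : (starRingEnd ℂ) x * (Complex.I * a * (x / ((‖x‖ : ℂ) ^ 2)) * φ x)
        = Complex.I * a * φ x := by
      linear_combination Complex.I * a * φ x * h2
    rw [h4, h3]
    push_cast
    linear_combination (-x.re * fderiv ℝ φ x Complex.I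
      + x.im * fderiv ℝ φ x Complex.I * Complex.I + x.re * fderiv ℝ φ x Complex.I) * Complex.I_sq
  rw [← mul_pow, ← Complex.norm_conj x, ← norm_mul, h1]
  simp

theorem DopStar_eq_zero_of_notMem_tsupport (a : ℝ) {x : ℂ} (hx : x ∉ tsupport φ) :
    DopStar a φ x = 0 := by
  simp [DopStar, wirtingerZbar, fderiv_of_notMem_tsupport ℝ hx, image_eq_zero_of_notMem_tsupport hx]

open Real in
theorem integral_DopStar_form (hφ : ContDiff ℝ (⊤ : ℕ∞) φ) (hc : HasCompactSupport φ)
    (h0 : (0 : ℂ) ∉ tsupport φ) {ν lam : ℝ} (a : ℝ) (hν : 0 < ν) (hlam : 0 < 1 + lam) :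
    ∫ x : ℂ, (‖DopStar a φ x‖ ^ 2 / (1 + lam + ν / ‖x‖) + (1 - lam - ν / ‖x‖) * ‖φ x‖ ^ 2)
      = ∫ t : ℝ, ∫ θ in -π..π,
        (‖fderiv ℝ φ (Complex.exp (t + θ * Complex.I)) (Complex.exp (t + θ * Complex.I))
          + Complex.I * fderiv ℝ φ (Complex.exp (t + θ * Complex.I))
            (Complex.I * Complex.exp (t + θ * Complex.I))
          + a * φ (Complex.exp (t + θ * Complex.I))‖ ^ 2 / (1 + lam + ν * rexp (-t))
        + (1 - lam - ν * rexp (-t)) * rexp t ^ 2 * ‖φ (Complex.exp (t + θ * Complex.I))‖ ^ 2) := by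
  have hz : ∀ x ∉ tsupport φ,
      ‖DopStar a φ x‖ ^ 2 / (1 + lam + ν / ‖x‖) + (1 - lam - ν / ‖x‖) * ‖φ x‖ ^ 2 = 0 := by
    intro x hx
    simp [DopStar_eq_zero_of_notMem_tsupport a hx, image_eq_zero_of_notMem_tsupport hx]
  have hts : tsupport (fun x =>
      ‖DopStar a φ x‖ ^ 2 / (1 + lam + ν / ‖x‖) + (1 - lam - ν / ‖x‖) * ‖φ x‖ ^ 2)
      ⊆ tsupport φ :=
    closure_minimal (fun x hx => by_contra fun h => hx (hz x h)) (isClosed_tsupport φ)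
  rw [Complex.integral_eq_integral_log_polar (continuous_of_tsupport fun x hx => ?_)
    (HasCompactSupport.intro hc hz)]
  · congr 1 with t
    congr 1 with θ
    have hn : ‖Complex.exp (t + θ * Complex.I)‖ = rexp t := by simp [Complex.norm_exp]
    have h1 := norm_DopStar_sq_mul_norm_sq (φ := φ) a (Complex.exp_ne_zero (t + θ * Complex.I))
    rw [← h1, hn, Real.exp_neg]
    have : 0 < 1 + lam + ν / rexp t := by positivity
    field_simp
  · have hx0 : x ≠ 0 := fun h => h0 (h ▸ hts hx)
    have hn : ‖x‖ ≠ 0 := norm_ne_zero_iff.2 hx0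
    have hn' : (‖x‖ : ℂ) ^ 2 ≠ 0 := by exact_mod_cast pow_ne_zero 2 hn
    have hd : (1 + lam + ν / ‖x‖) ≠ 0 := by positivity
    have h1 : Continuous (fderiv ℝ φ) := hφ.continuous_fderiv (by simp)
    have h2 : Continuous φ := hφ.continuous
    have h3 : ContinuousAt (DopStar a φ) x := by
      unfold DopStar wirtingerZbar
      fun_prop (disch := assumption)
    fun_prop (disch := assumption)

theorem hasDerivAt_comp_exp_fst (hφ : Differentiable ℝ φ) (t θ : ℝ) :
    HasDerivAt (fun s : ℝ => φ (Complex.exp (s + θ * Complex.I)))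
      (fderiv ℝ φ (Complex.exp (t + θ * Complex.I)) (Complex.exp (t + θ * Complex.I))) t := by
  have h : HasDerivAt (fun s : ℝ => Complex.exp (s + θ * Complex.I))
      (Complex.exp (t + θ * Complex.I)) t := by
    have h1 : HasDerivAt (fun s : ℝ => (s : ℂ) + θ * Complex.I) 1 t :=
      Complex.ofRealCLM.hasDerivAt.add_const _
    simpa using h1.cexp
  exact (hφ _).hasFDerivAt.comp_hasDerivAt t h

theorem hasDerivAt_comp_exp_snd (hφ : Differentiable ℝ φ) (t θ : ℝ) :
    HasDerivAt (fun s : ℝ => φ (Complex.exp (t + s * Complex.I)))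
      (fderiv ℝ φ (Complex.exp (t + θ * Complex.I))
        (Complex.I * Complex.exp (t + θ * Complex.I))) θ := by
  have h : HasDerivAt (fun s : ℝ => Complex.exp (t + s * Complex.I))
      (Complex.I * Complex.exp (t + θ * Complex.I)) θ := by
    have h1 : HasDerivAt (fun s : ℝ => (t : ℂ) + s * Complex.I) (1 * Complex.I) θ :=
      (Complex.ofRealCLM.hasDerivAt.mul_const _).const_add _
    simpa [mul_comm] using h1.cexp
  exact (hφ _).hasFDerivAt.comp_hasDerivAt θ h

theorem DopStar_form_nonneg (hφ : ContDiff ℝ (⊤ : ℕ∞) φ) (hc : HasCompactSupport φ)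
    (h0 : (0 : ℂ) ∉ tsupport φ) {ν a : ℝ} (hν : 0 < ν) (ha0 : 0 ≤ a) (ha : a ≤ 1 / 2 - ν) :
    0 ≤ ∫ x : ℂ, (‖DopStar a φ x‖ ^ 2 / (1 + 0 + ν / ‖x‖) + (1 - 0 - ν / ‖x‖) * ‖φ x‖ ^ 2) := by
  rw [integral_DopStar_form hφ hc h0 a hν (by norm_num)]
  simp only [add_zero, sub_zero]
  obtain ⟨R, hR⟩ := hc.isCompact.isBounded.subset_closedBall 0
  obtain ⟨r, hr, hr'⟩ := Metric.isOpen_iff.1 (isClosed_tsupport φ).isOpen_compl 0 h0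
  have hout : ∀ t, |Real.log R| + |Real.log r| < |t| → ∀ θ : ℝ,
      Complex.exp (t + θ * Complex.I) ∉ tsupport φ := by
    intro t ht θ hmem
    have hn : ‖Complex.exp (t + θ * Complex.I)‖ = Real.exp t := by simp [Complex.norm_exp]
    have h1 : Real.exp t ≤ R := by simpa [hn] using hR hmem
    have h2 : r ≤ Real.exp t := by
      by_contra! h
      exact hr' (by simpa [hn] using h : Complex.exp (t + θ * Complex.I) ∈ Metric.ball 0 r) hmem
    have h3 : t ≤ Real.log R := (Real.le_log_iff_exp_le ((Real.exp_pos t).trans_le h1)).2 h1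
    have h4 : Real.log r ≤ t := (Real.log_le_iff_le_exp hr).2 h2
    have h5 := le_abs_self (Real.log R)
    have h6 := neg_abs_le (Real.log r)
    have h7 := abs_nonneg (Real.log R)
    have h8 := abs_nonneg (Real.log r)
    exact absurd ht (not_lt.2 (abs_le.2 ⟨by linarith, by linarith⟩))
  have hd : Differentiable ℝ φ := hφ.differentiable (by simp)
  have hdc : Continuous (fderiv ℝ φ) := hφ.continuous_fderiv (by simp)
  have hcont : Continuous φ := hφ.continuous
  refine log_polar_form_nonneg hν ha0 ha
    (f := fun t θ => φ (Complex.exp (t + θ * Complex.I)))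
    (g := fun t θ => fderiv ℝ φ (Complex.exp (t + θ * Complex.I))
      (Complex.exp (t + θ * Complex.I)))
    (h := fun t θ => fderiv ℝ φ (Complex.exp (t + θ * Complex.I))
      (Complex.I * Complex.exp (t + θ * Complex.I)))
    (by simp only [Function.uncurry_def]; fun_prop) (by simp only [Function.uncurry_def]; fun_prop)
    (by simp only [Function.uncurry_def]; fun_prop) (hasDerivAt_comp_exp_fst hd)
    (hasDerivAt_comp_exp_snd hd) (fun t => ?_) (T := |Real.log R| + |Real.log r|)
    (fun t ht θ => image_eq_zero_of_notMem_tsupport (hout t ht θ))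
    (fun t ht θ => ?_) (fun t ht θ => ?_)
  · simp [Complex.exp_add, Complex.exp_neg]
  · simp [fderiv_of_notMem_tsupport ℝ (hout t ht θ)]
  · simp [fderiv_of_notMem_tsupport ℝ (hout t ht θ)]

end DopStar

section RadialTest

open Real

variable {h : ℝ → ℝ} {A B : ℝ}

theorem radial_tsupport_subset (hB : B < 0) (hh : ∀ t, h t ≠ 0 → t ∈ Set.Icc A B) :
    tsupport (fun x : ℂ => ((rexp (-(Real.log ‖x‖) / 2) * h (Real.log ‖x‖) : ℝ) : ℂ))
      ⊆ {x | rexp A ≤ ‖x‖ ∧ ‖x‖ ≤ rexp B} := by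
  refine closure_minimal (fun x hx => ?_) ((isClosed_le continuous_const continuous_norm).inter
    (isClosed_le continuous_norm continuous_const))
  have h1 : h (Real.log ‖x‖) ≠ 0 := by
    intro h0
    exact hx (by simp [h0])
  obtain ⟨h2, h3⟩ := hh _ h1
  have hx0 : 0 < ‖x‖ := by
    refine norm_pos_iff.2 fun h0 => ?_
    rw [h0, norm_zero, Real.log_zero] at h3
    linarith
  exact ⟨(Real.le_log_iff_exp_le hx0).1 h2, (Real.log_le_iff_le_exp hx0).1 h3⟩

theorem radial_contDiff (hB : B < 0) (hh : ∀ t, h t ≠ 0 → t ∈ Set.Icc A B)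
    (hs : ContDiff ℝ (⊤ : ℕ∞) h) :
    ContDiff ℝ (⊤ : ℕ∞)
      (fun x : ℂ => ((rexp (-(Real.log ‖x‖) / 2) * h (Real.log ‖x‖) : ℝ) : ℂ)) := by
  rw [contDiff_iff_contDiffAt]
  intro x
  by_cases hx : x ∈ tsupport
    (fun x : ℂ => ((rexp (-(Real.log ‖x‖) / 2) * h (Real.log ‖x‖) : ℝ) : ℂ))
  · have hx0 : x ≠ 0 := by
      rintro rfl
      have := (radial_tsupport_subset hB hh hx).1
      rw [norm_zero] at this
      exact absurd this (not_le.2 (exp_pos A))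
    have hn : ContDiffAt ℝ (⊤ : ℕ∞) (fun x : ℂ => Real.log ‖x‖) x :=
      (contDiffAt_norm ℝ hx0).log (norm_ne_zero_iff.2 hx0)
    exact Complex.ofRealCLM.contDiff.contDiffAt.comp x
      ((hn.neg.div_const 2).exp.mul (hs.contDiffAt.comp x hn))
  · rw [notMem_tsupport_iff_eventuallyEq] at hx
    exact contDiffAt_const.congr_of_eventuallyEq hx

theorem integral_DopStar_form_radial (hB : B < 0) (hh : ∀ t, h t ≠ 0 → t ∈ Set.Icc A B)
    (hs : ContDiff ℝ (⊤ : ℕ∞) h) {h' : ℝ → ℝ} (hd : ∀ t, HasDerivAt h (h' t) t)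
    {ν lam : ℝ} (a : ℝ) (hν : 0 < ν) (hlam : 0 < 1 + lam) {φ : ℂ → ℂ}
    (hφ : φ = fun x : ℂ => ((rexp (-(Real.log ‖x‖) / 2) * h (Real.log ‖x‖) : ℝ) : ℂ)) :
    ContDiff ℝ (⊤ : ℕ∞) φ ∧ HasCompactSupport φ ∧ (0 : ℂ) ∉ tsupport φ ∧
    ∫ x : ℂ, (‖DopStar a φ x‖ ^ 2 / (1 + lam + ν / ‖x‖) + (1 - lam - ν / ‖x‖) * ‖φ x‖ ^ 2)
      = 2 * π * ∫ t : ℝ, (rexp (-t) * (h' t + (a - 1 / 2) * h t) ^ 2 / (1 + lam + ν * rexp (-t))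
        + (1 - lam - ν * rexp (-t)) * rexp t * h t ^ 2) := by
  have hsm : ContDiff ℝ (⊤ : ℕ∞) φ := hφ ▸ radial_contDiff hB hh hs
  have hsub : tsupport φ ⊆ {x | rexp A ≤ ‖x‖ ∧ ‖x‖ ≤ rexp B} :=
    hφ ▸ radial_tsupport_subset hB hh
  have hc : HasCompactSupport φ :=
    (isCompact_closedBall (0 : ℂ) (rexp B)).of_isClosed_subset (isClosed_tsupport φ)
      fun x hx => mem_closedBall_zero_iff.2 (hsub hx).2
  have h0 : (0 : ℂ) ∉ tsupport φ := by
    intro hx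
    have := (hsub hx).1
    rw [norm_zero] at this
    exact absurd this (not_le.2 (exp_pos A))
  refine ⟨hsm, hc, h0, ?_⟩
  have hdiff : Differentiable ℝ φ := hsm.differentiable (by simp)
  have hval : ∀ t θ : ℝ, φ (Complex.exp (t + θ * Complex.I)) = ((rexp (-t / 2) * h t : ℝ) : ℂ) := by
    intro t θ
    simp [hφ, Complex.norm_exp]
  have h1 : ∀ t θ : ℝ, fderiv ℝ φ (Complex.exp (t + θ * Complex.I))
      (Complex.exp (t + θ * Complex.I)) = ((rexp (-t / 2) * (h' t - h t / 2) : ℝ) : ℂ) := by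
    intro t θ
    refine (hasDerivAt_comp_exp_fst hdiff t θ).unique ?_
    simp only [hval]
    have h3 : HasDerivAt (fun t : ℝ => rexp (-t / 2)) (rexp (-t / 2) * (-1 / 2)) t :=
      ((hasDerivAt_id t).fun_neg.div_const 2).exp
    have h4 := (h3.fun_mul (hd t)).ofReal_comp
    rwa [show rexp (-t / 2) * (-1 / 2) * h t + rexp (-t / 2) * h' t
      = rexp (-t / 2) * (h' t - h t / 2) by ring] at h4
  have h2 : ∀ t θ : ℝ, fderiv ℝ φ (Complex.exp (t + θ * Complex.I))
      (Complex.I * Complex.exp (t + θ * Complex.I)) = 0 := by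
    intro t θ
    refine (hasDerivAt_comp_exp_snd hdiff t θ).unique ?_
    simp only [hval]
    exact hasDerivAt_const _ _
  rw [integral_DopStar_form hsm hc h0 a hν hlam, ← integral_const_mul]
  congr 1 with t
  have h4 : ((rexp (-t / 2) * (h' t - h t / 2) : ℝ) : ℂ) + Complex.I * 0
      + a * ((rexp (-t / 2) * h t : ℝ) : ℂ)
      = ((rexp (-t / 2) * (h' t + (a - 1 / 2) * h t) : ℝ) : ℂ) := by
    push_cast
    ring
  have h5 : rexp (-t / 2) ^ 2 = rexp (-t) := by
    rw [← Real.exp_nat_mul]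
    congr 1
    push_cast
    ring
  have h6 : rexp t * rexp (-t) = 1 := by rw [← Real.exp_add]; simp
  simp only [h1, h2, hval, h4, Complex.norm_real, Real.norm_eq_abs, sq_abs, mul_pow, h5,
    intervalIntegral.integral_const, smul_eq_mul]
  linear_combination 2 * π * (1 - lam - ν * rexp (-t)) * rexp t * h t ^ 2 * h6

end RadialTest

open Real in
theorem radial_integrand_le {ν a lam δ u v t : ℝ} (hν0 : 0 < ν) (hν1 : ν < 1 / 2)
    (hl0 : -1 < lam) (hδ : δ = ν ^ 2 - (a - 1 / 2) ^ 2) (ht : u ≠ 0 → rexp t ≤ δ / 4) :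
    rexp (-t) * (v + (a - 1 / 2) * u) ^ 2 / (1 + lam + ν * rexp (-t))
        + (1 - lam - ν * rexp (-t)) * rexp t * u ^ 2
      ≤ ν⁻¹ * (v ^ 2 + 2 * (a - 1 / 2) * (v * u) - 3 / 4 * δ * u ^ 2) := by
  have hw : 0 < 1 + lam + ν * rexp (-t) := by
    have := mul_pos hν0 (exp_pos (-t))
    linarith
  have hE : rexp (-t) * rexp t = 1 := by rw [← Real.exp_add]; simp
  have h5 : rexp (-t) * (v + (a - 1 / 2) * u) ^ 2 / (1 + lam + ν * rexp (-t))
      ≤ ν⁻¹ * (v + (a - 1 / 2) * u) ^ 2 := by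
    rw [div_le_iff₀ hw]
    have h6 : ν⁻¹ * (v + (a - 1 / 2) * u) ^ 2 * (1 + lam + ν * rexp (-t))
        = ν⁻¹ * (1 + lam) * (v + (a - 1 / 2) * u) ^ 2
          + rexp (-t) * (v + (a - 1 / 2) * u) ^ 2 := by
      field_simp
    have h7 : 0 ≤ ν⁻¹ * (1 + lam) * (v + (a - 1 / 2) * u) ^ 2 :=
      mul_nonneg (mul_nonneg (by positivity) (by linarith)) (sq_nonneg _)
    linarith
  have h6 : ν * (1 - lam) * rexp t * u ^ 2 ≤ δ / 4 * u ^ 2 := by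
    by_cases hu0 : u = 0
    · simp [hu0]
    · have h7 : rexp t ≤ δ / 4 := ht hu0
      have h8 : ν * (1 - lam) ≤ 1 := by nlinarith
      have h9 : ν * (1 - lam) * rexp t ≤ 1 * rexp t :=
        mul_le_mul_of_nonneg_right h8 (exp_pos t).le
      exact mul_le_mul_of_nonneg_right (by linarith) (sq_nonneg u)
  have h7 : (1 - lam - ν * rexp (-t)) * rexp t * u ^ 2
      = ν⁻¹ * (ν * (1 - lam) * rexp t * u ^ 2 - ν ^ 2 * u ^ 2) := by
    field_simp
    linear_combination -ν * u ^ 2 * hE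
  have h8 : ν⁻¹ * (ν * (1 - lam) * rexp t * u ^ 2 - ν ^ 2 * u ^ 2)
      ≤ ν⁻¹ * (δ / 4 * u ^ 2 - ν ^ 2 * u ^ 2) :=
    mul_le_mul_of_nonneg_left (by linarith) (by positivity)
  rw [h7]
  refine (add_le_add h5 h8).trans_eq ?_
  rw [hδ]
  ring

theorem exists_integral_quadratic_form_neg {c : ℝ} (hc : 0 < c) (k B : ℝ) :
    ∃ (A : ℝ) (h h' : ℝ → ℝ), ContDiff ℝ (⊤ : ℕ∞) h ∧ Continuous h' ∧
      (∀ t, HasDerivAt h (h' t) t) ∧ (∀ t, h t ≠ 0 → t ∈ Set.Icc A B) ∧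
      (∀ t, h' t ≠ 0 → t ∈ Set.Icc A B) ∧
      ∫ t, (h' t ^ 2 + 2 * k * (h' t * h t) - c * h t ^ 2) < 0 := by
  obtain ⟨χ, hχs, hcomp, hχ0, hχ2⟩ : ∃ χ : ℝ → ℝ, ContDiff ℝ (⊤ : ℕ∞) χ ∧ HasCompactSupport χ ∧
      χ 0 ≠ 0 ∧ ∀ s, χ s ≠ 0 → s ∈ Metric.ball (0 : ℝ) 2 := by
    obtain ⟨χ, h1⟩ : ∃ χ : ContDiffBump (0 : ℝ), χ.rOut = 2 :=
      ⟨⟨1, 2, one_pos, one_lt_two⟩, rfl⟩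
    refine ⟨χ, χ.contDiff, χ.hasCompactSupport,
      (χ.pos_of_mem_ball (Metric.mem_ball_self χ.rOut_pos)).ne', fun s hs => ?_⟩
    rw [← h1, ← χ.support_eq]
    exact hs
  have hχc : Continuous χ := hχs.continuous
  have hχd : ∀ s, HasDerivAt χ (deriv χ s) s := fun s =>
    (hχs.differentiable (by simp) s).hasDerivAt
  have hχ'c : Continuous (deriv χ) := hχs.continuous_deriv (by simp)
  have hcomp' : HasCompactSupport (deriv χ) := hcomp.deriv
  have hsq0 : HasCompactSupport fun s => χ s ^ 2 :=
    hcomp.comp_left (g := fun y => y ^ 2) (by simp)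
  have hsq1 : HasCompactSupport fun s => deriv χ s ^ 2 :=
    hcomp'.comp_left (g := fun y => y ^ 2) (by simp)
  have hmul : HasCompactSupport fun s => deriv χ s * χ s := hcomp.mul_left
  have hi0 : Integrable fun s => χ s ^ 2 :=
    Continuous.integrable_of_hasCompactSupport (by fun_prop) hsq0
  have hi1 : Integrable fun s => deriv χ s ^ 2 :=
    Continuous.integrable_of_hasCompactSupport (by fun_prop) hsq1
  have hi2 : Integrable fun s => deriv χ s * χ s :=
    Continuous.integrable_of_hasCompactSupport (by fun_prop) hmul
  have hI2 : ∫ s, deriv χ s * χ s = 0 := by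
    have h1 : ∫ s, (2 * (deriv χ s * χ s)) = 0 :=
      integral_eq_zero_of_hasDerivAt_of_integrable
        (fun s => by simpa [mul_comm, mul_left_comm, mul_assoc] using (hχd s).fun_pow 2) (hi2.const_mul 2) hi0
    rw [integral_const_mul] at h1
    linarith
  have hI0 : 0 < ∫ s, χ s ^ 2 :=
    Continuous.integral_pos_of_hasCompactSupport_nonneg_nonzero (f := fun s => χ s ^ 2) (x := 0)
      (by fun_prop) hsq0 (fun s => sq_nonneg _) (pow_ne_zero 2 hχ0)
  obtain ⟨ε, hε, hlt⟩ : ∃ ε : ℝ, 0 < ε ∧ ε ^ 2 * ∫ s, deriv χ s ^ 2 < c * ∫ s, χ s ^ 2 := by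
    obtain ⟨d, hd0, hd⟩ := exists_pos_mul_lt (mul_pos hc hI0) (∫ s, deriv χ s ^ 2)
    refine ⟨√d, Real.sqrt_pos.2 hd0, ?_⟩
    rwa [Real.sq_sqrt hd0.le, mul_comm]
  have hd : ∀ t, HasDerivAt (fun t => χ (ε * t + (2 - ε * B)))
      (ε * deriv χ (ε * t + (2 - ε * B))) t := by
    intro t
    have h1 : HasDerivAt (fun t : ℝ => ε * t + (2 - ε * B)) ε t := by
      simpa using ((hasDerivAt_id t).const_mul ε).add_const (2 - ε * B)
    have h2 := (hχd _).comp t h1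
    rwa [mul_comm (deriv χ _)] at h2
  have hsupp : ∀ t, χ (ε * t + (2 - ε * B)) ≠ 0 → t ∈ Set.Icc (B - 4 / ε) B := by
    intro t ht
    have h1 := hχ2 _ ht
    rw [mem_ball_zero_iff, Real.norm_eq_abs, abs_lt] at h1
    constructor
    · rw [sub_le_iff_le_add, ← sub_le_iff_le_add', le_div_iff₀ hε]
      nlinarith
    · nlinarith
  refine ⟨B - 4 / ε, fun t => χ (ε * t + (2 - ε * B)), fun t => ε * deriv χ (ε * t + (2 - ε * B)),
    hχs.comp (by fun_prop), by fun_prop, hd, hsupp, fun t ht => ?_, ?_⟩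
  · by_contra hout
    have h5 : (fun t => χ (ε * t + (2 - ε * B))) =ᶠ[nhds t] fun _ => 0 := by
      filter_upwards [isClosed_Icc.isOpen_compl.mem_nhds hout] with s hs
      exact by_contra fun h => hs (hsupp s h)
    exact ht ((hd t).unique ((hasDerivAt_const t (0 : ℝ)).congr_of_eventuallyEq h5))
  · have h1 : ∫ t, ((ε * deriv χ (ε * t + (2 - ε * B))) ^ 2
        + 2 * k * (ε * deriv χ (ε * t + (2 - ε * B)) * χ (ε * t + (2 - ε * B)))
        - c * χ (ε * t + (2 - ε * B)) ^ 2)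
        = ε⁻¹ * ∫ s, (ε ^ 2 * deriv χ s ^ 2 + 2 * k * ε * (deriv χ s * χ s) - c * χ s ^ 2) := by
      rw [Measure.integral_comp_mul_left (fun s => (ε * deriv χ (s + (2 - ε * B))) ^ 2
          + 2 * k * (ε * deriv χ (s + (2 - ε * B)) * χ (s + (2 - ε * B)))
          - c * χ (s + (2 - ε * B)) ^ 2) ε,
        integral_add_right_eq_self (fun s => (ε * deriv χ s) ^ 2
          + 2 * k * (ε * deriv χ s * χ s) - c * χ s ^ 2),
        abs_of_pos (by positivity), smul_eq_mul]
      congr 2 with s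
      ring
    have h2 : Integrable fun s => ε ^ 2 * deriv χ s ^ 2 + 2 * k * ε * (deriv χ s * χ s) :=
      (hi1.const_mul _).add (hi2.const_mul _)
    rw [h1, integral_sub h2 (hi0.const_mul _),
      integral_add (hi1.const_mul _) (hi2.const_mul _), integral_const_mul,
      integral_const_mul, integral_const_mul, hI2]
    refine mul_neg_of_pos_of_neg (by positivity) ?_
    linarith

open Real in
theorem exists_DopStar_form_neg {ν a lam : ℝ} (hν : ν ∈ Set.Ioo (0 : ℝ) (1 / 2))
    (ha : (a - 1 / 2) ^ 2 < ν ^ 2) (hlam : -1 < lam) :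
    ∃ φ : ℂ → ℂ, ContDiff ℝ (⊤ : ℕ∞) φ ∧ HasCompactSupport φ ∧ (0 : ℂ) ∉ tsupport φ ∧
      ∫ x : ℂ, (‖DopStar a φ x‖ ^ 2 / (1 + lam + ν / ‖x‖)
        + (1 - lam - ν / ‖x‖) * ‖φ x‖ ^ 2) < 0 := by
  obtain ⟨hν0, hν1⟩ := hν
  obtain ⟨δ, hδ⟩ : ∃ δ, δ = ν ^ 2 - (a - 1 / 2) ^ 2 := ⟨_, rfl⟩
  have hδ0 : 0 < δ := by linarith
  have hδ1 : δ < 1 / 4 := by nlinarith [sq_nonneg (a - 1 / 2)]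
  obtain ⟨B, hBexp⟩ : ∃ B, rexp B = δ / 4 := ⟨_, Real.exp_log (by positivity)⟩
  have hB0 : B < 0 := exp_lt_one_iff.1 (by linarith)
  obtain ⟨A, h, h', hs, hc', hd, hsupp, hsupp', hneg⟩ :=
    exists_integral_quadratic_form_neg (show 0 < 3 / 4 * δ by positivity) (a - 1 / 2) B
  obtain ⟨h1, h2, h3, h4⟩ := integral_DopStar_form_radial hB0 hsupp hs hd a hν0
    (by linarith : 0 < 1 + lam) rfl
  refine ⟨_, h1, h2, h3, ?_⟩
  rw [h4]
  refine mul_neg_of_pos_of_neg (by positivity) ?_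
  have hc : Continuous h := hs.continuous
  have hw : ∀ t, 0 < 1 + lam + ν * rexp (-t) := fun t => by
    have := mul_pos hν0 (exp_pos (-t))
    linarith
  have hout : ∀ t ∉ Set.Icc A B, h t = 0 := fun t ht => by_contra fun h0 => ht (hsupp t h0)
  have hout' : ∀ t ∉ Set.Icc A B, h' t = 0 := fun t ht => by_contra fun h0 => ht (hsupp' t h0)
  have hi1 : Integrable fun t => rexp (-t) * (h' t + (a - 1 / 2) * h t) ^ 2
      / (1 + lam + ν * rexp (-t)) + (1 - lam - ν * rexp (-t)) * rexp t * h t ^ 2 := by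
    refine Continuous.integrable_of_hasCompactSupport (Continuous.add
      (Continuous.div (by fun_prop) (by fun_prop) fun t => (hw t).ne') (by fun_prop))
      (HasCompactSupport.intro (isCompact_Icc (a := A) (b := B)) fun t ht => ?_)
    simp [hout t ht, hout' t ht]
  have hi2 : Integrable fun t =>
      ν⁻¹ * (h' t ^ 2 + 2 * (a - 1 / 2) * (h' t * h t) - 3 / 4 * δ * h t ^ 2) := by
    refine Continuous.integrable_of_hasCompactSupport (by fun_prop)
      (HasCompactSupport.intro (isCompact_Icc (a := A) (b := B)) fun t ht => ?_)
    simp [hout t ht, hout' t ht]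
  refine (integral_mono hi1 hi2 fun t => radial_integrand_le hν0 hν1 hlam hδ
    fun hu => hBexp ▸ exp_le_exp.2 (hsupp t hu).2).trans_lt ?_
  rw [integral_const_mul]
  exact mul_neg_of_pos_of_neg (by positivity) hneg

theorem stmt13 (ν a : ℝ) (hν : ν ∈ Set.Ioo (0 : ℝ) (1/2)) (ha : a ∈ Set.Ico (0 : ℝ) (1/2)) :
    (∃ lam ∈ Set.Ioo (-1 : ℝ) 1, ∀ φ : ℂ → ℂ,
      ContDiff ℝ (⊤ : ℕ∞) φ → HasCompactSupport φ → (0 : ℂ) ∉ tsupport φ →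
      ∫ x : ℂ, (‖DopStar a φ x‖^2 / (1 + lam + ν/‖x‖)
          + (1 - lam - ν/‖x‖) * ‖φ x‖^2) ≥ 0) ↔
    a ≤ 1/2 - ν := by
  refine ⟨fun ⟨lam, hlam, H⟩ => ?_, fun h => ⟨0, by norm_num, fun φ h1 h2 h3 =>
    DopStar_form_nonneg h1 h2 h3 hν.1 ha.1 h⟩⟩
  by_contra! hlt
  obtain ⟨φ, h1, h2, h3, h4⟩ := exists_DopStar_form_neg (a := a) hν
    (by nlinarith [ha.2, hν.1]) hlam.1
  exact absurd (H φ h1 h2 h3) (not_le.2 h4)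
end

section
/- Let ν ∈ (0,1/2), a ∈ (0, 1/2 − ν), c(a) = 1/2 − a, λ_{ν,a} = √(c(a)² − ν²)/c(a), and define φ_⋆(x) = |x|^{√(c(a)²−ν²) − 1/2} e^{−(ν/c(a))|x|} for x ≠ 0. Then the integrals ∫_{ℝ²} |D_a^* φ_⋆(x)|²/(1 + λ_{ν,a} + ν/|x|) dx and ∫_{ℝ²} (1 + ν/|x|) |φ_⋆(x)|² dx are finite, and ∫_{ℝ²} ( |D_a^* φ_⋆(x)|² / (1 + λ_{ν,a} + ν/|x|) + (1 − λ_{ν,a} − ν/|x|) |φ_⋆(x)|² ) dx = 0; i.e., φ_⋆ realizes the equality case of the magnetic Dirac-Coulomb Hardy inequality. -/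
open MeasureTheory

theorem hasFDerivAt_norm_of_ne_zero {E : Type*} [NormedAddCommGroup E] [InnerProductSpace ℝ E]
    {x : E} (hx : x ≠ 0) :
    HasFDerivAt (fun y : E => ‖y‖) (‖x‖⁻¹ • innerSL ℝ x) x := by
  have hn : ‖x‖ ≠ 0 := norm_ne_zero_iff.mpr hx
  have h := (hasStrictFDerivAt_norm_sq x).hasFDerivAt.sqrt (pow_ne_zero 2 hn)
  simp only [Real.sqrt_sq (norm_nonneg _)] at h
  convert! h using 1
  ext v
  simp
  field_simp

theorem wirtingerZbar_of_radial {η : ℂ → ℂ} {g : ℝ → ℝ} {g' : ℝ} {x : ℂ} (hx : x ≠ 0)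
    (hη : ∀ y : ℂ, y ≠ 0 → η y = (g ‖y‖ : ℂ)) (hg : HasDerivAt g g' ‖x‖) :
    wirtingerZbar η x = x / (2 * ‖x‖) * g' := by
  have hn : (‖x‖ : ℂ) ≠ 0 := by simpa using hx
  have h : HasFDerivAt (fun y : ℂ => (g ‖y‖ : ℂ))
      (Complex.ofRealCLM.comp (g' • (‖x‖⁻¹ • innerSL ℝ x))) x :=
    Complex.ofRealCLM.hasFDerivAt.comp x (hg.comp_hasFDerivAt x (hasFDerivAt_norm_of_ne_zero hx))
  have heq : η =ᶠ[nhds x] fun y : ℂ => (g ‖y‖ : ℂ) := by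
    filter_upwards [isOpen_ne.mem_nhds hx] with y hy using hη y hy
  rw [wirtingerZbar, (h.congr_of_eventuallyEq heq).fderiv]
  simp [Complex.inner]
  field_simp
  nth_rewrite 3 [← Complex.re_add_im x]
  ring

theorem norm_sq_DopStar_of_radial (a : ℝ) {η : ℂ → ℂ} {g : ℝ → ℝ} {g' : ℝ} {x : ℂ} (hx : x ≠ 0)
    (hη : ∀ y : ℂ, y ≠ 0 → η y = (g ‖y‖ : ℂ)) (hg : HasDerivAt g g' ‖x‖) :
    ‖DopStar a η x‖ ^ 2 = (g' + a / ‖x‖ * g ‖x‖) ^ 2 := by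
  have hn : (‖x‖ : ℂ) ≠ 0 := by simpa using hx
  have hn' : ‖x‖ ≠ 0 := by simpa using hx
  have : DopStar a η x = -Complex.I * (x / ‖x‖) * ((g' + a / ‖x‖ * g ‖x‖ : ℝ) : ℂ) := by
    rw [DopStar, wirtingerZbar_of_radial hx hη hg, hη x hx]
    push_cast
    field_simp
    ring
  rw [this]
  rw [norm_mul, norm_mul, norm_neg, Complex.norm_I, norm_div, Complex.norm_real, Complex.norm_real,
    norm_norm, div_self hn', one_mul, one_mul, Real.norm_eq_abs, sq_abs]

theorem smul_rpow_mul_exp_eqOn (s b : ℝ) :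
    Set.EqOn (fun y : ℝ => y ^ (Module.finrank ℝ ℂ - 1) • (y ^ s * Real.exp (-b * y)))
      (fun y => y ^ (s + 2 - 1) * Real.exp (-(b * y))) (Set.Ioi 0) := by
  intro y hy
  simp only [Complex.finrank_real_complex, smul_eq_mul]
  rw [show s + 2 - 1 = s + 1 by ring, Real.rpow_add_one (ne_of_gt hy), neg_mul]
  ring

theorem integrable_norm_rpow_mul_exp {s b : ℝ} (hs : -2 < s) (hb : 0 < b) :
    Integrable (fun x : ℂ => ‖x‖ ^ s * Real.exp (-b * ‖x‖)) := by
  rw [integrable_fun_norm_addHaar volume (f := fun y : ℝ => y ^ s * Real.exp (-b * y)),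
    integrableOn_congr_fun (smul_rpow_mul_exp_eqOn s b) measurableSet_Ioi]
  simpa using integrableOn_rpow_mul_exp_neg_mul_rpow
    (show -1 < s + 2 - 1 by linarith) one_pos hb

theorem integral_norm_rpow_mul_exp {s b : ℝ} (hs : -2 < s) (hb : 0 < b) :
    ∫ x : ℂ, ‖x‖ ^ s * Real.exp (-b * ‖x‖) =
      2 * volume.real (Metric.ball (0 : ℂ) 1) * ((1 / b) ^ (s + 2) * Real.Gamma (s + 2)) := by
  rw [integral_fun_norm_addHaar volume (fun y : ℝ => y ^ s * Real.exp (-b * y)),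
    setIntegral_congr_fun measurableSet_Ioi (smul_rpow_mul_exp_eqOn s b),
    Real.integral_rpow_mul_exp_neg_mul_Ioi (by linarith) hb]
  simp [mul_assoc]

theorem integral_norm_rpow_add_one_mul_exp {s b : ℝ} (hs : -2 < s) (hb : 0 < b) :
    ∫ x : ℂ, ‖x‖ ^ (s + 1) * Real.exp (-b * ‖x‖) =
      (s + 2) / b * ∫ x : ℂ, ‖x‖ ^ s * Real.exp (-b * ‖x‖) := by
  rw [integral_norm_rpow_mul_exp hs hb, integral_norm_rpow_mul_exp (by linarith) hb,
    show s + 1 + 2 = s + 2 + 1 by ring, Real.Gamma_add_one (by linarith),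
    Real.rpow_add_one (by positivity)]
  ring

theorem hasDerivAt_rpow_mul_exp (s b : ℝ) {r : ℝ} (hr : 0 < r) :
    HasDerivAt (fun r : ℝ => r ^ s * Real.exp (-b * r))
      ((s / r - b) * (r ^ s * Real.exp (-b * r))) r := by
  have h1 := Real.hasDerivAt_rpow_const (p := s) (Or.inl hr.ne')
  have h2 := ((hasDerivAt_id r).const_mul (-b)).exp
  convert! h1.mul h2 using 1
  rw [Real.rpow_sub_one hr.ne']
  simp
  ring

theorem stmt14 (ν a : ℝ) (hν : ν ∈ Set.Ioo (0 : ℝ) (1/2)) (ha : a ∈ Set.Ioo (0 : ℝ) (1/2 - ν))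
    (c δ lam : ℝ) (hc : c = 1/2 - a) (hδ : δ = Real.sqrt (c^2 - ν^2)) (hlam : lam = δ / c)
    (φ : ℂ → ℂ)
    (hφ : ∀ x : ℂ, x ≠ 0 →
      φ x = ((‖x‖ ^ (δ - 1/2) * Real.exp (-(ν/c) * ‖x‖) : ℝ) : ℂ)) :
    Integrable (fun x : ℂ => ‖DopStar a φ x‖^2 / (1 + lam + ν/‖x‖)) ∧
    Integrable (fun x : ℂ => (1 + ν/‖x‖) * ‖φ x‖^2) ∧
    ∫ x : ℂ, (‖DopStar a φ x‖^2 / (1 + lam + ν/‖x‖)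
        + (1 - lam - ν/‖x‖) * ‖φ x‖^2) = 0 := by
  obtain ⟨hν0, -⟩ := hν
  have hνc : ν < c := by linarith [ha.2]
  have hc0 : 0 < c := hν0.trans hνc
  have hδ2 : δ ^ 2 = c ^ 2 - ν ^ 2 := by
    rw [hδ, Real.sq_sqrt]
    nlinarith
  have hδ0 : 0 < δ := by
    rw [hδ]
    apply Real.sqrt_pos.mpr
    nlinarith
  have hcδ : 0 < c + δ := by linarith
  have hb : 0 < 2 * ν / c := by positivity
  set A : ℂ → ℝ := fun x => ‖x‖ ^ (2 * δ - 2) * Real.exp (-(2 * ν / c) * ‖x‖) with hA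
  set B : ℂ → ℝ := fun x => ‖x‖ ^ (2 * δ - 2 + 1) * Real.exp (-(2 * ν / c) * ‖x‖) with hB
  have hAint : Integrable A := integrable_norm_rpow_mul_exp (by linarith) hb
  have hBint : Integrable B := integrable_norm_rpow_mul_exp (by linarith) hb
  have hBA : ∫ x, B x = δ * c / ν * ∫ x, A x := by
    rw [hA, hB, integral_norm_rpow_add_one_mul_exp (by linarith) hb]
    congr 1
    field_simp
    ring
  have hne : ∀ᵐ x : ℂ, x ≠ 0 := by simp [ae_iff]
  have hsq : ∀ x : ℂ, x ≠ 0 →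
      (‖x‖ ^ (δ - 1/2) * Real.exp (-(ν/c) * ‖x‖)) ^ 2 = B x := by
    intro x hx
    rw [mul_pow, ← Real.rpow_mul_natCast (norm_nonneg x), ← Real.exp_nat_mul, hB]
    congr 2 <;> (push_cast; ring)
  have hBx : ∀ x : ℂ, x ≠ 0 → B x = ‖x‖ * A x := by
    intro x hx
    simp only [hA, hB, Real.rpow_add_one (norm_ne_zero_iff.mpr hx)]
    ring
  have hφ2 : ∀ x : ℂ, x ≠ 0 → ‖φ x‖ ^ 2 = B x := by
    intro x hx
    rw [hφ x hx, Complex.norm_real, Real.norm_eq_abs, sq_abs, hsq x hx]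
  have hD : ∀ x : ℂ, x ≠ 0 → ‖DopStar a φ x‖ ^ 2 / (1 + lam + ν/‖x‖) =
      (1 - lam) * B x + ν * (c - δ) / (c + δ) * A x := by
    intro x hx
    have hr : 0 < ‖x‖ := norm_pos_iff.mpr hx
    rw [norm_sq_DopStar_of_radial a hx hφ (hasDerivAt_rpow_mul_exp _ _ hr), ← add_mul, mul_pow,
      hsq x hx, hBx x hx, show a = 1/2 - c by linarith, hlam]
    have hpos : 0 < 1 + δ / c + ν / ‖x‖ := by positivity
    rw [div_eq_iff hpos.ne']
    have hνsq : ν ^ 2 = (c - δ) * (c + δ) := by linarith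
    have key : (((δ - 1/2) / ‖x‖ - ν / c + (1/2 - c) / ‖x‖) ^ 2) * (c + δ) =
        (c - δ) * (1 + δ / c + ν / ‖x‖) ^ 2 := by
      field_simp
      grind
    rw [← mul_right_inj' hcδ.ne']
    have : (c + δ) * (((1 - δ / c) * (‖x‖ * A x) + ν * (c - δ) / (c + δ) * A x) *
        (1 + δ / c + ν / ‖x‖)) = (c - δ) * (1 + δ / c + ν / ‖x‖) ^ 2 * (‖x‖ * A x) := by
      field_simp
    rw [this, ← key]
    ring
  have hW : ∀ x : ℂ, x ≠ 0 → ν / ‖x‖ * ‖φ x‖ ^ 2 = ν * A x := by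
    intro x hx
    have hr : ‖x‖ ≠ 0 := norm_ne_zero_iff.mpr hx
    rw [hφ2 x hx, hBx x hx]
    field_simp
  refine ⟨?_, ?_, ?_⟩
  · refine ((hBint.const_mul (1 - lam)).add
      (hAint.const_mul (ν * (c - δ) / (c + δ)))).congr ?_
    filter_upwards [hne] with x hx using (hD x hx).symm
  · refine (hBint.add (hAint.const_mul ν)).congr ?_
    filter_upwards [hne] with x hx
    rw [add_mul, hW x hx, hφ2 x hx, one_mul]
    rfl
  · have hcongr : (fun x : ℂ => ‖DopStar a φ x‖^2 / (1 + lam + ν/‖x‖)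
        + (1 - lam - ν/‖x‖) * ‖φ x‖^2) =ᵐ[volume]
        fun x => 2 * (1 - lam) * B x + (ν * (c - δ) / (c + δ) - ν) * A x := by
      filter_upwards [hne] with x hx
      rw [hD x hx, sub_mul _ (ν / ‖x‖), hW x hx, hφ2 x hx]
      ring
    rw [integral_congr_ae hcongr, integral_add (hBint.const_mul _) (hAint.const_mul _),
      integral_const_mul, integral_const_mul, hBA, hlam, ← mul_assoc, ← add_mul]
    apply mul_eq_zero_of_left
    field_simp
    grind
end
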